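/- For all positive integers A and B there exists N such that the following holds for every finite field 𝔽_q of characteristic p with q > N elements. Let f₁(T,X),…,f_s(T,X) ∈ 𝔽_q[T,X] be irreducible polynomials of total degrees d₁,…,d_s with d₁ + ⋯ + d_s ≤ B, such that for each i: p does not divide d_i(d_i − 1), and the projective plane curve defined by the degree-d_i homogenization F_i ∈ 𝔽_q[x,y,z] of f_i is smooth (F_i, ∂F_i/∂x, ∂F_i/∂y, ∂F_i/∂z have no common nontrivial zero over an algebraic closure of 𝔽_q). Then there exist at least A pairs (a,b) ∈ 𝔽_q² such that all f_i(T, aT + b), i = 1,…,s, are irreducible in 𝔽_q[T]. -/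

import Mathlib

open Polynomial

/-- The degree-`d` homogenization `F ∈ K[x,y,z]` of a polynomial `f ∈ K[T,X]` in two
variables (`x,y,z` being the variables `0,1,2` of `Fin 3`, and `T,X` the variables
`0,1` of `Fin 2`): each monomial `c·T^i X^j` of `f` becomes `c·x^i y^j z^(d-i-j)`. -/
noncomputable def homogenization {K : Type*} [CommSemiring K] (d : ℕ)
    (f : MvPolynomial (Fin 2) K) : MvPolynomial (Fin 3) K :=
  ∑ m ∈ f.support,
    MvPolynomial.monomial
      (Finsupp.single (0 : Fin 3) (m 0) + Finsupp.single 1 (m 1) +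
        Finsupp.single 2 (d - (m 0 + m 1)))
      (MvPolynomial.coeff m f)


namespace BW
section A1
variable {k : Type*} [Field k] {h : k[X][X]}

/-- elements whose coordinates have degree at most `D` -/
def CoordLE (hm : h.Monic) (D : ℕ) (r : AdjoinRoot h) : Prop :=
  ∀ i, ((AdjoinRoot.modByMonicHom hm r).coeff i).natDegree ≤ D

variable (hm : h.Monic)

lemma CoordLE.mono {D D' : ℕ} (hD : D ≤ D') {r : AdjoinRoot h} (hr : CoordLE hm D r) :
    CoordLE hm D' r := fun i => (hr i).trans hD

lemma CoordLE.zero (D : ℕ) : CoordLE hm D 0 := fun i => by simp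

lemma CoordLE.add {D : ℕ} {r s : AdjoinRoot h} (hr : CoordLE hm D r) (hs : CoordLE hm D s) :
    CoordLE hm D (r + s) := fun i => by
  rw [map_add, coeff_add]
  exact (natDegree_add_le _ _).trans (max_le (hr i) (hs i))

lemma CoordLE.sum {ι : Type*} {D : ℕ} {f : ι → AdjoinRoot h} (s : Finset ι)
    (hr : ∀ i ∈ s, CoordLE hm D (f i)) :
    CoordLE hm D (∑ i ∈ s, f i) := by
  classical
  induction s using Finset.induction_on with
  | empty => simpa using CoordLE.zero hm D
  | insert a s ha ih =>
    rw [Finset.sum_insert ha]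
    exact CoordLE.add hm (hr a (Finset.mem_insert_self _ _))
      (ih fun i hi => hr i (Finset.mem_insert_of_mem hi))

lemma CoordLE.of_mul {D : ℕ} {r : AdjoinRoot h} (hr : CoordLE hm D r) (p : k[X]) :
    CoordLE hm (p.natDegree + D) (AdjoinRoot.of h p * r) := fun i => by
  have : AdjoinRoot.of h p * r = p • r := by
    rw [Algebra.smul_def]; rfl
  rw [this, map_smul, coeff_smul, smul_eq_mul]
  exact natDegree_mul_le.trans (by have := hr i; omega)

lemma CoordLE.root_mul {D e : ℕ} (hn : 1 ≤ h.natDegree) (he : ∀ i, (h.coeff i).natDegree ≤ e)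
    {r : AdjoinRoot h} (hr : CoordLE hm D r) :
    CoordLE hm (D + e) (AdjoinRoot.root h * r) := fun i => by
  obtain ⟨p, rfl⟩ := AdjoinRoot.mk_surjective r
  set P := AdjoinRoot.modByMonicHom hm (AdjoinRoot.mk h p) with hP
  have hPm : AdjoinRoot.mk h P = AdjoinRoot.mk h p := AdjoinRoot.mk_leftInverse hm _
  have hPd : P.natDegree < h.natDegree := by
    rw [hP, AdjoinRoot.modByMonicHom_mk]
    apply natDegree_modByMonic_lt _ hm
    rintro rfl; simp at hn
  rw [← hPm, ← AdjoinRoot.mk_X, ← map_mul, AdjoinRoot.modByMonicHom_mk]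
  have key : (X * P) %ₘ h = X * P - C (P.coeff (h.natDegree - 1)) * h := by
    have h1 : X * P = (X * P - C (P.coeff (h.natDegree - 1)) * h)
      + h * C (P.coeff (h.natDegree - 1)) := by ring
    conv_lhs => rw [h1]
    rw [add_modByMonic, (modByMonic_eq_zero_iff_dvd hm).2 (dvd_mul_right _ _), add_zero,
      (modByMonic_eq_self_iff hm).2]
    rw [degree_eq_natDegree hm.ne_zero, degree_lt_iff_coeff_zero]
    intro m hmm
    rw [coeff_sub, coeff_C_mul]
    have hm1 : 1 ≤ m := hn.trans hmm
    obtain ⟨m, rfl⟩ : ∃ m', m = m' + 1 := ⟨m - 1, by omega⟩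
    rw [coeff_X_mul]
    rcases Nat.lt_or_ge (h.natDegree) (m+1) with h2 | h2
    · rw [coeff_eq_zero_of_natDegree_lt h2, coeff_eq_zero_of_natDegree_lt (by omega : P.natDegree < m)]
      simp
    · have : h.natDegree = m + 1 := le_antisymm hmm h2
      rw [← this, hm.coeff_natDegree, this]
      simp
  rw [key, coeff_sub, coeff_C_mul]
  refine (natDegree_sub_le _ _).trans (max_le ?_ ?_)
  · rcases i with _ | i
    · simp
    · rw [coeff_X_mul]
      exact (hr i).trans (by omega)
  · exact natDegree_mul_le.trans (add_le_add (hr _) (he i))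

lemma CoordLE.root_pow_mul {D e : ℕ} (hn : 1 ≤ h.natDegree) (he : ∀ i, (h.coeff i).natDegree ≤ e)
    {r : AdjoinRoot h} (hr : CoordLE hm D r) (a : ℕ) :
    CoordLE hm (D + e * a) (AdjoinRoot.root h ^ a * r) := by
  induction a with
  | zero => simpa using hr
  | succ a ih =>
    rw [pow_succ', mul_assoc]
    have := CoordLE.root_mul hm hn he ih
    convert this using 1
    ring

lemma CoordLE.one (hn : 1 ≤ h.natDegree) : CoordLE hm 0 1 := fun i => by
  rw [← map_one (AdjoinRoot.mk h), AdjoinRoot.modByMonicHom_mk, (modByMonic_eq_self_iff hm).2]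
  · rw [coeff_one]; split_ifs <;> simp
  · rw [degree_one, degree_eq_natDegree hm.ne_zero]; exact_mod_cast hn

lemma CoordLE.monom {e : ℕ} (hn : 1 ≤ h.natDegree) (he : ∀ i, (h.coeff i).natDegree ≤ e)
    (i a : ℕ) : CoordLE hm (i + e * a) (AdjoinRoot.of h X ^ i * AdjoinRoot.root h ^ a) := by
  have h1 := CoordLE.root_pow_mul hm hn he (CoordLE.one hm hn) a
  have h2 := CoordLE.of_mul hm h1 (X ^ i)
  simpa using h2

lemma CoordLE.mul {D D' e : ℕ} (hn : 1 ≤ h.natDegree) (he : ∀ i, (h.coeff i).natDegree ≤ e)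
    {r s : AdjoinRoot h} (hr : CoordLE hm D r) (hs : CoordLE hm D' s) :
    CoordLE hm (D + D' + e * h.natDegree) (r * s) := by
  have hr1 : r = AdjoinRoot.mk h (AdjoinRoot.modByMonicHom hm r) :=
    (AdjoinRoot.mk_leftInverse hm r).symm
  set P := AdjoinRoot.modByMonicHom hm r with hP
  have hPd : P.natDegree < h.natDegree := by
    obtain ⟨p, rfl⟩ := AdjoinRoot.mk_surjective r
    rw [hP, AdjoinRoot.modByMonicHom_mk]
    apply natDegree_modByMonic_lt _ hm
    rintro rfl; simp at hn
  rw [hr1, P.as_sum_range_C_mul_X_pow, map_sum, Finset.sum_mul]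
  apply CoordLE.sum
  intro i hi
  rw [map_mul, map_pow, AdjoinRoot.mk_C, AdjoinRoot.mk_X, mul_assoc]
  have h1 := CoordLE.of_mul hm (CoordLE.root_pow_mul hm hn he hs i) (P.coeff i)
  refine CoordLE.mono hm ?_ h1
  have h2 : e * i ≤ e * h.natDegree := Nat.mul_le_mul_left _ (by
    have := Finset.mem_range.1 hi; omega)
  have := hr i
  rw [← hP] at this
  omega

lemma natDegree_norm_le {D e : ℕ} (hn : 1 ≤ h.natDegree) (he : ∀ i, (h.coeff i).natDegree ≤ e)
    {r : AdjoinRoot h} (hr : CoordLE hm D r) :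
    (Algebra.norm k[X] r).natDegree ≤ h.natDegree * (D + e * h.natDegree) := by
  classical
  rw [Algebra.norm_eq_matrix_det (AdjoinRoot.powerBasisAux' hm)]
  rw [Matrix.det_apply]
  refine natDegree_sum_le_of_forall_le _ _ fun σ _ => ?_
  refine (natDegree_smul_le _ _).trans ?_
  refine (natDegree_prod_le _ _).trans ?_
  refine (Finset.sum_le_card_nsmul _ _ (D + e * h.natDegree) fun i _ => ?_).trans (by simp)
  rw [Algebra.leftMulMatrix_eq_repr_mul, AdjoinRoot.powerBasisAux'_repr_apply_to_fun]
  have h1 : AdjoinRoot.powerBasisAux' hm i = AdjoinRoot.root h ^ (i : ℕ) := by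
    exact (AdjoinRoot.powerBasis' hm).basis_eq_pow i
  rw [h1, mul_comm]
  have := CoordLE.root_pow_mul hm hn he hr i
  refine (this _).trans ?_
  have : e * i ≤ e * h.natDegree := Nat.mul_le_mul_left _ i.2.le
  omega

lemma dvd_norm (hm : h.Monic) (r : AdjoinRoot h) : r ∣ AdjoinRoot.of h (Algebra.norm k[X] r) := by
  classical
  set b := AdjoinRoot.powerBasisAux' hm
  set Mx := Algebra.leftMulMatrix b r with hMx
  have hch := Matrix.aeval_self_charpoly Mx
  have h0 : aeval r Mx.charpoly = 0 := by
    apply Algebra.leftMulMatrix_injective b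
    rw [map_zero, ← Polynomial.aeval_algHom_apply]
    exact hch
  have hN : AdjoinRoot.of h (Algebra.norm k[X] r) = algebraMap k[X] _ (Mx.det) := by
    rw [Algebra.norm_eq_matrix_det b]; rfl
  have h1 : r ∣ algebraMap k[X] (AdjoinRoot h) (Mx.charpoly.coeff 0) := by
    rw [← divX_mul_X_add Mx.charpoly, map_add, map_mul, aeval_X, aeval_C] at h0
    exact ⟨-(aeval r Mx.charpoly.divX), by linear_combination h0⟩
  rw [hN, Matrix.det_eq_sign_charpoly_coeff, map_mul]
  exact h1.mul_left _

lemma norm_ne_zero (hm : h.Monic) (hirr : Irreducible h) {r : AdjoinRoot h} (hr : r ≠ 0) :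
    Algebra.norm k[X] r ≠ 0 := by
  have : Fact (Prime h) := ⟨hirr.prime⟩
  have : IsDomain (AdjoinRoot h) := AdjoinRoot.isDomain_of_prime hirr.prime
  have := hm.free_adjoinRoot
  have := hm.finite_adjoinRoot
  exact Algebra.norm_ne_zero_iff.2 hr

end A1
end BW

namespace BW
section A2

lemma hensel_ps {K : Type*} [Field K] (G : (PowerSeries K)[X]) (hG : G.Monic) (a0 : K)
    (h0 : (G.map PowerSeries.constantCoeff).eval a0 = 0)
    (h1 : (derivative (G.map PowerSeries.constantCoeff)).eval a0 ≠ 0) :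
    ∃ ω : PowerSeries K, G.eval ω = 0 ∧ PowerSeries.constantCoeff ω = a0 := by
  have hH : HenselianRing (PowerSeries K) (Ideal.span {PowerSeries.X}) := inferInstance
  have hc : ∀ P : (PowerSeries K)[X], PowerSeries.constantCoeff (P.eval (PowerSeries.C a0)) =
      (P.map PowerSeries.constantCoeff).eval a0 := by
    intro P
    rw [eval_map, ← eval₂_hom]
    simp
  obtain ⟨ω, hω, hω1⟩ := hH.is_henselian G hG (PowerSeries.C a0) (by
      rw [Ideal.mem_span_singleton, PowerSeries.X_dvd_iff, hc, h0]) (by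
      apply IsUnit.map
      rw [PowerSeries.isUnit_iff_constantCoeff, hc, ← derivative_map]
      exact isUnit_iff_ne_zero.2 h1)
  refine ⟨ω, hω, ?_⟩
  rw [Ideal.mem_span_singleton, PowerSeries.X_dvd_iff, map_sub, sub_eq_zero] at hω1
  simpa using hω1

variable {k : Type*} [Field k] {h : k[X][X]} (hm : h.Monic)

lemma exists_pointHom (hm : h.Monic) (x0 w0 : k) (h0 : (h.map (evalRingHom x0)).eval w0 = 0)
    (h1 : (derivative (h.map (evalRingHom x0))).eval w0 ≠ 0) :
    ∃ φ : AdjoinRoot h →ₐ[k] PowerSeries k,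
      φ (AdjoinRoot.of h X) = PowerSeries.C x0 + PowerSeries.X ∧
      PowerSeries.constantCoeff (φ (AdjoinRoot.root h)) = w0 := by
  set ι : k[X] →ₐ[k] PowerSeries k := aeval (PowerSeries.C x0 + PowerSeries.X) with hι
  have hcomp : (PowerSeries.constantCoeff).comp (ι : k[X] →+* PowerSeries k) = evalRingHom x0 := by
    ext <;> simp [hι]
  obtain ⟨ω, hω, hω1⟩ := hensel_ps (h.map (ι : k[X] →+* PowerSeries k)) (hm.map _) w0
    (by rw [Polynomial.map_map, hcomp]; exact h0) (by rw [Polynomial.map_map, hcomp]; exact h1)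
  rw [eval_map] at hω
  refine ⟨AdjoinRoot.liftAlgHom h ι ω hω, ?_, ?_⟩
  · rw [AdjoinRoot.liftAlgHom_of]; simp [hι]
  · rw [AdjoinRoot.liftAlgHom_root, hω1]

variable (φ : AdjoinRoot h →ₐ[k] PowerSeries k) {x0 w0 : k}

lemma pointHom_of (hφ : φ (AdjoinRoot.of h X) = PowerSeries.C x0 + PowerSeries.X) (p : k[X]) :
    φ (AdjoinRoot.of h p) = ((taylor x0 p : k[X]) : PowerSeries k) := by
  have : φ.comp (AdjoinRoot.ofAlgHom k h) =
      (Polynomial.coeToPowerSeries.algHom (R := k) k).comp (taylorAlgHom x0) := by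
    apply Polynomial.algHom_ext
    simp [hφ, taylor_X, add_comm]
  have := congrArg (fun f => f p) this
  simpa using this

lemma pointHom_order_of (hφ : φ (AdjoinRoot.of h X) = PowerSeries.C x0 + PowerSeries.X) {p : k[X]} (hp : p ≠ 0) {N : ℕ}
    (hN : PowerSeries.X ^ N ∣ φ (AdjoinRoot.of h p)) : N ≤ p.natDegree := by
  rw [pointHom_of φ hφ, PowerSeries.X_pow_dvd_iff] at hN
  by_contra hlt
  push Not at hlt
  have := hN p.natDegree hlt
  rw [Polynomial.coeff_coe, ← natDegree_taylor p x0, coeff_natDegree, leadingCoeff_eq_zero] at this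
  exact hp (by simpa using this)

lemma pointHom_order (hm : h.Monic) (φ : AdjoinRoot h →ₐ[k] PowerSeries k) (hφ : φ (AdjoinRoot.of h X) = PowerSeries.C x0 + PowerSeries.X) {D e : ℕ} (hirr : Irreducible h) (hn : 1 ≤ h.natDegree)
    (he : ∀ i, (h.coeff i).natDegree ≤ e) {r : AdjoinRoot h} (hr0 : r ≠ 0) (hr : CoordLE hm D r)
    {N : ℕ} (hN : PowerSeries.X ^ N ∣ φ r) : N ≤ h.natDegree * (D + e * h.natDegree) := by
  refine le_trans ?_ (natDegree_norm_le hm hn he hr)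
  apply pointHom_order_of φ hφ (norm_ne_zero hm hirr hr0)
  exact hN.trans (map_dvd φ (dvd_norm hm r))

lemma pointHom_injective (hm : h.Monic) (φ : AdjoinRoot h →ₐ[k] PowerSeries k) (hφ : φ (AdjoinRoot.of h X) = PowerSeries.C x0 + PowerSeries.X) (hirr : Irreducible h) : Function.Injective φ := by
  rw [injective_iff_map_eq_zero]
  intro r hr
  by_contra h0
  have := pointHom_order_of φ hφ (norm_ne_zero hm hirr h0)
    (N := (Algebra.norm k[X] r).natDegree + 1)
    (by
      have := map_dvd φ (dvd_norm hm r)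
      rw [hr, zero_dvd_iff] at this
      rw [this]; exact dvd_zero _)
  omega

lemma monom_linInd (hn : 1 ≤ h.natDegree) {A : ℕ} (c : Fin A → Fin h.natDegree → k)
    (hc : ∑ i, ∑ a, c i a • ((AdjoinRoot.of h X) ^ (i : ℕ) * AdjoinRoot.root h ^ (a : ℕ)) = 0) :
    c = 0 := by
  set P : k[X][X] := ∑ a : Fin h.natDegree, C (∑ i : Fin A, C (c i a) * X ^ (i:ℕ)) * X ^ (a:ℕ)
    with hP
  have hPm : AdjoinRoot.mk h P = 0 := by
    rw [← hc, hP, Finset.sum_comm]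
    simp only [map_sum, map_mul, map_pow, AdjoinRoot.mk_C, AdjoinRoot.mk_X, Finset.sum_mul]
    refine Finset.sum_congr rfl fun a _ => Finset.sum_congr rfl fun i _ => ?_
    rw [Algebra.smul_def, mul_assoc]
    rfl
  have hcoef : ∀ a : Fin h.natDegree, P.coeff a = ∑ i : Fin A, C (c i a) * X ^ (i:ℕ) := by
    intro a
    rw [hP, finsetSum_coeff]
    rw [Finset.sum_eq_single a]
    · rw [coeff_C_mul, coeff_X_pow, if_pos rfl, mul_one]
    · intro b _ hb
      rw [coeff_C_mul, coeff_X_pow, if_neg, mul_zero]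
      intro h; exact hb (Fin.ext h.symm)
    · simp
  have hP0 : P = 0 := by
    rw [AdjoinRoot.mk_eq_zero] at hPm
    by_contra h0
    have hdeg : P.degree < h.natDegree := by
      rw [degree_lt_iff_coeff_zero]
      intro m hm'
      rw [hP, finsetSum_coeff]
      refine Finset.sum_eq_zero fun a _ => ?_
      rw [coeff_C_mul, coeff_X_pow, if_neg, mul_zero]
      have := a.2; omega
    have hh : h ≠ 0 := by rintro rfl; simp at hn
    have := degree_le_of_dvd hPm h0
    rw [degree_eq_natDegree hh] at this
    exact absurd this (not_le.2 hdeg)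
  funext i a
  have := congrArg (fun p => p.coeff i) (hcoef a)
  simp only [hP0, coeff_zero, finsetSum_coeff, coeff_C_mul, coeff_X_pow] at this
  rw [Finset.sum_eq_single i] at this
  · simpa using this.symm
  · intro b _ hb
    rw [if_neg, mul_zero]
    intro h; exact hb (Fin.ext h.symm)
  · simp

/-- nonvanishing -/
lemma nonvanish (hm : h.Monic) [Fintype k] {A e : ℕ} (hirr : Irreducible h) (hn : 1 ≤ h.natDegree)
    (he : ∀ i, (h.coeff i).natDegree ≤ e)
    (hq : h.natDegree * (A + 2 * (e * h.natDegree)) < Fintype.card k)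
    (φ : AdjoinRoot h →ₐ[k] PowerSeries k)
    (hφ : φ (AdjoinRoot.of h X) = PowerSeries.C x0 + PowerSeries.X)
    (s : Fin A → Fin h.natDegree → AdjoinRoot h) (hs : s ≠ 0) :
    ∑ i : Fin A, ∑ a : Fin h.natDegree,
      ((AdjoinRoot.of h X) ^ (i : ℕ) * AdjoinRoot.root h ^ (a : ℕ)) * (s i a) ^ (Fintype.card k) ≠ 0 := by
  classical
  intro h0
  set q := Fintype.card k with hqd
  have hinj := pointHom_injective hm φ hφ hirr
  set t : Fin A × Fin h.natDegree → PowerSeries k := fun ia => φ (s ia.1 ia.2) with ht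
  obtain ⟨ia1, hia1⟩ : ∃ ia, t ia ≠ 0 := by
    by_contra hcon
    push Not at hcon
    apply hs
    funext i a
    have := hcon (i, a)
    exact hinj (by simpa [ht] using this)
  obtain ⟨ia0, -, hmin⟩ := Finset.exists_min_image Finset.univ (fun ia => (t ia).order)
    ⟨ia1, Finset.mem_univ _⟩
  have hne0 : t ia0 ≠ 0 := by
    intro h00
    have := hmin ia1 (Finset.mem_univ _)
    rw [h00, PowerSeries.order_zero, top_le_iff, PowerSeries.order_eq_top] at this
    exact hia1 this
  set j := (t ia0).order.toNat with hj
  have hjo : (j : ℕ∞) = (t ia0).order := ENat.natCast_toNat (by rwa [Ne, PowerSeries.order_eq_top])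
  have hdvd : ∀ ia, PowerSeries.X ^ j ∣ t ia := by
    intro ia
    rw [PowerSeries.X_pow_dvd_iff]
    intro m hm'
    apply PowerSeries.coeff_of_lt_order
    refine lt_of_lt_of_le ?_ (hmin ia (Finset.mem_univ _))
    rw [← hjo]; exact_mod_cast hm'
  choose t' ht' using hdvd
  have hc0 : PowerSeries.constantCoeff (t' ia0) ≠ 0 := by
    intro hz
    rw [← PowerSeries.X_dvd_iff] at hz
    have h1 : PowerSeries.X ^ (j+1) ∣ t ia0 := by
      rw [ht' ia0, pow_succ]; exact mul_dvd_mul_left _ hz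
    rw [PowerSeries.X_pow_dvd_iff] at h1
    have := h1 j (Nat.lt_succ_self _)
    exact PowerSeries.coeff_order hne0 (by rw [← hj]; exact this)
  choose t'' ht'' using fun ia =>
    (PowerSeries.X_dvd_iff.2 (show PowerSeries.constantCoeff
      (t' ia - PowerSeries.C (PowerSeries.constantCoeff (t' ia))) = 0 by simp))
  have hfrob : ∀ ia, t' ia ^ q = PowerSeries.C (PowerSeries.constantCoeff (t' ia)) +
      PowerSeries.X ^ q * t'' ia ^ q := by
    intro ia
    have h1 : t' ia = PowerSeries.C (PowerSeries.constantCoeff (t' ia)) +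
      PowerSeries.X * t'' ia := by rw [← ht'']; ring
    have h2 : ∀ z, FiniteField.frobeniusAlgHom k (PowerSeries k) z = z ^ q := fun z => rfl
    conv_lhs => rw [h1]
    rw [← h2, map_add, h2, h2, ← map_pow, FiniteField.pow_card, mul_pow]
  have hsum : ∑ ia : Fin A × Fin h.natDegree,
      φ ((AdjoinRoot.of h X) ^ (ia.1 : ℕ) * AdjoinRoot.root h ^ (ia.2 : ℕ)) * t' ia ^ q = 0 := by
    have h1 := congrArg φ h0
    rw [map_zero, ← Finset.sum_product', map_sum] at h1
    have h2 : (PowerSeries.X : PowerSeries k) ^ (j * q) ≠ 0 := pow_ne_zero _ PowerSeries.X_ne_zero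
    apply mul_left_cancel₀ h2
    rw [mul_zero, ← h1, Finset.mul_sum]
    refine Finset.sum_congr (by simp) fun ia _ => ?_
    rw [map_mul φ (_ * _) (_ ^ _), map_pow φ (s _ _)]
    change _ = _ * (t ia) ^ q
    rw [ht' ia, mul_pow, ← pow_mul]
    ring
  set E : AdjoinRoot h := ∑ i : Fin A, ∑ a : Fin h.natDegree,
    (PowerSeries.constantCoeff (t' (i,a))) •
      ((AdjoinRoot.of h X) ^ (i : ℕ) * AdjoinRoot.root h ^ (a : ℕ)) with hE
  have hE0 : E ≠ 0 := by
    intro hz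
    have := monom_linInd hn _ hz
    exact hc0 (congrFun (congrFun this ia0.1) ia0.2)
  have hEC : CoordLE hm (A + e * h.natDegree) E := by
    refine CoordLE.sum hm _ fun i _ => CoordLE.sum hm _ fun a _ => ?_
    have h1 := CoordLE.of_mul hm (CoordLE.monom hm hn he i a)
      (C (PowerSeries.constantCoeff (t' (i,a))))
    rw [natDegree_C, zero_add] at h1
    rw [Algebra.smul_def]
    refine CoordLE.mono hm ?_ h1
    have := i.2
    have h2 : e * a ≤ e * h.natDegree := Nat.mul_le_mul_left _ a.2.le
    omega
  have hX : PowerSeries.X ^ q ∣ φ E := by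
    have h1 : φ E = ∑ ia : Fin A × Fin h.natDegree,
      φ ((AdjoinRoot.of h X) ^ (ia.1 : ℕ) * AdjoinRoot.root h ^ (ia.2 : ℕ)) *
        PowerSeries.C (PowerSeries.constantCoeff (t' ia)) := by
      rw [hE, ← Finset.sum_product', map_sum]
      refine Finset.sum_congr (by simp) fun ia _ => ?_
      rw [map_smul, PowerSeries.smul_eq_C_mul, mul_comm]
    have h2 : φ E = - (PowerSeries.X ^ q * ∑ ia : Fin A × Fin h.natDegree,
      φ ((AdjoinRoot.of h X) ^ (ia.1 : ℕ) * AdjoinRoot.root h ^ (ia.2 : ℕ)) * t'' ia ^ q) := by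
      rw [eq_neg_iff_add_eq_zero, ← hsum, h1, Finset.mul_sum, ← Finset.sum_add_distrib]
      refine Finset.sum_congr rfl fun ia _ => ?_
      rw [hfrob]; ring
    rw [h2]
    exact (dvd_mul_right _ _).neg_right
  have := pointHom_order hm φ hφ hirr hn he hE0 hEC hX
  have h3 : h.natDegree * (A + e * h.natDegree + e * h.natDegree) =
    h.natDegree * (A + 2 * (e * h.natDegree)) := by ring
  omega

end A2
end BW

namespace BW
section A3

variable {k : Type*} [Field k] {h : k[X][X]} (hm : h.Monic)

lemma finite_quot (hirr : Irreducible h) {Φ : AdjoinRoot h} (hΦ : Φ ≠ 0) (hm : h.Monic) :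
    Module.Finite k (AdjoinRoot h ⧸ Ideal.span {Φ}) := by
  classical
  have hN := norm_ne_zero hm hirr hΦ
  set N := Algebra.norm k[X] Φ
  have := hm.finite_adjoinRoot
  have h1 : Module.Finite k (k[X] ⧸ Ideal.span {N}) :=
    PowerBasis.finite (AdjoinRoot.powerBasis hN)
  -- R / (Φ) is finite over k[X]
  have h2 : Module.Finite k[X] (AdjoinRoot h ⧸ Ideal.span {Φ}) := inferInstance
  obtain ⟨s, hs⟩ := h2.fg_top
  -- linear map from (s → k[X]/N)
  let g : (s → (k[X] ⧸ Ideal.span {N})) →ₗ[k] (AdjoinRoot h ⧸ Ideal.span {Φ}) :=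
    LinearMap.lsum k (fun _ : s => (k[X] ⧸ Ideal.span {N})) k (fun i =>
      (Submodule.liftQ (Ideal.span {N}) (LinearMap.toSpanSingleton k[X] _ (i : AdjoinRoot h ⧸ Ideal.span {Φ})) (by
        rw [Ideal.span, Submodule.span_le, Set.singleton_subset_iff]
        simp only [SetLike.mem_coe, LinearMap.mem_ker, LinearMap.toSpanSingleton_apply]
        obtain ⟨r, hr⟩ := Ideal.Quotient.mk_surjective (i : AdjoinRoot h ⧸ Ideal.span {Φ})
        rw [← hr, ← Ideal.Quotient.mk_eq_mk, ← Submodule.Quotient.mk_smul, Submodule.Quotient.mk_eq_zero,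
          Ideal.mem_span_singleton, Algebra.smul_def]
        exact (dvd_norm hm Φ).mul_right _)).restrictScalars k)
  apply Module.Finite.of_surjective g
  intro z
  have hz : z ∈ Submodule.span k[X] (s : Set (AdjoinRoot h ⧸ Ideal.span {Φ})) := by
    rw [hs]; trivial
  rw [Submodule.mem_span_finset'] at hz
  obtain ⟨f, rfl⟩ := hz
  refine ⟨fun i => Submodule.Quotient.mk (f i), ?_⟩
  simp only [g]
  rw [LinearMap.lsum_apply, LinearMap.sum_apply]
  refine Finset.sum_congr rfl fun i _ => ?_
  simp only [LinearMap.comp_apply, LinearMap.proj_apply, LinearMap.restrictScalars_apply]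
  rfl

lemma zero_count (hm : h.Monic) (hirr : Irreducible h) (S : Finset (k × k))
    (φ : k × k → (AdjoinRoot h →ₐ[k] PowerSeries k))
    (hφ1 : ∀ y ∈ S, φ y (AdjoinRoot.of h X) = PowerSeries.C y.1 + PowerSeries.X)
    (hφ2 : ∀ y ∈ S, PowerSeries.constantCoeff (φ y (AdjoinRoot.root h)) = y.2)
    {Φ : AdjoinRoot h} (hΦ : Φ ≠ 0) (M : ℕ) (hM : ∀ y ∈ S, PowerSeries.X ^ M ∣ φ y Φ) :
    M * S.card ≤ (Algebra.norm k[X] Φ).natDegree := by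
  classical
  have := finite_quot hirr hΦ hm
  have : IsDomain (AdjoinRoot h) := AdjoinRoot.isDomain_of_prime hirr.prime
  rw [← finrank_quotient_span_eq_natDegree_norm (AdjoinRoot.powerBasisAux' hm) hΦ]
  let T0 : AdjoinRoot h →ₗ[k] (S → Fin M → k) :=
    LinearMap.pi fun y => LinearMap.pi fun i => (PowerSeries.coeff (i:ℕ)).comp (φ y).toLinearMap
  have hT0 : ∀ r y i, T0 r y i = PowerSeries.coeff (i:ℕ) (φ y r) := fun r y i => rfl
  let T : (AdjoinRoot h ⧸ Ideal.span {Φ}) →ₗ[k] (S → Fin M → k) :=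
    Submodule.liftQ ((Ideal.span {Φ}).restrictScalars k) T0 (by
      intro r hr
      rw [Submodule.restrictScalars_mem, Ideal.mem_span_singleton] at hr
      rw [LinearMap.mem_ker]
      ext y i
      rw [hT0]
      have h1 := (hM y y.2).trans (map_dvd (φ y) hr)
      rw [PowerSeries.X_pow_dvd_iff] at h1
      exact h1 i i.2)
  have hsurj : Function.Surjective T := by
    intro a
    let I : S → Ideal (AdjoinRoot h) := fun y => Ideal.comap (φ y) (Ideal.span {PowerSeries.X ^ M})
    have hI : ∀ y r, r ∈ I y ↔ PowerSeries.X ^ M ∣ φ y r := fun y r => by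
      simp only [I]; rw [Ideal.mem_comap, Ideal.mem_span_singleton]
    have hx : ∀ y : S, (AdjoinRoot.of h X - algebraMap k _ y.1.1) ^ M ∈ I y := by
      intro y
      rw [hI, map_pow]
      apply pow_dvd_pow_of_dvd
      rw [map_sub, AlgHom.commutes, hφ1 y y.2]
      simp
    have hw : ∀ y : S, (AdjoinRoot.root h - algebraMap k _ y.1.2) ^ M ∈ I y := by
      intro y
      rw [hI, map_pow]
      apply pow_dvd_pow_of_dvd
      rw [PowerSeries.X_dvd_iff, map_sub, AlgHom.commutes, map_sub, hφ2 y y.2]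
      simp
    have hcop : Pairwise (fun y z => IsCoprime (I y) (I z)) := by
      intro y z hyz
      have aux : ∀ (ξ : AdjoinRoot h) (c d : k), c ≠ d → (ξ - algebraMap k _ c) ^ M ∈ I y →
          (ξ - algebraMap k _ d) ^ M ∈ I z → IsCoprime (I y) (I z) := by
        intro ξ c d hcd h1 h2
        have h3 : IsCoprime (ξ - algebraMap k (AdjoinRoot h) c) (ξ - algebraMap k _ d) := by
          refine ⟨algebraMap k _ (-(c - d)⁻¹), algebraMap k _ ((c - d)⁻¹), ?_⟩
          have : (1 : AdjoinRoot h) = algebraMap k _ ((c-d)⁻¹ * (c - d)) := by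
            rw [inv_mul_cancel₀ (sub_ne_zero.2 hcd), map_one]
          rw [this, map_neg, map_mul, map_sub]
          ring
        have h4 := h3.pow (m := M) (n := M)
        rw [Ideal.isCoprime_iff_exists]
        obtain ⟨a, b, hab⟩ := h4
        exact ⟨_, (I y).mul_mem_left a h1, _, (I z).mul_mem_left b h2, hab⟩
      by_cases h1 : y.1.1 = z.1.1
      · have h2 : y.1.2 ≠ z.1.2 := fun h2 => hyz (Subtype.ext (Prod.ext h1 h2))
        exact aux _ _ _ h2 (hw y) (hw z)
      · exact aux _ _ _ h1 (hx y) (hx z)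
    obtain ⟨r, hr⟩ := Ideal.exists_forall_sub_mem_ideal (I := I) hcop
      (fun y => ∑ i : Fin M, a y i • (AdjoinRoot.of h X - algebraMap k _ y.1.1) ^ (i:ℕ))
    refine ⟨Submodule.Quotient.mk r, ?_⟩
    change T0 r = a
    ext y i
    rw [hT0]
    have h1 := (hI _ _).1 (hr y)
    rw [PowerSeries.X_pow_dvd_iff] at h1
    have h2 := h1 i i.2
    rw [map_sub, map_sub, sub_eq_zero] at h2
    rw [h2, map_sum, map_sum]
    rw [Finset.sum_eq_single i]
    · rw [map_smul, map_pow, map_sub, AlgHom.commutes, hφ1 y y.2]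
      simp [PowerSeries.algebraMap_apply, PowerSeries.coeff_X_pow]
    · intro b _ hb
      rw [map_smul, map_pow, map_sub, AlgHom.commutes, hφ1 y y.2]
      have : (i:ℕ) ≠ b := fun h => hb (Fin.ext h.symm)
      simp [PowerSeries.algebraMap_apply, PowerSeries.coeff_X_pow, this]
    · simp
  have h1 := LinearMap.finrank_le_finrank_of_surjective hsurj
  rw [Module.finrank_pi_fintype] at h1
  simp only [Module.finrank_fintype_fun_eq_card, Fintype.card_fin, Finset.sum_const,
    Finset.card_univ, Fintype.card_coe, smul_eq_mul] at h1
  rw [mul_comm]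
  exact h1

end A3
end BW

namespace BW
section A4

variable {k : Type*} [Field k]

/-- monomials in four variables -/
noncomputable def mon4 (k : Type*) [Field k] (i a j b : ℕ) : MvPolynomial (Fin 4) k :=
  MvPolynomial.X 0 ^ i * MvPolynomial.X 1 ^ a * MvPolynomial.X 2 ^ j * MvPolynomial.X 3 ^ b

lemma mon4_eq (m : Fin 4 →₀ ℕ) :
    mon4 k (m 0) (m 1) (m 2) (m 3) = MvPolynomial.monomial m 1 := by
  rw [MvPolynomial.monomial_eq, mon4, Finsupp.prod_fintype _ _ (by simp)]
  simp [Fin.prod_univ_four]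

lemma mon4_mul (i a j b i' a' j' b' : ℕ) :
    mon4 k i a j b * mon4 k i' a' j' b' = mon4 k (i+i') (a+a') (j+j') (b+b') := by
  simp only [mon4, pow_add]; ring

/-- index -/
noncomputable def idx4 (i a j b : ℕ) : Fin 4 →₀ ℕ := Finsupp.equivFunOnFinite.symm ![i, a, j, b]

lemma mon4_eq' (i a j b : ℕ) : mon4 k i a j b = MvPolynomial.basisMonomials (Fin 4) k (idx4 i a j b) := by
  rw [MvPolynomial.coe_basisMonomials]
  change _ = MvPolynomial.monomial _ 1
  rw [← mon4_eq]
  simp [idx4]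

lemma lin4_ext {V : Type*} [AddCommGroup V] [Module k V] (f g : MvPolynomial (Fin 4) k →ₗ[k] V)
    (hfg : ∀ i a j b, f (mon4 k i a j b) = g (mon4 k i a j b)) : f = g := by
  apply (MvPolynomial.basisMonomials (Fin 4) k).ext
  intro m
  rw [MvPolynomial.coe_basisMonomials]
  change f (MvPolynomial.monomial _ 1) = g (MvPolynomial.monomial _ 1)
  rw [← mon4_eq]
  exact hfg _ _ _ _

/-- geometric sum -/
noncomputable def geo4 (x y : MvPolynomial (Fin 4) k) (m : ℕ) : MvPolynomial (Fin 4) k :=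
  ∑ i ∈ Finset.range m, x ^ i * y ^ (m - 1 - i)

lemma geo4_mul (x y : MvPolynomial (Fin 4) k) (m : ℕ) : (x - y) * geo4 x y m = x ^ m - y ^ m := by
  rw [mul_comm]; exact geom_sum₂_mul x y m

/-- divided difference in the third variable -/
noncomputable def al4 (k : Type*) [Field k] : MvPolynomial (Fin 4) k →ₗ[k] MvPolynomial (Fin 4) k :=
  (MvPolynomial.basisMonomials (Fin 4) k).constr k fun m =>
    mon4 k (m 0) (m 1) 0 (m 3) * geo4 (MvPolynomial.X 2) (MvPolynomial.X 0) (m 2)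

/-- divided difference in the fourth variable -/
noncomputable def be4 (k : Type*) [Field k] : MvPolynomial (Fin 4) k →ₗ[k] MvPolynomial (Fin 4) k :=
  (MvPolynomial.basisMonomials (Fin 4) k).constr k fun m =>
    mon4 k (m 0 + m 2) (m 1) 0 0 * geo4 (MvPolynomial.X 3) (MvPolynomial.X 1) (m 3)

lemma al4_mon (i a j b : ℕ) : al4 k (mon4 k i a j b) =
    mon4 k i a 0 b * geo4 (MvPolynomial.X 2) (MvPolynomial.X 0) j := by
  rw [mon4_eq' i a j b, al4, Module.Basis.constr_basis]
  simp [idx4]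

lemma be4_mon (i a j b : ℕ) : be4 k (mon4 k i a j b) =
    mon4 k (i + j) a 0 0 * geo4 (MvPolynomial.X 3) (MvPolynomial.X 1) b := by
  rw [mon4_eq' i a j b, be4, Module.Basis.constr_basis]
  simp [idx4]

/-- diagonal -/
noncomputable def dg4 (k : Type*) [Field k] : MvPolynomial (Fin 4) k →ₐ[k] MvPolynomial (Fin 4) k :=
  MvPolynomial.aeval ![MvPolynomial.X 0, MvPolynomial.X 1, MvPolynomial.X 0, MvPolynomial.X 1]

lemma decomp4 (p : MvPolynomial (Fin 4) k) :
    p = dg4 k p + (MvPolynomial.X 2 - MvPolynomial.X 0) * al4 k p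
      + (MvPolynomial.X 3 - MvPolynomial.X 1) * be4 k p := by
  have : (LinearMap.id : MvPolynomial (Fin 4) k →ₗ[k] _) = (dg4 k).toLinearMap +
      (LinearMap.mulLeft k (MvPolynomial.X 2 - MvPolynomial.X 0)).comp (al4 k) +
      (LinearMap.mulLeft k (MvPolynomial.X 3 - MvPolynomial.X 1)).comp (be4 k) := by
    apply lin4_ext
    intro i a j b
    simp only [LinearMap.id_apply, LinearMap.add_apply, AlgHom.toLinearMap_apply,
      LinearMap.comp_apply, LinearMap.mulLeft_apply, al4_mon, be4_mon]
    rw [mul_left_comm, geo4_mul, mul_left_comm, geo4_mul]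
    simp only [mon4, dg4, map_mul, map_pow, MvPolynomial.aeval_X]
    simp
    ring
  exact congrArg (fun f => f p) this

/-- weighted pieces -/
noncomputable def TW4 (k : Type*) [Field k] (e D : ℕ) : Submodule k (MvPolynomial (Fin 4) k) :=
  Submodule.span k {p | ∃ i a j b, i + j + e * (a + b) ≤ D ∧ p = mon4 k i a j b}

lemma TW4_mono {e D D' : ℕ} (hD : D ≤ D') : TW4 k e D ≤ TW4 k e D' := by
  apply Submodule.span_mono
  rintro p ⟨i, a, j, b, h1, rfl⟩
  exact ⟨i, a, j, b, h1.trans hD, rfl⟩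

lemma mon4_mem {e D i a j b : ℕ} (hD : i + j + e * (a + b) ≤ D) : mon4 k i a j b ∈ TW4 k e D :=
  Submodule.subset_span ⟨i, a, j, b, hD, rfl⟩

lemma TW4_mul {e D D' : ℕ} {p r : MvPolynomial (Fin 4) k} (hp : p ∈ TW4 k e D)
    (hr : r ∈ TW4 k e D') : p * r ∈ TW4 k e (D + D') := by
  have h1 : TW4 k e D * TW4 k e D' ≤ TW4 k e (D + D') := by
    rw [TW4, TW4, Submodule.span_mul_span, Submodule.span_le]
    rintro _ ⟨_, ⟨i, a, j, b, h1, rfl⟩, _, ⟨i', a', j', b', h1', rfl⟩, rfl⟩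
    simp only [mon4_mul]
    apply mon4_mem
    nlinarith
  exact h1 (Submodule.mul_mem_mul hp hr)

lemma TW4_map {e D : ℕ} (f : MvPolynomial (Fin 4) k →ₗ[k] MvPolynomial (Fin 4) k)
    (hf : ∀ i a j b, i + j + e * (a + b) ≤ D → f (mon4 k i a j b) ∈ TW4 k e D)
    {p : MvPolynomial (Fin 4) k} (hp : p ∈ TW4 k e D) : f p ∈ TW4 k e D := by
  have : TW4 k e D ≤ (TW4 k e D).comap f := by
    conv_lhs => rw [TW4]
    rw [Submodule.span_le]
    rintro _ ⟨i, a, j, b, h1, rfl⟩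
    exact hf i a j b h1
  exact this hp

lemma al4_mem {e D : ℕ} {p : MvPolynomial (Fin 4) k} (hp : p ∈ TW4 k e D) : al4 k p ∈ TW4 k e D := by
  refine TW4_map _ ?_ hp
  intro i a j b h1
  rw [al4_mon, geo4, Finset.mul_sum]
  refine Submodule.sum_mem _ fun l hl => ?_
  have : mon4 k i a 0 b * (MvPolynomial.X 2 ^ l * MvPolynomial.X 0 ^ (j - 1 - l)) =
      mon4 k (i + (j-1-l)) a l b := by
    simp only [mon4]; ring
  rw [this]
  apply mon4_mem
  have := Finset.mem_range.1 hl
  omega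

lemma be4_mem {e D : ℕ} {p : MvPolynomial (Fin 4) k} (hp : p ∈ TW4 k e D) : be4 k p ∈ TW4 k e D := by
  refine TW4_map _ ?_ hp
  intro i a j b h1
  rw [be4_mon, geo4, Finset.mul_sum]
  refine Submodule.sum_mem _ fun l hl => ?_
  have : mon4 k (i+j) a 0 0 * (MvPolynomial.X 3 ^ l * MvPolynomial.X 1 ^ (b - 1 - l)) =
      mon4 k (i + j) (a + (b-1-l)) 0 l := by
    simp only [mon4]; ring
  rw [this]
  apply mon4_mem
  have := Finset.mem_range.1 hl
  have h2 : e * (a + (b-1-l) + l) ≤ e * (a + b) := Nat.mul_le_mul_left _ (by omega)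
  omega

/-- the polynomial `h` in the last two variables -/
noncomputable def H4 (h : k[X][X]) : MvPolynomial (Fin 4) k :=
  h.eval₂ (aeval (MvPolynomial.X 2 : MvPolynomial (Fin 4) k) : k[X] →ₐ[k] _).toRingHom
    (MvPolynomial.X 3)

lemma H4_map {A : Type*} [CommRing A] [Algebra k A] (f : MvPolynomial (Fin 4) k →ₐ[k] A) (h : k[X][X]) :
    f (H4 h) = h.eval₂ (aeval (f (MvPolynomial.X 2)) : k[X] →ₐ[k] _).toRingHom
      (f (MvPolynomial.X 3)) := by
  rw [H4]
  change (f : MvPolynomial (Fin 4) k →+* A) _ = _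
  rw [hom_eval₂]
  congr 1
  ext <;> simp

lemma H4_mem {h : k[X][X]} {e : ℕ} (hn : 1 ≤ h.natDegree) (hm : h.Monic)
    (he : ∀ i, (h.coeff i).natDegree ≤ e) : H4 h ∈ TW4 k e (e * h.natDegree) := by
  rw [H4, eval₂_eq_sum_range]
  refine Submodule.sum_mem _ fun a ha => ?_
  have ha' : a ≤ h.natDegree := by have := Finset.mem_range.1 ha; omega
  change (aeval (MvPolynomial.X 2 : MvPolynomial (Fin 4) k) (h.coeff a)) * _ ∈ _
  rw [aeval_eq_sum_range, Finset.sum_mul]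
  refine Submodule.sum_mem _ fun i hi => ?_
  rw [smul_mul_assoc]
  apply Submodule.smul_mem
  have : (MvPolynomial.X 2 : MvPolynomial (Fin 4) k) ^ i * MvPolynomial.X 3 ^ a = mon4 k 0 0 i a := by
    simp [mon4]
  rw [this]
  apply mon4_mem
  have hi' : i ≤ (h.coeff a).natDegree := by have := Finset.mem_range.1 hi; omega
  rcases Nat.lt_or_ge a h.natDegree with h1 | h1
  · have := he a
    have h2 : e * (a + 1) ≤ e * h.natDegree := Nat.mul_le_mul_left _ h1
    rw [mul_add] at h2
    rw [zero_add, zero_add]; omega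
  · have : a = h.natDegree := le_antisymm ha' h1
    subst this
    rw [hm.coeff_natDegree, natDegree_one] at hi'
    simp; omega

lemma H4_be_eval (h : k[X][X]) (x0 w0 : k) :
    MvPolynomial.aeval ![x0, w0, x0, w0] (be4 k (H4 h)) =
      (derivative (h.map (evalRingHom x0))).eval w0 := by
  have hadd : ∀ p r : k[X][X], H4 (p + r) = H4 p + H4 r := fun p r => by
    simp [H4, eval₂_add]
  induction h using Polynomial.induction_on' with
  | add p r hp hr => simp only [hadd, map_add, hp, hr, Polynomial.map_add, eval_add]
  | monomial b c =>
    induction c using Polynomial.induction_on' with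
    | add p r hp hr =>
      simp only [map_add, hadd, hp, hr, Polynomial.map_add, eval_add]
    | monomial j c =>
      have : H4 (monomial b (monomial j c)) = c • mon4 k 0 0 j b := by
        rw [H4, eval₂_monomial]
        change (aeval _ (monomial j c)) * _ = _
        rw [aeval_monomial, mon4, Algebra.smul_def]
        simp [mul_assoc]
      rw [this, map_smul, be4_mon, map_smul, map_mul]
      have hg : MvPolynomial.aeval ![x0, w0, x0, w0]
          (geo4 (MvPolynomial.X 3 : MvPolynomial (Fin 4) k) (MvPolynomial.X 1) b) =
          b * w0 ^ (b - 1) := by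
        rw [geo4, map_sum]
        simp only [map_mul, map_pow, MvPolynomial.aeval_X]
        rw [Finset.sum_congr rfl (g := fun _ => w0 ^ (b-1))]
        · simp
        · intro l hl
          have := Finset.mem_range.1 hl
          simp only [Matrix.cons_val, ← pow_add]
          congr 1; omega
      rw [hg]
      simp [mon4]
      simp [derivative_monomial]
      ring

/-- the operator `L` -/
noncomputable def L4 (h : k[X][X]) : MvPolynomial (Fin 4) k →ₗ[k] MvPolynomial (Fin 4) k :=
  (LinearMap.mulLeft k (be4 k (H4 h))).comp (al4 k) -
    (LinearMap.mulLeft k (al4 k (H4 h))).comp (be4 k)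

lemma L4_mem {h : k[X][X]} {e D : ℕ} (hn : 1 ≤ h.natDegree) (hm : h.Monic)
    (he : ∀ i, (h.coeff i).natDegree ≤ e) {p : MvPolynomial (Fin 4) k} (hp : p ∈ TW4 k e D) :
    L4 h p ∈ TW4 k e (D + e * h.natDegree) := by
  have hH := H4_mem hn hm he
  rw [add_comm]
  exact Submodule.sub_mem _ (TW4_mul (be4_mem hH) (al4_mem hp)) (TW4_mul (al4_mem hH) (be4_mem hp))

lemma L4_pow_mem {h : k[X][X]} {e D : ℕ} (hn : 1 ≤ h.natDegree) (hm : h.Monic)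
    (he : ∀ i, (h.coeff i).natDegree ≤ e) {p : MvPolynomial (Fin 4) k} (hp : p ∈ TW4 k e D) (l : ℕ) :
    (L4 h ^ l) p ∈ TW4 k e (D + e * h.natDegree * l) := by
  induction l with
  | zero => simpa using hp
  | succ l ih =>
    rw [pow_succ', Module.End.mul_apply]
    have := L4_mem hn hm he ih
    convert this using 2
    ring

lemma L4_identity (h : k[X][X]) (p : MvPolynomial (Fin 4) k) :
    be4 k (H4 h) * p = be4 k (H4 h) * dg4 k p + (MvPolynomial.X 2 - MvPolynomial.X 0) * L4 h p +
      (H4 h - dg4 k (H4 h)) * be4 k p := by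
  have h1 := decomp4 p
  have h2 := decomp4 (H4 h)
  simp only [L4, LinearMap.sub_apply, LinearMap.comp_apply, LinearMap.mulLeft_apply]
  linear_combination (be4 k (H4 h)) * h1 - (be4 k p) * h2

variable {h : k[X][X]}

/-- diagonal map to `R` -/
noncomputable def DR4 (h : k[X][X]) : MvPolynomial (Fin 4) k →ₐ[k] AdjoinRoot h :=
  MvPolynomial.aeval ![AdjoinRoot.of h X, AdjoinRoot.root h, AdjoinRoot.of h X, AdjoinRoot.root h]

lemma DR4_coord (hm : h.Monic) {e D : ℕ} (hn : 1 ≤ h.natDegree)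
    (he : ∀ i, (h.coeff i).natDegree ≤ e) {p : MvPolynomial (Fin 4) k} (hp : p ∈ TW4 k e D) :
    CoordLE hm D (DR4 h p) := by
  induction hp using Submodule.span_induction with
  | mem p hp =>
    obtain ⟨i, a, j, b, h1, rfl⟩ := hp
    have : DR4 h (mon4 k i a j b) =
        AdjoinRoot.of h X ^ (i + j) * AdjoinRoot.root h ^ (a + b) := by
      simp [DR4, mon4, pow_add]; ring
    rw [this]
    exact CoordLE.mono hm h1 (CoordLE.monom hm hn he _ _)
  | zero => rw [map_zero]; exact CoordLE.zero hm D
  | add x y _ _ hx hy => rw [map_add]; exact CoordLE.add hm hx hy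
  | smul c x _ hx =>
    rw [map_smul, Algebra.smul_def]
    have := CoordLE.of_mul hm hx (C c)
    rw [natDegree_C, zero_add] at this
    exact this

/-- evaluation at a point -/
noncomputable def ev4 (φ : AdjoinRoot h →ₐ[k] PowerSeries k) (x0 w0 : k) :
    MvPolynomial (Fin 4) k →ₐ[k] PowerSeries k :=
  MvPolynomial.aeval ![φ (AdjoinRoot.of h X), φ (AdjoinRoot.root h), PowerSeries.C x0, PowerSeries.C w0]

lemma ev4_dvd (φ : AdjoinRoot h →ₐ[k] PowerSeries k) (x0 w0 : k)
    (hφ1 : φ (AdjoinRoot.of h X) = PowerSeries.C x0 + PowerSeries.X)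
    (hφ2 : PowerSeries.constantCoeff (φ (AdjoinRoot.root h)) = w0)
    (h0 : (h.map (evalRingHom x0)).eval w0 = 0)
    (h1 : (derivative (h.map (evalRingHom x0))).eval w0 ≠ 0)
    (M : ℕ) (p : MvPolynomial (Fin 4) k) (hp : ∀ l < M, DR4 h ((L4 h ^ l) p) = 0) :
    PowerSeries.X ^ M ∣ ev4 φ x0 w0 p := by
  have hdg : ∀ p, ev4 φ x0 w0 (dg4 k p) = φ (DR4 h p) := by
    intro p
    have : (ev4 φ x0 w0).comp (dg4 k) = φ.comp (DR4 h) := by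
      apply MvPolynomial.algHom_ext
      intro i
      fin_cases i <;> simp [ev4, dg4, DR4]
    exact congrArg (fun f => f p) this
  have hH : ev4 φ x0 w0 (H4 h) = 0 := by
    rw [H4_map]
    have e2 : ev4 φ x0 w0 (MvPolynomial.X 2) = PowerSeries.C x0 := by simp [ev4]
    have e3 : ev4 φ x0 w0 (MvPolynomial.X 3) = PowerSeries.C w0 := by simp [ev4]
    have e4 : (aeval (ev4 φ x0 w0 (MvPolynomial.X 2)) : k[X] →ₐ[k] _).toRingHom =
        (PowerSeries.C).comp (evalRingHom x0) := by
      ext <;> simp [e2]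
    rw [e4, e3, ← eval₂_map, eval₂_at_apply, h0, map_zero]
  have hDH : DR4 h (H4 h) = 0 := by
    rw [H4_map]
    have e2 : DR4 h (MvPolynomial.X 2) = AdjoinRoot.of h X := by simp [DR4]
    have e3 : DR4 h (MvPolynomial.X 3) = AdjoinRoot.root h := by simp [DR4]
    have e4 : (aeval (DR4 h (MvPolynomial.X 2)) : k[X] →ₐ[k] _).toRingHom =
        AdjoinRoot.of h := by
      ext c
      · simp only [AlgHom.toRingHom_eq_coe, RingHom.coe_comp, RingHom.coe_coe,
          Function.comp_apply, aeval_C]; rfl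
      · simp [e2]
    rw [e4, e3]
    exact AdjoinRoot.eval₂_root h
  have hU : IsUnit (ev4 φ x0 w0 (be4 k (H4 h))) := by
    rw [PowerSeries.isUnit_iff_constantCoeff]
    have : PowerSeries.constantCoeff (ev4 φ x0 w0 (be4 k (H4 h))) =
        MvPolynomial.aeval ![x0, w0, x0, w0] (be4 k (H4 h)) := by
      have h4 : (PowerSeries.constantCoeff (R := k)).comp (ev4 φ x0 w0 : MvPolynomial (Fin 4) k →+* _) =
          (MvPolynomial.aeval ![x0, w0, x0, w0] : MvPolynomial (Fin 4) k →ₐ[k] k).toRingHom := by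
        apply MvPolynomial.ringHom_ext
        · intro c; simp [ev4]
        · intro i
          fin_cases i <;> simp [ev4, hφ1, hφ2]
      exact congrArg (fun f => f (be4 k (H4 h))) h4
    rw [this, H4_be_eval]
    exact isUnit_iff_ne_zero.2 h1
  have hstep : ∀ p, DR4 h p = 0 → ev4 φ x0 w0 (be4 k (H4 h)) * ev4 φ x0 w0 p =
      -PowerSeries.X * ev4 φ x0 w0 (L4 h p) := by
    intro p hp
    have := congrArg (ev4 φ x0 w0) (L4_identity h p)
    simp only [map_add, map_mul, map_sub, hdg, hH, hDH, hp, map_zero] at this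
    rw [this]
    have e2 : ev4 φ x0 w0 (MvPolynomial.X 2) = PowerSeries.C x0 := by simp [ev4]
    have e0 : ev4 φ x0 w0 (MvPolynomial.X 0) = PowerSeries.C x0 + PowerSeries.X := by simp [ev4, hφ1]
    rw [e2, e0]; ring
  induction M generalizing p with
  | zero => simp
  | succ M ih =>
    have h5 := hstep p (by simpa using hp 0 (Nat.succ_pos _))
    have h6 := ih (L4 h p) (fun l hl => by
      have := hp (l+1) (Nat.succ_lt_succ hl)
      rwa [pow_succ, Module.End.mul_apply] at this)
    rw [← hU.dvd_mul_left, h5, pow_succ', neg_mul, dvd_neg]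
    exact mul_dvd_mul_left _ h6

end A4
end BW

namespace BW
section A5

variable {k : Type*} [Field k] {h : k[X][X]}

lemma coord_zero (hm : h.Monic) {D : ℕ} {r : AdjoinRoot h} (hr : CoordLE hm D r)
    (h0 : ∀ a < h.natDegree, ∀ t ≤ D, ((AdjoinRoot.modByMonicHom hm r).coeff a).coeff t = 0) :
    r = 0 := by
  have h1 : AdjoinRoot.modByMonicHom hm r = 0 := by
    ext a t
    rw [coeff_zero, coeff_zero]
    rcases Nat.lt_or_ge a h.natDegree with ha | ha
    · rcases Nat.lt_or_ge D t with ht | ht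
      · exact coeff_eq_zero_of_natDegree_lt (lt_of_le_of_lt (hr a) ht)
      · exact h0 a ha t ht
    · obtain ⟨p, rfl⟩ := AdjoinRoot.mk_surjective r
      rw [AdjoinRoot.modByMonicHom_mk]
      have : (p %ₘ h).degree < a := by
        by_cases hh : h = 1
        · subst hh; simp
        · refine (degree_modByMonic_lt p hm).trans_le ?_
          rw [degree_eq_natDegree hm.ne_zero]
          exact_mod_cast ha
      rw [coeff_eq_zero_of_degree_lt this, coeff_zero]
  rw [← AdjoinRoot.mk_leftInverse hm r, h1, map_zero]

lemma U1_core [Fintype k] (hm : h.Monic) (hirr : Irreducible h) (hn : 1 ≤ h.natDegree) {e : ℕ}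
    (he : ∀ i, (h.coeff i).natDegree ≤ e) (A J M : ℕ)
    (hq : h.natDegree * (A + 2 * (e * h.natDegree)) < Fintype.card k)
    (hMq : M ≤ Fintype.card k)
    (hdim : M * (h.natDegree * (A + J + 2 * (e * h.natDegree) + e * h.natDegree * M + 1)) <
      A * (h.natDegree * (J * h.natDegree)))
    (S : Finset (k × k)) (hS : ∀ y ∈ S, (h.map (evalRingHom y.1)).eval y.2 = 0 ∧
      (derivative (h.map (evalRingHom y.1))).eval y.2 ≠ 0) :
    M * S.card ≤ h.natDegree * (A + Fintype.card k * J + e * (h.natDegree + Fintype.card k * h.natDegree)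
      + e * h.natDegree) := by
  classical
  rcases S.eq_empty_or_nonempty with rfl | ⟨y0, hy0⟩
  · simp
  set n := h.natDegree with hnn
  set q := Fintype.card k with hqq
  have hφ : ∀ y : k × k, ∃ φ : AdjoinRoot h →ₐ[k] PowerSeries k, y ∈ S →
      φ (AdjoinRoot.of h X) = PowerSeries.C y.1 + PowerSeries.X ∧
      PowerSeries.constantCoeff (φ (AdjoinRoot.root h)) = y.2 := by
    intro y
    by_cases hy : y ∈ S
    · obtain ⟨φ, h1, h2⟩ := exists_pointHom hm y.1 y.2 (hS y hy).1 (hS y hy).2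
      exact ⟨φ, fun _ => ⟨h1, h2⟩⟩
    · obtain ⟨φ, h1, h2⟩ := exists_pointHom hm y0.1 y0.2 (hS y0 hy0).1 (hS y0 hy0).2
      exact ⟨φ, fun h => absurd h hy⟩
  choose φ hφ using hφ
  set D0 := A + J + 2 * (e * n) with hD0
  set D := D0 + e * n * M with hD
  let I := Fin A × Fin n × Fin J × Fin n
  let Θ : (I → k) →ₗ[k] MvPolynomial (Fin 4) k :=
    Fintype.linearCombination k (fun I : I => mon4 k I.1 I.2.1 I.2.2.1 I.2.2.2)
  have hΘ : ∀ c, Θ c = ∑ I : I, c I • mon4 k I.1 I.2.1 I.2.2.1 I.2.2.2 := fun c =>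
    Fintype.linearCombination_apply k _ c
  have hΘm : ∀ c, Θ c ∈ TW4 k e D0 := by
    intro c
    rw [hΘ]
    refine Submodule.sum_mem _ fun I _ => Submodule.smul_mem _ _ (mon4_mem ?_)
    have h1 := I.1.2; have h2 := I.2.1.2; have h3 := I.2.2.1.2; have h4 := I.2.2.2.2
    have : e * ((I.2.1 : ℕ) + I.2.2.2) ≤ e * (n + n) := Nat.mul_le_mul_left _ (by omega)
    have : e * (n + n) = 2 * (e * n) := by ring
    omega
  let T : (I → k) →ₗ[k] (Fin M × Fin n × Fin (D + 1) → k) :=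
    { toFun := fun c z => ((AdjoinRoot.modByMonicHom hm (DR4 h ((L4 h ^ (z.1 : ℕ)) (Θ c)))).coeff z.2.1).coeff z.2.2
      map_add' := fun c c' => by funext z; simp
      map_smul' := fun r c => by
        funext z
        simp only [map_smul, RingHom.id_apply, Pi.smul_apply]
        have : ∀ x : AdjoinRoot h, r • x = (C r : k[X]) • x := fun x => by
          rw [Algebra.smul_def, Algebra.smul_def]; rfl
        rw [this, map_smul, coeff_smul, smul_eq_mul, coeff_C_mul, smul_eq_mul] }
  have hker : LinearMap.ker T ≠ ⊥ := by
    apply LinearMap.ker_ne_bot_of_finrank_lt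
    simp only [Module.finrank_fintype_fun_eq_card, Fintype.card_prod, Fintype.card_fin, I]
    exact hdim
  obtain ⟨c, hc, hc0⟩ := Submodule.exists_mem_ne_zero_of_ne_bot hker
  have hcond : ∀ l < M, DR4 h ((L4 h ^ l) (Θ c)) = 0 := by
    intro l hl
    have h1 := DR4_coord hm hn he (L4_pow_mem hn hm he (hΘm c) l)
    refine coord_zero hm (D := D) (CoordLE.mono hm ?_ h1) ?_
    · rw [hD]
      exact Nat.add_le_add_left (Nat.mul_le_mul_left _ hl.le) _
    · intro a ha t ht
      exact congrFun (LinearMap.mem_ker.1 hc) (⟨l, hl⟩, ⟨a, ha⟩, ⟨t, by omega⟩)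
  let s : Fin A → Fin n → AdjoinRoot h := fun i a =>
    ∑ j : Fin J, ∑ b : Fin n, c (i, a, j, b) • ((AdjoinRoot.of h X) ^ (j : ℕ) * AdjoinRoot.root h ^ (b : ℕ))
  have hs : s ≠ 0 := by
    intro hs
    apply hc0
    funext ⟨i, a, j, b⟩
    have h1 := monom_linInd hn (fun j b => c (i, a, j, b)) (congrFun (congrFun hs i) a)
    exact congrFun (congrFun h1 j) b
  let Ψ : MvPolynomial (Fin 4) k →ₐ[k] AdjoinRoot h :=
    MvPolynomial.aeval ![AdjoinRoot.of h X, AdjoinRoot.root h, (AdjoinRoot.of h X)^q, (AdjoinRoot.root h)^q]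
  have hΨ : ∀ i a j b, Ψ (mon4 k i a j b) =
      AdjoinRoot.of h X ^ (i + q * j) * AdjoinRoot.root h ^ (a + q * b) := by
    intro i a j b
    simp [Ψ, mon4, pow_add, pow_mul]; ring
  have hΦ : Ψ (Θ c) = ∑ i : Fin A, ∑ a : Fin n,
      ((AdjoinRoot.of h X) ^ (i : ℕ) * AdjoinRoot.root h ^ (a : ℕ)) * (s i a) ^ q := by
    have hf : ∀ i a, (s i a) ^ q = ∑ j : Fin J, ∑ b : Fin n,
        c (i, a, j, b) • ((AdjoinRoot.of h X) ^ (q * j : ℕ) * AdjoinRoot.root h ^ (q * b : ℕ)) := by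
      intro i a
      have : (s i a) ^ q = FiniteField.frobeniusAlgHom k (AdjoinRoot h) (s i a) := by
        rw [FiniteField.coe_frobeniusAlgHom]
      rw [this]
      simp only [s, map_sum, map_smul]
      refine Finset.sum_congr rfl fun j _ => Finset.sum_congr rfl fun b _ => ?_
      rw [FiniteField.coe_frobeniusAlgHom]
      dsimp only
      rw [mul_pow, ← pow_mul, ← pow_mul, mul_comm (j:ℕ), mul_comm (b : ℕ)]
    rw [hΘ, map_sum, Fintype.sum_prod_type]
    refine Finset.sum_congr rfl fun i _ => ?_
    rw [Fintype.sum_prod_type]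
    refine Finset.sum_congr rfl fun a _ => ?_
    rw [Fintype.sum_prod_type, hf, Finset.mul_sum]
    refine Finset.sum_congr rfl fun j _ => ?_
    rw [Finset.mul_sum]
    refine Finset.sum_congr rfl fun b _ => ?_
    rw [map_smul, hΨ, mul_smul_comm]
    congr 1
    ring
  have hΦ0 : Ψ (Θ c) ≠ 0 := by
    rw [hΦ]
    exact nonvanish hm hirr hn he hq (φ y0) (hφ y0 hy0).1 s hs
  have hΦC : CoordLE hm (A + q * J + e * (n + q * n)) (Ψ (Θ c)) := by
    rw [hΘ, map_sum]
    refine CoordLE.sum hm _ fun I _ => ?_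
    rw [map_smul, hΨ, Algebra.smul_def]
    have h1 := CoordLE.of_mul hm (CoordLE.monom hm hn he (I.1 + q * I.2.2.1) (I.2.1 + q * I.2.2.2)) (C (c I))
    rw [natDegree_C, zero_add] at h1
    refine CoordLE.mono hm ?_ h1
    have h1 := I.1.2; have h2 := I.2.1.2; have h3 := I.2.2.1.2; have h4 := I.2.2.2.2
    have g1 : q * (I.2.2.1 : ℕ) ≤ q * J := Nat.mul_le_mul_left _ h3.le
    have g2 : q * (I.2.2.2 : ℕ) ≤ q * n := Nat.mul_le_mul_left _ h4.le
    have g3 : e * (I.2.1 + q * I.2.2.2 : ℕ) ≤ e * (n + q * n) := Nat.mul_le_mul_left _ (by omega)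
    omega
  refine le_trans (zero_count hm hirr S φ (fun y hy => (hφ y hy).1) (fun y hy => (hφ y hy).2) hΦ0 M ?_)
    (natDegree_norm_le hm hn he hΦC)
  intro y hy
  have hev := ev4_dvd (φ y) y.1 y.2 (hφ y hy).1 (hφ y hy).2 (hS y hy).1 (hS y hy).2 M (Θ c) hcond
  have hcong : ∀ p, PowerSeries.X ^ M ∣ φ y (Ψ p) - ev4 (φ y) y.1 y.2 p := by
    intro p
    refine (pow_dvd_pow _ hMq).trans ?_
    have hsub : ∀ r : PowerSeries k, PowerSeries.X ^ q ∣ r ^ q - PowerSeries.C (PowerSeries.constantCoeff r) := by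
      intro r
      have h1 : r ^ q - PowerSeries.C (PowerSeries.constantCoeff r) =
          (r - PowerSeries.C (PowerSeries.constantCoeff r)) ^ q := by
        have := map_sub (FiniteField.frobeniusAlgHom k (PowerSeries k)) r
          (PowerSeries.C (PowerSeries.constantCoeff r))
        simp only [FiniteField.coe_frobeniusAlgHom] at this
        rw [this, ← map_pow, FiniteField.pow_card]
      rw [h1]
      apply pow_dvd_pow_of_dvd
      rw [PowerSeries.X_dvd_iff]
      simp
    rw [← Ideal.mem_span_singleton, ← Ideal.Quotient.mk_eq_mk_iff_sub_mem]
    have : (Ideal.Quotient.mkₐ k (Ideal.span {(PowerSeries.X : PowerSeries k) ^ q})).comp ((φ y).comp Ψ) =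
       (Ideal.Quotient.mkₐ k (Ideal.span {(PowerSeries.X : PowerSeries k) ^ q})).comp (ev4 (φ y) y.1 y.2) := by
      apply MvPolynomial.algHom_ext
      intro i
      simp only [AlgHom.comp_apply, Ideal.Quotient.mkₐ_eq_mk]
      rw [Ideal.Quotient.mk_eq_mk_iff_sub_mem, Ideal.mem_span_singleton]
      fin_cases i
      · simp [Ψ, ev4]
      · simp [Ψ, ev4]
      · have h1 := hsub (φ y (AdjoinRoot.of h X))
        have h2 : PowerSeries.constantCoeff (φ y (AdjoinRoot.of h X)) = y.1 := by
          rw [(hφ y hy).1]; simp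
        rw [h2] at h1
        simpa [Ψ, ev4] using h1
      · have h1 := hsub (φ y (AdjoinRoot.root h))
        rw [(hφ y hy).2] at h1
        simpa [Ψ, ev4] using h1
    exact congrArg (fun f => f p) this
  have := dvd_add (hcong (Θ c)) hev
  simpa using this

theorem U1 (n e m : ℕ) (hn : 1 ≤ n) : ∃ N : ℕ, ∀ (k : Type) [Field k] [Fintype k], N ≤ Fintype.card k →
    ∀ h : k[X][X], h.Monic → Irreducible h → h.natDegree = n → (∀ i, (h.coeff i).natDegree ≤ e) →
    ∀ S : Finset (k × k), (∀ y ∈ S, (h.map (evalRingHom y.1)).eval y.2 = 0 ∧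
      (derivative (h.map (evalRingHom y.1))).eval y.2 ≠ 0) →
    m * S.card ≤ (m + 1) * Fintype.card k := by
  set M0 := m * (3 + e * n) + 1 with hM0
  set c := M0 + 1 + 2 * (e * n) + e * n * (n * M0) + 1 with hc
  refine ⟨n * (M0 * c + 2 * (e * n) + 2) + 2 * (e * n) + n * M0, ?_⟩
  intro k _ _ hN h hm hirr hd he S hS
  set q := Fintype.card k with hq
  obtain ⟨A, hA⟩ : ∃ A, (q - 1) / n = A + 2 * (e * n) := by
    refine ⟨(q-1)/n - 2 * (e * n), ?_⟩
    have : 2 * (e * n) ≤ (q - 1) / n := by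
      rw [Nat.le_div_iff_mul_le (by omega)]
      have : 2 * (e * n) * n ≤ n * (M0 * c + 2 * (e * n) + 1) := by nlinarith [Nat.zero_le (M0 * c)]
      have : n * (M0 * c + 2 * (e * n) + 2) = n * (M0 * c + 2 * (e * n) + 1) + n := by ring
      omega
    omega
  have h1 : n * (A + 2 * (e * n)) ≤ q - 1 := by
    rw [← hA]; exact Nat.mul_div_le _ _
  have h2 : q - 1 < n * (A + 2 * (e * n) + 1) := by
    rw [← hA]; exact Nat.lt_mul_div_succ _ (by omega)
  have h3 : M0 * c < A := by
    by_contra hcon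
    push Not at hcon
    have : n * (A + 2 * (e * n) + 1) ≤ n * (M0 * c + 2 * (e * n) + 1) := Nat.mul_le_mul_left _ (by omega)
    have : n * (M0 * c + 2 * (e * n) + 2) = n * (M0 * c + 2 * (e * n) + 1) + n := by ring
    omega
  have hAq : A ≤ q := by
    have : 1 * (A + 2 * (e * n)) ≤ n * (A + 2 * (e * n)) := Nat.mul_le_mul_right _ hn
    omega
  have := U1_core hm hirr (by omega) he A (M0 + 1) (n * M0) (by
      rw [hd]
      have : 0 < q := Fintype.card_pos
      omega) (by omega)
    (by
      rw [hd]
      have : A + (M0 + 1) + 2 * (e * n) + e * n * (n * M0) + 1 = A + c := by rw [hc]; ring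
      rw [this]
      have h4 : M0 * (A + c) < A * (M0 + 1) := by nlinarith
      have h5 : 0 < n * n := by positivity
      nlinarith) S hS
  rw [hd] at this
  have h6 : M0 * S.card ≤ A + q * (M0 + 1) + e * (n + q * n) + e * n := by
    have h7 : n * (M0 * S.card) ≤ n * (A + q * (M0 + 1) + e * (n + q * n) + e * n) := by
      rw [← mul_assoc]; exact this
    exact Nat.le_of_mul_le_mul_left h7 (by omega)
  have h8 : M0 * S.card ≤ q * (M0 + 3 + e * n) := by
    have : 2 * (e * n) ≤ q := by omega
    nlinarith
  have h9 : M0 * (m * S.card) ≤ M0 * ((m + 1) * q) := by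
    have h10 : m * (M0 * S.card) ≤ m * (q * (M0 + 3 + e * n)) := Nat.mul_le_mul_left _ h8
    have h11 : m * (q * (M0 + 3 + e * n)) = q * (m * M0) + q * (m * (3 + e * n)) := by ring
    have h12 : q * (m * (3 + e * n)) ≤ q * M0 := Nat.mul_le_mul_left _ (by omega)
    calc M0 * (m * S.card) = m * (M0 * S.card) := by ring
      _ ≤ q * (m * M0) + q * M0 := by omega
      _ = M0 * ((m + 1) * q) := by ring
  exact Nat.le_of_mul_le_mul_left h9 (by omega)

end A5
end BW

namespace BW
section B1

variable {k : Type*} [Field k]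

/-- polynomials in `x` over `k[s]` whose `l`-th coefficient has degree at most `l` -/
noncomputable def AA (k : Type*) [Field k] : Subring k[X][X] where
  carrier := {p | ∀ l, (p.coeff l).natDegree ≤ l}
  mul_mem' := by
    intro p r hp hr l
    rw [coeff_mul]
    apply natDegree_sum_le_of_forall_le
    rintro ⟨i, j⟩ hij
    rw [Finset.HasAntidiagonal.mem_antidiagonal] at hij
    have h1 := hp i
    have h2 := hr j
    exact natDegree_mul_le.trans (by simp only at *; omega)
  one_mem' := by
    intro l
    rw [coeff_one]; split_ifs <;> simp
  add_mem' := by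
    intro p r hp hr l
    rw [coeff_add]
    exact (natDegree_add_le _ _).trans (max_le (hp l) (hr l))
  zero_mem' := by intro l; simp
  neg_mem' := by intro p hp l; simpa using hp l

/-- substitution of the pencil of lines through a point -/
noncomputable def ln (a0 b0 : k) : MvPolynomial (Fin 2) k →ₐ[k] k[X][X] :=
  MvPolynomial.aeval ![C (C a0) + X, C (C b0) + C X * X]

lemma CC_mem (c : k) : (C (C c) : k[X][X]) ∈ AA k := by
  intro l
  rw [coeff_C]; split_ifs <;> simp

lemma X_mem : (X : k[X][X]) ∈ AA k := by
  intro l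
  rw [coeff_X]; split_ifs <;> simp

lemma sX_mem : (C X * X : k[X][X]) ∈ AA k := by
  intro l
  rw [coeff_C_mul, coeff_X]; split_ifs with h
  · subst h; simp
  · simp

lemma ln_mem (a0 b0 : k) (p : MvPolynomial (Fin 2) k) : ln a0 b0 p ∈ AA k := by
  induction p using MvPolynomial.induction_on with
  | C a =>
    have : ln a0 b0 (MvPolynomial.C a) = C (C a) := by
      rw [ln, MvPolynomial.aeval_C]; rfl
    rw [this]; exact CC_mem a
  | add p r hp hr => rw [map_add]; exact add_mem hp hr
  | mul_X p i hp =>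
    rw [map_mul]
    refine mul_mem hp ?_
    rw [ln, MvPolynomial.aeval_X]
    fin_cases i
    · exact add_mem (CC_mem _) X_mem
    · exact add_mem (CC_mem _) sX_mem

lemma ln_natDegree (a0 b0 : k) (p : MvPolynomial (Fin 2) k) :
    (ln a0 b0 p).natDegree ≤ p.totalDegree := by
  rw [ln, MvPolynomial.aeval_def, MvPolynomial.eval₂_eq']
  apply natDegree_sum_le_of_forall_le
  intro m hm
  have h1 : ∀ i, (![C (C a0) + X, C (C b0) + C X * X] i : k[X][X]).natDegree ≤ 1 := by
    intro i
    fin_cases i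
    · simp only [Fin.zero_eta, Matrix.cons_val_zero]
      exact (natDegree_add_le _ _).trans (by simp)
    · simp only [Fin.mk_one, Matrix.cons_val_one]
      exact (natDegree_add_le _ _).trans (max_le (by simp) ((natDegree_C_mul_le _ _).trans (by simp)))
  have h2 : m 0 + m 1 ≤ p.totalDegree := by
    have := MvPolynomial.le_totalDegree hm
    rwa [Finsupp.sum_fintype _ _ (by simp), Fin.sum_univ_two] at this
  refine (natDegree_C_mul_le _ _).trans ?_
  rw [Fin.prod_univ_two]
  refine natDegree_mul_le.trans ?_
  have h3 := (natDegree_pow_le (p := (![C (C a0) + X, C (C b0) + C X * X] 0 : k[X][X])) (n := m 0))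
  have h4 := (natDegree_pow_le (p := (![C (C a0) + X, C (C b0) + C X * X] 1 : k[X][X])) (n := m 1))
  have h5 := Nat.mul_le_mul_left (m 0) (h1 0)
  have h6 := Nat.mul_le_mul_left (m 1) (h1 1)
  omega

lemma newton (G : k[X][X][X]) (hG : ∀ i, G.coeff i ∈ AA k) (w0 lam : k)
    (h0 : X ∣ G.eval (C (C w0))) (h1 : X ∣ 1 - C (C lam) * (derivative G).eval (C (C w0))) (t : ℕ) :
    ∃ P ∈ AA k, X ∣ P - C (C w0) ∧ X ^ (t + 1) ∣ G.eval P := by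
  induction t with
  | zero => exact ⟨C (C w0), CC_mem _, by simp, by simpa using h0⟩
  | succ t ih =>
    obtain ⟨P, hP, hP0, hPt⟩ := ih
    have hGP : G.eval P ∈ AA k := by
      rw [eval_eq_sum_range]
      exact sum_mem fun i _ => mul_mem (hG i) (pow_mem hP i)
    refine ⟨P + -(C (C lam) * G.eval P), add_mem hP (neg_mem (mul_mem (CC_mem _) hGP)), ?_, ?_⟩
    · have h2 : X ∣ G.eval P := (dvd_pow_self _ (Nat.succ_ne_zero t)).trans hPt
      have : P + -(C (C lam) * G.eval P) - C (C w0) = (P - C (C w0)) - C (C lam) * G.eval P := by ring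
      rw [this]
      exact dvd_sub hP0 (Dvd.dvd.mul_left h2 _)
    · obtain ⟨c, hc⟩ := Polynomial.binomExpansion G P (-(C (C lam) * G.eval P))
      rw [hc]
      have h3 : X ∣ 1 - C (C lam) * (derivative G).eval P := by
        have h4 := (hP0.trans (sub_dvd_eval_sub P (C (C w0)) (derivative G))).mul_left (C (C lam))
        have := dvd_sub h1 h4
        convert this using 1
        ring
      have e1 : G.eval P + (derivative G).eval P * -(C (C lam) * G.eval P) + c * (-(C (C lam) * G.eval P)) ^ 2
        = (1 - C (C lam) * (derivative G).eval P) * G.eval P + (c * (C (C lam))^2) * (G.eval P) ^ 2 := by ring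
      rw [e1]
      refine dvd_add ?_ (Dvd.dvd.mul_left ?_ _)
      · rw [pow_succ' _ (t+1)]
        exact mul_dvd_mul h3 hPt
      · refine dvd_trans ?_ (pow_dvd_pow_of_dvd hPt 2)
        rw [← pow_mul]
        exact pow_dvd_pow _ (by omega)

end B1
end BW

namespace BW
section B2

lemma minor {F m n : Type*} [Field F] [Fintype m] [DecidableEq m] [Fintype n] (A : Matrix m n F)
    (h : LinearIndependent F A.row) : ∃ c : m → n, (A.submatrix id c).det ≠ 0 := by
  have h1 := h.rank_matrix
  rw [Matrix.rank_eq_finrank_span_cols] at h1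
  obtain ⟨f, hf, -, hli⟩ := Submodule.exists_fun_fin_finrank_span_eq F (Set.range A.col)
  choose c hc using hf
  let e := Fintype.equivFinOfCardEq h1.symm
  refine ⟨c ∘ e, ?_⟩
  have h2 : LinearIndependent F ((A.submatrix id (c ∘ e)).transpose.row) := by
    have : (A.submatrix id (c ∘ e)).transpose.row = f ∘ e := by
      funext i
      have := hc (e i)
      rw [Function.comp, ← this]
      rfl
    rw [this]
    exact hli.comp e e.injective
  rw [Matrix.linearIndependent_rows_iff_isUnit, Matrix.isUnit_iff_isUnit_det, Matrix.det_transpose] at h2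
  exact h2.ne_zero

variable {k : Type*} [Field k]

/-- over the function field of the slope the restricted polynomial stays irreducible -/
lemma HF_irr (H : (MvPolynomial (Fin 2) k)[X]) (hm : H.Monic) (hirr : Irreducible H) (a0 b0 : k) :
    Irreducible ((H.map (ln a0 b0 : MvPolynomial (Fin 2) k →+* k[X][X])).map
      (mapRingHom (algebraMap k[X] (FractionRing k[X])))) := by
  set L := FractionRing (MvPolynomial (Fin 2) k) with hL
  set A : MvPolynomial (Fin 2) k := MvPolynomial.X 0 - MvPolynomial.C a0 with hA
  set B : MvPolynomial (Fin 2) k := MvPolynomial.X 1 - MvPolynomial.C b0 with hB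
  have hA0 : A ≠ 0 := by
    intro h
    have := congrArg (MvPolynomial.eval ![a0 + 1, b0]) h
    simp [hA] at this
  have hAL : algebraMap _ L A ≠ 0 := by
    rw [Ne, FaithfulSMul.algebraMap_eq_zero_iff]; exact hA0
  set t : L := algebraMap _ L B / algebraMap _ L A with ht
  have htr : Transcendental k t := by
    intro halg
    have h1 : IsIntegral (MvPolynomial (Fin 2) k) t := halg.isIntegral.tower_top
    obtain ⟨r, hr⟩ := IsIntegrallyClosed.isIntegral_iff.1 h1
    rw [ht, eq_div_iff hAL, ← map_mul] at hr
    have h2 := FaithfulSMul.algebraMap_injective _ L hr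
    have := congrArg (MvPolynomial.eval ![a0, b0 + 1]) h2
    simp [hA, hB] at this
  have hinj : Function.Injective (aeval t : k[X] →ₐ[k] L) :=
    transcendental_iff_injective.1 htr
  let β0 : FractionRing k[X] →+* L := IsFractionRing.lift (g := (aeval t : k[X] →ₐ[k] L).toRingHom) hinj
  have hβ0 : ∀ p : k[X], β0 (algebraMap _ _ p) = aeval t p := fun p =>
    IsFractionRing.lift_algebraMap hinj p
  let β : (FractionRing k[X])[X] →+* L := eval₂RingHom β0 (algebraMap _ L A)
  have hcomp : (β.comp (mapRingHom (algebraMap k[X] (FractionRing k[X])))).comp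
      (ln a0 b0 : MvPolynomial (Fin 2) k →+* k[X][X]) = algebraMap _ L := by
    apply MvPolynomial.ringHom_ext
    · intro c
      have h1 : ln a0 b0 (MvPolynomial.C c) = C (C c) := by
        rw [ln, MvPolynomial.aeval_C]; rfl
      simp only [RingHom.comp_apply, RingHom.coe_coe, h1, coe_mapRingHom, map_C, β, coe_eval₂RingHom,
        eval₂_C, hβ0, aeval_C]
      rw [IsScalarTower.algebraMap_apply k (MvPolynomial (Fin 2) k) L]; rfl
    · intro i
      have hC : ∀ c : k, algebraMap k L c = algebraMap _ L (MvPolynomial.C c : MvPolynomial (Fin 2) k) := by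
        intro c
        rw [IsScalarTower.algebraMap_apply k (MvPolynomial (Fin 2) k) L]; rfl
      fin_cases i
      · simp [ln, β, hβ0, hA, hC]
      · simp [ln, β, hβ0, hC]
        rw [ht, div_mul_cancel₀ _ hAL, hB]
        simp
  apply Monic.irreducible_of_irreducible_map β _ ((hm.map _).map _)
  rw [Polynomial.map_map, Polynomial.map_map, hcomp]
  exact (hm.irreducible_iff_irreducible_map_fraction_map).1 hirr

/-- uniqueness of approximate simple roots -/
lemma approx {F : Type*} [Field F] (G : (PowerSeries F)[X]) (ω Q : PowerSeries F) (M : ℕ)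
    (h0 : G.eval ω = 0) (hQ : PowerSeries.X ^ M ∣ G.eval Q)
    (hc : PowerSeries.constantCoeff ω = PowerSeries.constantCoeff Q)
    (h1 : PowerSeries.constantCoeff ((derivative G).eval Q) ≠ 0) :
    PowerSeries.X ^ M ∣ ω - Q := by
  obtain ⟨c, hcc⟩ := Polynomial.binomExpansion G Q (ω - Q)
  rw [add_sub_cancel, h0] at hcc
  have h2 : IsUnit ((derivative G).eval Q + c * (ω - Q)) := by
    rw [PowerSeries.isUnit_iff_constantCoeff]
    simp [hc, h1]
  rw [← h2.dvd_mul_left]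
  have : ((derivative G).eval Q + c * (ω - Q)) * (ω - Q) = - G.eval Q := by
    linear_combination -hcc
  rw [this, dvd_neg]
  exact hQ

end B2
end BW

namespace BW
section B3

variable {k : Type*} [Field k]

lemma evm {R S : Type*} [CommRing R] [CommRing S] (f : R →+* S) (p : R[X]) (r : R) :
    (p.map f).eval (f r) = f (p.eval r) := by rw [eval_map, eval₂_at_apply]

lemma evev {R : Type*} [CommRing R] (p : R[X][X]) (Q : R[X]) (z : R) :
    eval z (eval Q p) = (p.map (evalRingHom z)).eval (Q.eval z) := by
  rw [← coe_evalRingHom z, ← evm]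

lemma coeff_swap (p : k[X][X]) (i j : ℕ) :
    ((Bivariate.swap p).coeff i).coeff j = (p.coeff j).coeff i := by
  induction p using Polynomial.induction_on' with
  | add p r hp hr => simp only [map_add, coeff_add, hp, hr]
  | monomial b c =>
    induction c using Polynomial.induction_on' with
    | add p r hp hr => simp only [map_add, coeff_add, hp, hr]
    | monomial a c =>
      rw [Bivariate.swap_monomial_monomial]
      simp only [coeff_monomial]
      split_ifs <;> simp [*, coeff_monomial]

lemma natDegree_swap_le (p : k[X][X]) (e : ℕ) :
    (Bivariate.swap p).natDegree ≤ e ↔ ∀ j, (p.coeff j).natDegree ≤ e := by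
  constructor
  · intro h j
    rw [natDegree_le_iff_coeff_eq_zero]
    intro i hi
    rw [← coeff_swap, coeff_eq_zero_of_natDegree_lt (lt_of_le_of_lt h hi), coeff_zero]
  · intro h
    rw [natDegree_le_iff_coeff_eq_zero]
    intro i hi
    ext j
    rw [coeff_swap, coeff_zero, coeff_eq_zero_of_natDegree_lt (lt_of_le_of_lt (h j) hi)]

lemma factor_deg {f g : k[X][X]} {e : ℕ} (hfg : f * g ≠ 0) (he : ∀ j, ((f * g).coeff j).natDegree ≤ e) :
    ∀ j, (f.coeff j).natDegree ≤ e := by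
  rw [← natDegree_swap_le] at *
  rw [map_mul, natDegree_mul] at he
  · omega
  · intro h0
    rw [map_eq_zero_iff _ (AlgEquiv.injective _)] at h0
    exact hfg (by rw [h0, zero_mul])
  · intro h0
    rw [map_eq_zero_iff _ (AlgEquiv.injective _)] at h0
    exact hfg (by rw [h0, mul_zero])

lemma ln_eval0 (a0 b0 : k) : ((evalRingHom (0 : k[X])).comp (ln a0 b0 : MvPolynomial (Fin 2) k →+* k[X][X])) =
    C.comp (MvPolynomial.eval ![a0, b0]) := by
  apply MvPolynomial.ringHom_ext
  · intro c
    have h1 : ln a0 b0 (MvPolynomial.C c) = C (C c) := by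
      rw [ln, MvPolynomial.aeval_C]; rfl
    simp [h1]
  · intro i
    fin_cases i <;> simp [ln]

lemma map0 {F : Type*} [Field F] (θ : k[X] →+* F) (H : (MvPolynomial (Fin 2) k)[X]) (a0 b0 : k) :
    ((H.map (ln a0 b0 : MvPolynomial (Fin 2) k →+* k[X][X])).map (mapRingHom θ)).map (evalRingHom 0) =
    (H.map (MvPolynomial.eval ![a0, b0])).map (θ.comp C) := by
  rw [Polynomial.map_map, Polynomial.map_map, Polynomial.map_map]
  congr 1
  have h1 : (evalRingHom (0 : F)).comp (mapRingHom θ) = θ.comp (evalRingHom 0) := by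
    ext <;> simp
  rw [h1, RingHom.comp_assoc, ln_eval0, RingHom.comp_assoc]

theorem bertini (H : (MvPolynomial (Fin 2) k)[X]) (hm : H.Monic) (hirr : Irreducible H)
    {n e : ℕ} (hn : 1 ≤ n) (hHn : H.natDegree = n) (he : ∀ i, (H.coeff i).totalDegree ≤ e)
    (a0 b0 w0 : k) (h0 : (H.map (MvPolynomial.eval ![a0, b0])).eval w0 = 0)
    (h1 : (derivative (H.map (MvPolynomial.eval ![a0, b0]))).eval w0 ≠ 0) :
    ∃ Δ : k[X], Δ ≠ 0 ∧ Δ.natDegree ≤ (e + 1) * n * (n * (e + 2 * (e * n)) + 1) ∧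
      ∀ s0, Δ.eval s0 ≠ 0 → Irreducible ((H.map (ln a0 b0 : MvPolynomial (Fin 2) k →+* k[X][X])).map
        (mapRingHom (evalRingHom s0))) := by
  classical
  set Hs := H.map (ln a0 b0 : MvPolynomial (Fin 2) k →+* k[X][X]) with hHs
  set Hab := H.map (MvPolynomial.eval ![a0, b0]) with hHab
  set M := n * (e + 2 * (e * n)) + 1 with hM
  have hHs0 : Hs.map (evalRingHom 0) = Hab.map C := by
    rw [hHs, hHab, Polynomial.map_map, Polynomial.map_map, ln_eval0]
  have hsm : Hs.Monic := hm.map _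
  have hsd : Hs.natDegree = n := by rw [hm.natDegree_map, hHn]
  -- Newton
  obtain ⟨P, hPA, hP0, hPM⟩ := newton Hs (fun i => by rw [hHs, coeff_map]; exact ln_mem a0 b0 _) w0
    ((derivative Hab).eval w0)⁻¹
    (by
      rw [X_dvd_iff, coeff_zero_eq_eval_zero]
      have : eval 0 (eval (C (C w0)) Hs) = (Hs.map (evalRingHom 0)).eval (C w0) := by
        rw [evev, eval_C]
      rw [this, hHs0, evm, h0, map_zero])
    (by
      rw [X_dvd_iff, coeff_zero_eq_eval_zero]
      have : eval 0 (eval (C (C w0)) (derivative Hs)) = ((derivative Hs).map (evalRingHom 0)).eval (C w0) := by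
        rw [evev, eval_C]
      have hd : derivative (Hab.map (C : k →+* k[X])) = (derivative Hab).map C := derivative_map Hab C
      rw [eval_sub, eval_mul, this, ← derivative_map, hHs0, hd, evm]
      rw [eval_C, ← C_mul, inv_mul_cancel₀ h1]
      simp) M
  replace hPM : X ^ M ∣ Hs.eval P := (pow_dvd_pow _ (Nat.le_succ M)).trans hPM
  have hP00 : P.coeff 0 = C w0 := by
    rw [X_dvd_iff] at hP0
    simpa [sub_eq_zero] using hP0
  -- the matrix
  have hcoc : ∀ (F : Type _) [Field F] (p : F[X]) l,
      PowerSeries.coeff l (Polynomial.coeToPowerSeries.ringHom p : PowerSeries F) = p.coeff l := by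
    intro F _ p l; simp
  let Mat : Matrix (Fin (e + 1) × Fin n) (Fin M) k[X] := fun ij l => (X ^ (ij.1 : ℕ) * P ^ (ij.2 : ℕ)).coeff l
  set F := FractionRing k[X]
  set θ : k[X] →+* F := algebraMap k[X] F
  set HF := Hs.map (mapRingHom θ) with hHF
  have hFm : HF.Monic := hsm.map _
  have hFd : HF.natDegree = n := by rw [hsm.natDegree_map, hsd]
  have hFirr : Irreducible HF := HF_irr H hm hirr a0 b0
  have hFe : ∀ i, (HF.coeff i).natDegree ≤ e := by
    intro i
    rw [hHF, coeff_map, coe_mapRingHom]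
    refine natDegree_map_le.trans ?_
    rw [hHs, coeff_map]
    exact (ln_natDegree a0 b0 _).trans (he i)
  have hF0 : HF.map (evalRingHom 0) = Hab.map (θ.comp C) := map0 θ H a0 b0
  have hli : LinearIndependent F (Mat.map θ).row := by
    obtain ⟨φ, hφ1, hφ2⟩ := exists_pointHom hFm 0 (θ (C w0))
      (by
        rw [hF0, ← RingHom.comp_apply, eval_map, eval₂_at_apply, h0, map_zero])
      (by
        rw [hF0, derivative_map, ← RingHom.comp_apply, eval_map, eval₂_at_apply]
        rw [Ne, map_eq_zero]; exact h1)
    set co : F[X] →+* PowerSeries F := Polynomial.coeToPowerSeries.ringHom with hco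
    have hcoX : co X = PowerSeries.X := by simp [hco]
    have hφof : ∀ p : F[X], φ (AdjoinRoot.of HF p) = co p := by
      intro p
      rw [pointHom_of φ hφ1]; simp [hco]
    have happ : PowerSeries.X ^ M ∣ φ (AdjoinRoot.root HF) - co (P.map θ) := by
      refine approx (HF.map co) _ _ M ?_ ?_ ?_ ?_
      · have h3 : (φ : _ →+* PowerSeries F) (HF.eval₂ (AdjoinRoot.of HF) (AdjoinRoot.root HF)) = 0 := by
          rw [AdjoinRoot.eval₂_root, map_zero]
        rw [hom_eval₂] at h3
        rw [eval_map]
        have h4 : (φ : AdjoinRoot HF →+* PowerSeries F).comp (AdjoinRoot.of HF) = co :=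
          RingHom.ext hφof
        rw [h4] at h3
        exact h3
      · rw [eval_map, eval₂_at_apply, hHF, eval_map]
        have : eval₂ (mapRingHom θ) (P.map θ) Hs = (Hs.eval P).map θ := by
          rw [← coe_mapRingHom, eval₂_at_apply]
        rw [this, ← hcoX, ← map_pow]
        apply _root_.map_dvd
        have := _root_.map_dvd (mapRingHom θ) hPM
        simpa using this
      · rw [hφ2]
        have : ∀ p : F[X], PowerSeries.constantCoeff (co p) = p.coeff 0 := by
          intro p; simp [hco]
        rw [this, coeff_map, hP00]
      · rw [derivative_map, eval_map, eval₂_at_apply]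
        have : ∀ p : F[X], PowerSeries.constantCoeff (co p) = p.eval 0 := by
          intro p; rw [← coeff_zero_eq_eval_zero]; simp [hco]
        rw [this]
        have h5 : eval 0 (eval (P.map θ) (derivative HF)) = ((derivative HF).map (evalRingHom 0)).eval ((P.map θ).eval 0) := by
          rw [evev]
        rw [h5, ← derivative_map, hF0, ← coeff_zero_eq_eval_zero, coeff_map, hP00,
          derivative_map, ← RingHom.comp_apply, eval_map, eval₂_at_apply]
        rw [Ne, map_eq_zero]; exact h1
    rw [Fintype.linearIndependent_iff]
    intro g hg
    set r : AdjoinRoot HF := ∑ i : Fin (e+1), ∑ a : Fin HF.natDegree, g (i, Fin.cast hFd a) •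
      ((AdjoinRoot.of HF X) ^ (i : ℕ) * AdjoinRoot.root HF ^ (a : ℕ)) with hr
    have hrC : CoordLE hFm (e + e * n) r := by
      refine CoordLE.sum hFm _ fun i _ => CoordLE.sum hFm _ fun a _ => ?_
      rw [Algebra.smul_def]
      have h1 := CoordLE.of_mul hFm (CoordLE.monom hFm (by omega) hFe i a) (C (g (i, Fin.cast hFd a)))
      rw [natDegree_C, zero_add] at h1
      refine CoordLE.mono hFm ?_ h1
      have h2 := i.2
      have h3 : e * (a : ℕ) ≤ e * n := Nat.mul_le_mul_left _ (by omega)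
      omega
    have hrX : PowerSeries.X ^ M ∣ φ r := by
      have h3 : PowerSeries.X ^ M ∣ ∑ i : Fin (e+1), ∑ a : Fin HF.natDegree, g (i, Fin.cast hFd a) •
        (co X ^ (i : ℕ) * (co (P.map θ)) ^ (a : ℕ)) := by
        rw [PowerSeries.X_pow_dvd_iff]
        intro l hl
        have h4 := congrFun hg ⟨l, hl⟩
        rw [Fintype.sum_prod_type] at h4
        simp only [Finset.sum_apply, Pi.smul_apply, Pi.zero_apply] at h4
        rw [← h4, map_sum]
        refine Finset.sum_congr rfl fun i _ => ?_
        rw [map_sum]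
        refine Fintype.sum_equiv (finCongr hFd) _ _ fun a => ?_
        rw [PowerSeries.coeff_smul, ← map_pow, ← map_pow, ← map_mul]
        rw [finCongr_apply, smul_eq_mul, smul_eq_mul, hco, hcoc]
        congr 1
        change _ = θ ((X ^ (i : ℕ) * P ^ (a : ℕ)).coeff l)
        rw [← coeff_map, Polynomial.map_mul, Polynomial.map_pow, Polynomial.map_pow, map_X]
      have h5 : φ r = ∑ i : Fin (e+1), ∑ a : Fin HF.natDegree, g (i, Fin.cast hFd a) •
        (co X ^ (i : ℕ) * (φ (AdjoinRoot.root HF)) ^ (a : ℕ)) := by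
        simp only [hr, map_sum, map_smul, map_mul, map_pow, hφof]
      have h6 : PowerSeries.X ^ M ∣ φ r - ∑ i : Fin (e+1), ∑ a : Fin HF.natDegree, g (i, Fin.cast hFd a) •
        (co X ^ (i : ℕ) * (co (P.map θ)) ^ (a : ℕ)) := by
        rw [h5, ← Finset.sum_sub_distrib]
        refine Finset.dvd_sum fun i _ => ?_
        rw [← Finset.sum_sub_distrib]
        refine Finset.dvd_sum fun a _ => ?_
        rw [← smul_sub, ← mul_sub]
        apply dvd_smul_of_dvd
        exact Dvd.dvd.mul_left (happ.trans (sub_dvd_pow_sub_pow _ _ _)) _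
      have := dvd_add h6 h3
      simpa using this
    have hr0 : r = 0 := by
      by_contra hr0
      have h7 := pointHom_order hFm φ hφ1 hFirr (by omega) hFe hr0 hrC hrX
      rw [hFd] at h7
      have : e + e * n + e * n = e + 2 * (e * n) := by ring
      rw [this] at h7
      omega
    have h8 := monom_linInd (by omega) (fun i a => g (i, Fin.cast hFd a)) hr0
    rintro ⟨i, a⟩
    have := congrFun (congrFun h8 i) (Fin.cast hFd.symm a)
    simpa using this
  obtain ⟨c, hc⟩ := minor _ hli
  refine ⟨(Mat.submatrix id c).det, ?_, ?_, ?_⟩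
  · intro h
    apply hc
    have : (Mat.map θ).submatrix id c = θ.mapMatrix (Mat.submatrix id c) := rfl
    rw [this, ← RingHom.map_det, h, map_zero]
  · rw [Matrix.det_apply]
    refine natDegree_sum_le_of_forall_le _ _ fun σ _ => ?_
    refine (natDegree_smul_le _ _).trans ?_
    refine (natDegree_prod_le _ _).trans ?_
    refine (Finset.sum_le_card_nsmul _ _ M fun i _ => ?_).trans (by simp)
    have : (X ^ ((σ i).1 : ℕ) * P ^ ((σ i).2 : ℕ)) ∈ AA k := mul_mem (pow_mem X_mem _) (pow_mem hPA _)
    exact (this (c i)).trans (c i).2.le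
  · intro s0 hs0
    set h := Hs.map (mapRingHom (evalRingHom s0)) with hh
    have hhm : h.Monic := hsm.map _
    have hhd : h.natDegree = n := by rw [hsm.natDegree_map, hsd]
    have hhe : ∀ i, (h.coeff i).natDegree ≤ e := by
      intro i
      rw [hh, coeff_map, coe_mapRingHom]
      refine natDegree_map_le.trans ?_
      rw [hHs, coeff_map]
      exact (ln_natDegree a0 b0 _).trans (he i)
    have hh0 : h.map (evalRingHom 0) = Hab := by
      rw [hh, hHs, map0]
      have : (evalRingHom s0).comp C = RingHom.id k := by ext; simp
      rw [this, Polynomial.map_id]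
    set Q := P.map (evalRingHom s0) with hQ
    have hQ0 : Q.eval 0 = w0 := by
      rw [← coeff_zero_eq_eval_zero, hQ, coeff_map, hP00]; simp
    have hQM : X ^ M ∣ h.eval Q := by
      have : h.eval Q = (Hs.eval P).map (evalRingHom s0) := by
        rw [hh, eval_map, hQ, ← coe_mapRingHom, eval₂_at_apply]
      rw [this]
      have := _root_.map_dvd (mapRingHom (evalRingHom s0)) hPM
      simpa using this
    have key : ∀ f g : k[X][X], f.Monic → g.Monic → f * g = h → 0 < g.natDegree →
        (f.map (evalRingHom 0)).eval w0 = 0 → False := by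
      intro f g hf hg hfg hgd hf0
      have hfd : f.natDegree < n := by
        have := hf.natDegree_mul hg
        rw [hfg, hhd] at this; omega
      have hg0 : (g.map (evalRingHom 0)).eval w0 ≠ 0 := by
        intro hg0
        apply h1
        rw [← hh0, ← hfg, Polynomial.map_mul, derivative_mul, eval_add, eval_mul, eval_mul, hf0, hg0]
        simp
      have hev : ∀ p : k[X][X], (p.eval Q).eval 0 = (p.map (evalRingHom 0)).eval w0 := by
        intro p
        rw [evev, hQ0]
      have hXg : ¬ X ∣ g.eval Q := by
        rw [X_dvd_iff, coeff_zero_eq_eval_zero, hev]; exact hg0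
      have hXf : X ^ M ∣ f.eval Q := by
        apply (prime_X).pow_dvd_of_dvd_mul_right M hXg
        rw [← eval_mul, hfg]; exact hQM
      have hfe : ∀ j, (f.coeff j).natDegree ≤ e := by
        apply factor_deg (g := g)
        · rw [hfg]; exact hhm.ne_zero
        · rw [hfg]; exact hhe
      let v : Fin (e + 1) × Fin n → k := fun ij => (f.coeff ij.2).coeff ij.1
      have hv : v = 0 := by
        have hdet : ((evalRingHom s0).mapMatrix (Mat.submatrix id c)).det ≠ 0 := by
          rw [← RingHom.map_det]; exact hs0
        apply Matrix.eq_zero_of_vecMul_eq_zero hdet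
        funext t
        have hft : (f.eval Q).coeff (c t) = 0 := by
          rw [X_pow_dvd_iff] at hXf
          exact hXf _ (c t).2
        have hfQ : f.eval Q = ∑ i : Fin (e+1), ∑ j : Fin n, C (v (i, j)) * (X ^ (i:ℕ) * Q ^ (j:ℕ)) := by
          rw [eval_eq_sum_range' hfd, Finset.sum_comm, ← Fin.sum_univ_eq_sum_range (fun j => f.coeff j * Q ^ j)]
          refine Finset.sum_congr rfl fun j _ => ?_
          conv_lhs => rw [as_sum_range_C_mul_X_pow' (f.coeff j) (Nat.lt_succ_of_le (hfe j))]
          rw [← Fin.sum_univ_eq_sum_range (fun i => C ((f.coeff j).coeff i) * X ^ i), Finset.sum_mul]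
          refine Finset.sum_congr rfl fun i _ => ?_
          simp only [v]; ring
        rw [hfQ] at hft
        simp only [finsetSum_coeff, coeff_C_mul] at hft
        simp only [Matrix.vecMul, dotProduct, Pi.zero_apply]
        rw [Fintype.sum_prod_type, ← hft]
        refine Finset.sum_congr rfl fun i _ => Finset.sum_congr rfl fun j _ => ?_
        congr 1
        change evalRingHom s0 ((X ^ (i : ℕ) * P ^ (j : ℕ)).coeff (c t)) = _
        rw [← coeff_map, Polynomial.map_mul, Polynomial.map_pow, Polynomial.map_pow, map_X]
      have := congrFun hv (0, ⟨f.natDegree, hfd⟩)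
      simp [v, hf.coeff_natDegree] at this
    rw [hhm.irreducible_iff_natDegree]
    refine ⟨fun h1 => by rw [h1, natDegree_one] at hhd; omega, ?_⟩
    intro f g hf hg hfg
    by_contra hcon
    push Not at hcon
    have h3 : (f.map (evalRingHom 0)).eval w0 * (g.map (evalRingHom 0)).eval w0 = 0 := by
      rw [← eval_mul, ← Polynomial.map_mul, hfg, hh0, h0]
    rcases mul_eq_zero.1 h3 with h4 | h4
    · exact key f g hf hg hfg (Nat.pos_of_ne_zero hcon.2) h4
    · exact key g f hg hf (by rw [mul_comm, hfg]) (Nat.pos_of_ne_zero hcon.1) h4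

end B3
end BW

namespace BW

lemma Hs_eval {k : Type*} [Field k] (H : (MvPolynomial (Fin 2) k)[X]) (a0 b0 s x : k) :
    ((H.map (ln a0 b0 : MvPolynomial (Fin 2) k →+* k[X][X])).map
      (mapRingHom (evalRingHom s))).map (evalRingHom x) =
    H.map (MvPolynomial.eval ![a0 + x, b0 + s * x]) := by
  rw [Polynomial.map_map, Polynomial.map_map]
  congr 1
  apply MvPolynomial.ringHom_ext
  · intro r; simp [ln]
  · intro i
    fin_cases i <;> simp [ln]

/-- fibre bound -/
lemma card_fib {k : Type*} [Field k] [DecidableEq k] (H : (MvPolynomial (Fin 2) k)[X]) (hm : H.Monic)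
    (S : Finset (k × k × k))
    (hS : ∀ y ∈ S, (H.map (MvPolynomial.eval ![y.1, y.2.1])).eval y.2.2 = 0)
    (T : Finset (k × k)) (hT : ∀ y ∈ S, (y.1, y.2.1) ∈ T) : S.card ≤ H.natDegree * T.card := by
  classical
  refine Finset.card_le_mul_card_image_of_maps_to (f := fun y : k × k × k => (y.1, y.2.1)) hT _ ?_
  rintro ⟨a, b⟩ -
  have hne : H.map (MvPolynomial.eval ![a, b]) ≠ 0 := (hm.map _).ne_zero
  calc _ ≤ (H.map (MvPolynomial.eval ![a, b])).roots.toFinset.card := by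
        refine Finset.card_le_card_of_injOn (fun y => y.2.2) ?_ ?_
        · rintro ⟨a', b', w⟩ hy
          simp only [Finset.coe_filter, Set.mem_ofPred_eq, Prod.mk.injEq] at hy
          obtain ⟨h1, rfl, rfl⟩ := hy
          simp only [Finset.mem_coe, Multiset.mem_toFinset]
          rw [mem_roots hne]
          exact hS _ h1
        · rintro ⟨a', b', w⟩ hy ⟨a'', b'', w'⟩ hy' h
          simp only [Finset.coe_filter, Set.mem_ofPred_eq, Prod.mk.injEq] at hy hy' h
          simp [hy.2, hy'.2, h]
    _ ≤ _ := (Multiset.toFinset_card_le _).trans ((card_roots' _).trans (by rw [hm.natDegree_map]))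

theorem U2 (n e m : ℕ) (hn : 1 ≤ n) : ∃ N, ∀ (k : Type) [Field k] [Fintype k],
    N ≤ Fintype.card k → ∀ H : (MvPolynomial (Fin 2) k)[X], H.Monic → Irreducible H →
    H.natDegree = n → (∀ i, (H.coeff i).totalDegree ≤ e) → ∀ S : Finset (k × k × k),
    (∀ y ∈ S, (H.map (MvPolynomial.eval ![y.1, y.2.1])).eval y.2.2 = 0 ∧
      (derivative (H.map (MvPolynomial.eval ![y.1, y.2.1]))).eval y.2.2 ≠ 0) →
    m * S.card ≤ (m + 1) * Fintype.card k ^ 2 := by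
  obtain ⟨N, hN⟩ := U1 n e (2 * m) hn
  set D := (e + 1) * n * (n * (e + 2 * (e * n)) + 1) with hD
  refine ⟨max N (2 * m * (n * (D + 1))), ?_⟩
  intro k _ _ hk H hm hirr hHn he S hS
  classical
  rcases S.eq_empty_or_nonempty with rfl | ⟨⟨a0, b0, w0⟩, hy0⟩
  · simp
  obtain ⟨h0, h1⟩ := hS _ hy0
  obtain ⟨Δ, hΔ0, hΔd, hΔ⟩ := bertini H hm hirr hn hHn he a0 b0 w0 h0 h1
  set q := Fintype.card k with hq
  have hqN : N ≤ q := (le_max_left _ _).trans hk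
  have hqm : 2 * m * (n * (D + 1)) ≤ q := (le_max_right _ _).trans hk
  -- vertical part
  have hS0 : (S.filter (fun y => y.1 = a0)).card ≤ n * q := by
    rw [← hHn]
    refine (card_fib H hm _ (fun y hy => (hS y (Finset.mem_of_mem_filter _ hy)).1)
      ({a0} ×ˢ Finset.univ) ?_).trans ?_
    · intro y hy
      simp only [Finset.mem_filter] at hy
      simp [hy.2]
    · rw [Finset.card_product]; simp [hq]
  set sl : k × k × k → k := fun y => (y.2.1 - b0) / (y.1 - a0) with hsl
  set S1 := S.filter (fun y => ¬ y.1 = a0) with hS1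
  have hfl : ∀ y ∈ S1, y.1 ≠ a0 ∧ y.2.1 = b0 + sl y * (y.1 - a0) := by
    intro y hy
    simp only [hS1, Finset.mem_filter] at hy
    refine ⟨hy.2, ?_⟩
    have : y.1 - a0 ≠ 0 := sub_ne_zero.mpr hy.2
    simp only [hsl]; field_simp; ring
  have hbad : ∀ s : k, (S1.filter (fun y => sl y = s)).card ≤ n * q := by
    intro s
    rw [← hHn]
    refine (card_fib H hm _ (fun y hy => (hS y (Finset.mem_of_mem_filter _ (Finset.mem_of_mem_filter _ hy))).1)
      (Finset.univ.image (fun x : k => (x, b0 + s * (x - a0)))) ?_).trans ?_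
    · intro y hy
      rw [Finset.mem_filter] at hy
      have := (hfl y hy.1).2
      rw [hy.2] at this
      simp [this]
    · exact Nat.mul_le_mul_left _ (Finset.card_image_le.trans (by simp [hq]))
  have hgood : ∀ s : k, Δ.eval s ≠ 0 → 2 * m * (S1.filter (fun y => sl y = s)).card ≤ (2 * m + 1) * q := by
    intro s hs
    set Hs := (H.map (ln a0 b0 : MvPolynomial (Fin 2) k →+* k[X][X])).map (mapRingHom (evalRingHom s)) with hHs
    have hsm : Hs.Monic := (hm.map _).map _
    have hcard : (S1.filter (fun y => sl y = s)).card =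
        ((S1.filter (fun y => sl y = s)).image (fun y => (y.1 - a0, y.2.2))).card := by
      rw [Finset.card_image_of_injOn]
      rintro ⟨a, b, w⟩ hy ⟨a', b', w'⟩ hy' h
      simp only [Finset.coe_filter, Set.mem_ofPred_eq] at hy hy'
      have e1 := (hfl _ hy.1).2
      have e2 := (hfl _ hy'.1).2
      rw [hy.2] at e1
      rw [hy'.2] at e2
      simp only [Prod.mk.injEq, sub_left_inj] at h e1 e2 ⊢
      obtain ⟨rfl, rfl⟩ := h
      exact ⟨rfl, by rw [e1, e2], rfl⟩
    rw [hcard]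
    refine hN k hqN Hs hsm (hΔ s hs) ?_ ?_ _ ?_
    · rw [hHs, (hm.map _).natDegree_map, hm.natDegree_map, hHn]
    · intro i
      rw [hHs, coeff_map, coeff_map, coe_mapRingHom]
      exact natDegree_map_le.trans ((ln_natDegree a0 b0 _).trans (he i))
    · intro z hz
      simp only [Finset.mem_image, Finset.mem_filter] at hz
      obtain ⟨y, ⟨hy, hys⟩, rfl⟩ := hz
      have e1 := (hfl _ hy).2
      rw [hys] at e1
      have : Hs.map (evalRingHom (y.1 - a0)) = H.map (MvPolynomial.eval ![y.1, y.2.1]) := by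
        rw [hHs, Hs_eval, ← e1]
        congr 3; ring
      simp only [this]
      exact hS y (Finset.mem_of_mem_filter _ hy)
  have hnb : (Finset.univ.filter (fun s : k => Δ.eval s = 0)).card ≤ D := by
    calc _ ≤ Δ.roots.toFinset.card := by
          apply Finset.card_le_card
          intro s hs
          simp only [Finset.mem_filter, Finset.mem_univ, true_and] at hs
          simp [mem_roots hΔ0, hs]
      _ ≤ _ := (Multiset.toFinset_card_le _).trans ((card_roots' _).trans hΔd)
  have hsum : S1.card = ∑ s : k, (S1.filter (fun y => sl y = s)).card :=
    Finset.card_eq_sum_card_fiberwise (fun _ _ => Finset.mem_univ _)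
  have hS1c : 2 * m * S1.card ≤ (2 * m + 1) * q ^ 2 + 2 * m * (n * q) * D := by
    rw [hsum, Finset.mul_sum, ← Finset.sum_filter_add_sum_filter_not Finset.univ (fun s : k => Δ.eval s = 0), add_comm]
    refine Nat.add_le_add ?_ ?_
    · refine (Finset.sum_le_card_nsmul _ _ ((2 * m + 1) * q) ?_).trans ?_
      · intro s hs
        simp only [Finset.mem_filter, Finset.mem_univ, true_and] at hs
        exact hgood s hs
      · rw [smul_eq_mul]
        have : (Finset.univ.filter (fun s : k => ¬ Δ.eval s = 0)).card ≤ q := Finset.card_le_univ _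
        calc _ ≤ q * ((2 * m + 1) * q) := Nat.mul_le_mul_right _ this
          _ = _ := by ring
    · refine (Finset.sum_le_card_nsmul _ _ (2 * m * (n * q)) ?_).trans ?_
      · intro s hs
        exact Nat.mul_le_mul_left _ (hbad s)
      · rw [smul_eq_mul, mul_comm]
        exact Nat.mul_le_mul_left _ hnb
  have hSc : S.card = (S.filter (fun y => y.1 = a0)).card + S1.card :=
    (Finset.card_filter_add_card_filter_not _).symm
  have h2 : 2 * m * (n * (D + 1)) * q ≤ q * q := Nat.mul_le_mul_right _ hqm
  have h3 : 2 * m * (S.filter (fun y => y.1 = a0)).card ≤ 2 * m * (n * q) := Nat.mul_le_mul_left _ hS0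
  have : 2 * (m * S.card) ≤ 2 * ((m + 1) * q ^ 2) := by
    rw [hSc]; nlinarith
  omega

end BW

namespace BW

/-- coefficient vector of a polynomial with given roots -/
noncomputable def cf {S : Type} [CommRing S] {d : ℕ} (x : Fin d → S) (j : Fin d) : S :=
  (∏ k, (X - C (x k))).coeff j

lemma esymm_cf {R S : Type} [CommRing R] [CommRing S] (φ : R →+* S) {d : ℕ} (x : Fin d → S) (i : Fin d) :
    MvPolynomial.eval₂ φ x (MvPolynomial.esymm (Fin d) R (i + 1)) = (-1) ^ (i.val + 1) * cf x i.rev := by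
  let _ := φ.toAlgebra
  have h1 := MvPolynomial.aeval_esymm_eq_multiset_esymm (Fin d) R (i.val + 1) x
  have h2 := Multiset.prod_X_sub_C_coeff (Finset.univ.val.map x) (k := d - (i.val + 1)) (by simp)
  have h3 : d - (d - (i.val + 1)) = i.val + 1 := by omega
  simp only [Multiset.card_map, Finset.card_val, Finset.card_univ, Fintype.card_fin, h3, Multiset.map_map] at h2
  have h4 : cf x i.rev = (-1) ^ (i.val + 1) * (Finset.univ.val.map x).esymm (i.val + 1) := by
    rw [← h2, cf, Fin.val_rev]; rfl
  rw [h4, ← h1, ← mul_assoc, ← mul_pow]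
  simp [MvPolynomial.aeval_def]; rfl

lemma sym1 {R : Type} [CommRing R] {d : ℕ} (Q : MvPolynomial (Fin d) R) :
    ∃ P : MvPolynomial (Fin d) R, ∀ (S : Type) [CommRing S] (φ : R →+* S) (x : Fin d → S),
      MvPolynomial.eval₂ φ (cf x) P = ∏ π : Equiv.Perm (Fin d), MvPolynomial.eval₂ φ (x ∘ π) Q := by
  have hs : (∏ π : Equiv.Perm (Fin d), MvPolynomial.rename π Q).IsSymmetric := by
    intro e
    rw [map_prod]
    refine Fintype.prod_equiv (Equiv.mulLeft e) _ _ ?_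
    intro π
    rw [MvPolynomial.rename_rename]; rfl
  obtain ⟨P, hP⟩ := MvPolynomial.esymmAlgHom_surjective (σ := Fin d) R (n := d) (by simp) ⟨_, hs⟩
  refine ⟨MvPolynomial.bind₁ (fun i => (-1) ^ (i.val + 1) * MvPolynomial.X i.rev) P, ?_⟩
  intro S _ φ x
  have h1 := congrArg (MvPolynomial.eval₂ φ x) (congrArg Subtype.val hP)
  rw [MvPolynomial.esymmAlgHom_apply] at h1
  simp only [MvPolynomial.eval₂_prod, MvPolynomial.eval₂_rename] at h1
  rw [← h1]
  have e1 : (MvPolynomial.eval₂Hom φ (cf x)).comp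
      (MvPolynomial.bind₁ (fun i => (-1) ^ (i.val + 1) * MvPolynomial.X i.rev) :
        MvPolynomial (Fin d) R →ₐ[R] MvPolynomial (Fin d) R).toRingHom =
      (MvPolynomial.eval₂Hom φ x).comp
      (MvPolynomial.aeval (fun i => MvPolynomial.esymm (Fin d) R (i + 1)) :
        MvPolynomial (Fin d) R →ₐ[R] MvPolynomial (Fin d) R).toRingHom := by
    apply MvPolynomial.ringHom_ext
    · intro r; simp
    · intro i
      have := esymm_cf φ x i
      simpa using this.symm
  exact DFunLike.congr_fun e1 P

theorem symS : ∀ (s : ℕ) (d : Fin s → ℕ) (R : Type) [CommRing R] (Q : MvPolynomial (Σ i, Fin (d i)) R),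
    ∃ P : MvPolynomial (Σ i, Fin (d i)) R, ∀ (S : Type) [CommRing S] (φ : R →+* S)
      (x : ∀ i, Fin (d i) → S),
      MvPolynomial.eval₂ φ (fun p => cf (x p.1) p.2) P =
        ∏ τ : ∀ i, Equiv.Perm (Fin (d i)), MvPolynomial.eval₂ φ (fun p => x p.1 (τ p.1 p.2)) Q := by
  intro s
  induction s with
  | zero =>
    intro d R _ Q
    refine ⟨Q, ?_⟩
    intro S _ φ x
    rw [Fintype.prod_unique]
    congr 1
    ext p
    exact p.1.elim0
  | succ s ih =>
    intro d R _ Q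
    -- split off the zeroth block
    let d' : Fin s → ℕ := fun i => d i.succ
    let v1 : (Σ i, Fin (d i)) → MvPolynomial (Σ i, Fin (d' i)) (MvPolynomial (Fin (d 0)) R) :=
      fun p => Fin.cases (motive := fun i => Fin (d i) → _) (fun j => MvPolynomial.C (MvPolynomial.X j))
        (fun i j => MvPolynomial.X ⟨i, j⟩) p.1 p.2
    let Q1 := MvPolynomial.eval₂ (MvPolynomial.C.comp MvPolynomial.C) v1 Q
    obtain ⟨P1, hP1⟩ := ih d' (MvPolynomial (Fin (d 0)) R) Q1
    let Q2 : MvPolynomial (Fin (d 0)) (MvPolynomial (Σ i, Fin (d' i)) R) :=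
      MvPolynomial.eval₂ (MvPolynomial.eval₂Hom (MvPolynomial.C.comp MvPolynomial.C) MvPolynomial.X)
        (fun p => MvPolynomial.C (MvPolynomial.X p)) P1
    obtain ⟨P2, hP2⟩ := sym1 Q2
    refine ⟨MvPolynomial.eval₂ (MvPolynomial.eval₂Hom (MvPolynomial.C : R →+* MvPolynomial (Σ i, Fin (d i)) R)
      (fun p : Σ i, Fin (d' i) => MvPolynomial.X ⟨p.1.succ, p.2⟩)) (fun j => MvPolynomial.X ⟨0, j⟩) P2, ?_⟩
    intro S _ φ x
    have a1 : MvPolynomial.eval₂ φ (fun p : Σ i, Fin (d i) => cf (x p.1) p.2)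
        (MvPolynomial.eval₂ (MvPolynomial.eval₂Hom (MvPolynomial.C : R →+* MvPolynomial (Σ i, Fin (d i)) R)
      (fun p : Σ i, Fin (d' i) => MvPolynomial.X ⟨p.1.succ, p.2⟩)) (fun j => MvPolynomial.X ⟨0, j⟩) P2) =
      MvPolynomial.eval₂ (MvPolynomial.eval₂Hom φ (fun p : Σ i, Fin (d' i) => cf (x p.1.succ) p.2))
        (cf (x 0)) P2 := by
      have e1 : (MvPolynomial.eval₂Hom φ (fun p : Σ i, Fin (d i) => cf (x p.1) p.2)).comp
        (MvPolynomial.eval₂Hom (MvPolynomial.eval₂Hom MvPolynomial.C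
          (fun p : Σ i, Fin (d' i) => MvPolynomial.X ⟨p.1.succ, p.2⟩)) (fun j => MvPolynomial.X ⟨0, j⟩)) =
        MvPolynomial.eval₂Hom (MvPolynomial.eval₂Hom φ (fun p : Σ i, Fin (d' i) => cf (x p.1.succ) p.2))
        (cf (x 0)) := by
        apply MvPolynomial.ringHom_ext
        · intro r
          have e2 : (MvPolynomial.eval₂Hom φ (fun p : Σ i, Fin (d i) => cf (x p.1) p.2)).comp
            (MvPolynomial.eval₂Hom MvPolynomial.C
              (fun p : Σ i, Fin (d' i) => MvPolynomial.X ⟨p.1.succ, p.2⟩)) =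
              MvPolynomial.eval₂Hom φ (fun p : Σ i, Fin (d' i) => cf (x p.1.succ) p.2) := by
            apply MvPolynomial.ringHom_ext <;> intro r <;> simp
          have := DFunLike.congr_fun e2 r
          simpa using this
        · intro i; simp
      exact DFunLike.congr_fun e1 P2
    rw [a1, hP2]
    have a2 : ∀ π : Equiv.Perm (Fin (d 0)), MvPolynomial.eval₂
        (MvPolynomial.eval₂Hom φ (fun p : Σ i, Fin (d' i) => cf (x p.1.succ) p.2)) (x 0 ∘ π) Q2 =
        MvPolynomial.eval₂ (MvPolynomial.eval₂Hom φ (x 0 ∘ π))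
          (fun p : Σ i, Fin (d' i) => cf (x p.1.succ) p.2) P1 := by
      intro π
      have e1 : (MvPolynomial.eval₂Hom
        (MvPolynomial.eval₂Hom φ (fun p : Σ i, Fin (d' i) => cf (x p.1.succ) p.2)) (x 0 ∘ π)).comp
        (MvPolynomial.eval₂Hom (MvPolynomial.eval₂Hom (MvPolynomial.C.comp MvPolynomial.C) MvPolynomial.X)
        (fun p => MvPolynomial.C (MvPolynomial.X p))) =
        MvPolynomial.eval₂Hom (MvPolynomial.eval₂Hom φ (x 0 ∘ π))
          (fun p : Σ i, Fin (d' i) => cf (x p.1.succ) p.2) := by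
        apply MvPolynomial.ringHom_ext
        · intro r
          have e2 : (MvPolynomial.eval₂Hom
            (MvPolynomial.eval₂Hom φ (fun p : Σ i, Fin (d' i) => cf (x p.1.succ) p.2)) (x 0 ∘ π)).comp
            (MvPolynomial.eval₂Hom (MvPolynomial.C.comp MvPolynomial.C) MvPolynomial.X) =
            MvPolynomial.eval₂Hom φ (x 0 ∘ π) := by
            apply MvPolynomial.ringHom_ext <;> intro r <;> simp
          have := DFunLike.congr_fun e2 r
          simpa using this
        · intro i; simp
      exact DFunLike.congr_fun e1 P1
    simp_rw [a2]
    have a3 := fun π : Equiv.Perm (Fin (d 0)) => hP1 S (MvPolynomial.eval₂Hom φ (x 0 ∘ π)) (fun i => x i.succ)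
    simp_rw [a3]
    rw [← Fintype.prod_prod_type']
    refine Fintype.prod_equiv (Fin.consEquiv (fun i => Equiv.Perm (Fin (d i)))) _ _ ?_
    rintro ⟨π, τ⟩
    have e1 : (MvPolynomial.eval₂Hom (MvPolynomial.eval₂Hom φ (x 0 ∘ π))
        (fun p : Σ i, Fin (d' i) => x p.1.succ (τ p.1 p.2))).comp
        (MvPolynomial.eval₂Hom (MvPolynomial.C.comp MvPolynomial.C) v1) =
        MvPolynomial.eval₂Hom φ (fun p => x p.1 (Fin.consEquiv (fun i => Equiv.Perm (Fin (d i))) (π, τ) p.1 p.2)) := by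
      apply MvPolynomial.ringHom_ext
      · intro r; simp
      · rintro ⟨i, j⟩
        refine Fin.cases ?_ (fun i => ?_) i j
        · intro j; simp [v1, Fin.consEquiv]
        · intro j; simp [v1, Fin.consEquiv]
    exact DFunLike.congr_fun e1 Q

end BW

namespace BW

variable {s : ℕ} {d : Fin s → ℕ}

/-- index set of all roots -/
abbrev Th (d : Fin s → ℕ) : Type := Σ i, Fin (d i)
/-- product of symmetric groups -/
abbrev GG (d : Fin s → ℕ) : Type := ∀ i, Equiv.Perm (Fin (d i))

/-- weighted sum of roots -/
def wt {S : Type} [CommRing S] (θ : Th d → S) (x : ∀ i, Fin (d i) → S) (τ : GG d) : S :=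
  ∑ p : Th d, θ p * x p.1 (τ p.1 p.2)

noncomputable def Pres (d : Fin s → ℕ) : MvPolynomial (Th d) (MvPolynomial (Th d) ℤ)[X] :=
  (symS s d _ (MvPolynomial.C X - ∑ p : Th d,
    MvPolynomial.C (C (MvPolynomial.X p)) * MvPolynomial.X p)).choose

noncomputable def Pdl (d : Fin s → ℕ) : MvPolynomial (Th d) (MvPolynomial (Th d) ℤ) :=
  (symS s d _ (∏ τ' ∈ (Finset.univ : Finset (GG d)).erase 1, ∑ p : Th d,
    MvPolynomial.C (MvPolynomial.X p) * (MvPolynomial.X p - MvPolynomial.X ⟨p.1, τ' p.1 p.2⟩))).choose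

noncomputable def th {S : Type} [CommRing S] (θ : Th d → S) : MvPolynomial (Th d) ℤ →+* S :=
  MvPolynomial.eval₂Hom (Int.castRingHom S) θ

noncomputable def res {S : Type} [CommRing S] (θ v : Th d → S) : S[X] :=
  MvPolynomial.eval₂ (mapRingHom (th θ)) (fun p => C (v p)) (Pres d)

noncomputable def dl {S : Type} [CommRing S] (θ v : Th d → S) : S :=
  MvPolynomial.eval₂ (th θ) v (Pdl d)

lemma cf_map {S S' : Type} [CommRing S] [CommRing S'] (f : S →+* S') {n : ℕ} (x : Fin n → S) (j : Fin n) :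
    cf (f ∘ x) j = f (cf x j) := by
  unfold cf
  rw [← coeff_map, Polynomial.map_prod]
  simp

lemma th_map {S S' : Type} [CommRing S] [CommRing S'] (f : S →+* S') (θ : Th d → S) :
    f.comp (th θ) = th (f ∘ θ) := by
  apply MvPolynomial.ringHom_ext
  · intro r; simp [th]
  · intro r; simp [th]

lemma res_map {S S' : Type} [CommRing S] [CommRing S'] (f : S →+* S') (θ v : Th d → S) :
    (res θ v).map f = res (f ∘ θ) (f ∘ v) := by
  unfold res
  have : (mapRingHom f).comp (MvPolynomial.eval₂Hom (mapRingHom (th θ)) (fun p => C (v p))) =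
    MvPolynomial.eval₂Hom (mapRingHom (th (f ∘ θ))) (fun p => C ((f ∘ v) p)) := by
    rw [← th_map]
    apply MvPolynomial.ringHom_ext
    · intro r; simp
    · intro r; simp
  exact DFunLike.congr_fun this (Pres d)

lemma dl_map {S S' : Type} [CommRing S] [CommRing S'] (f : S →+* S') (θ v : Th d → S) :
    f (dl θ v) = dl (f ∘ θ) (f ∘ v) := by
  unfold dl
  have : f.comp (MvPolynomial.eval₂Hom (th θ) v) =
    MvPolynomial.eval₂Hom (th (f ∘ θ)) (f ∘ v) := by
    rw [← th_map]
    apply MvPolynomial.ringHom_ext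
    · intro r; simp
    · intro r; simp
  exact DFunLike.congr_fun this (Pdl d)

lemma res_cf {S : Type} [CommRing S] (θ : Th d → S) (x : ∀ i, Fin (d i) → S) :
    res θ (fun p => cf (x p.1) p.2) = ∏ τ : GG d, (X - C (wt θ x τ)) := by
  have := (symS s d _ (MvPolynomial.C X - ∑ p : Th d,
    MvPolynomial.C (C (MvPolynomial.X p)) * MvPolynomial.X p)).choose_spec S[X] (mapRingHom (th θ))
      (fun i => C ∘ x i)
  simp only [cf_map] at this
  unfold res Pres
  rw [this]
  refine Finset.prod_congr rfl fun τ _ => ?_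
  simp [MvPolynomial.eval₂_sum, th, wt]

lemma dl_cf {S : Type} [CommRing S] (θ : Th d → S) (x : ∀ i, Fin (d i) → S) :
    dl θ (fun p => cf (x p.1) p.2) =
      ∏ τ : GG d, ∏ τ' ∈ (Finset.univ : Finset (GG d)).erase 1, (wt θ x τ - wt θ x (τ * τ')) := by
  have := (symS s d _ (∏ τ' ∈ (Finset.univ : Finset (GG d)).erase 1, ∑ p : Th d,
    MvPolynomial.C (MvPolynomial.X p) * (MvPolynomial.X p - MvPolynomial.X ⟨p.1, τ' p.1 p.2⟩))).choose_spec
      S (th θ) x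
  unfold dl Pdl
  rw [this]
  refine Finset.prod_congr rfl fun τ _ => ?_
  rw [MvPolynomial.eval₂_prod]
  refine Finset.prod_congr rfl fun τ' _ => ?_
  simp [MvPolynomial.eval₂_sum, th, wt, mul_sub]

lemma wt_ne_of_dl {S : Type} [CommRing S] {θ : Th d → S} {x : ∀ i, Fin (d i) → S}
    (h : dl θ (fun p => cf (x p.1) p.2) ≠ 0) : Function.Injective (wt θ x) := by
  classical
  intro τ τ' hττ
  by_contra hne
  apply h
  rw [dl_cf]
  refine Finset.prod_eq_zero (Finset.mem_univ τ) ?_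
  refine Finset.prod_eq_zero (i := τ⁻¹ * τ') ?_ ?_
  · simp only [Finset.mem_erase, Finset.mem_univ, and_true, ne_eq]
    rw [inv_mul_eq_one]; exact hne
  · simp [hττ]

lemma dl_ne {S : Type} [CommRing S] [IsDomain S] {θ : Th d → S} {x : ∀ i, Fin (d i) → S}
    (h : Function.Injective (wt θ x)) : dl θ (fun p => cf (x p.1) p.2) ≠ 0 := by
  rw [dl_cf, Finset.prod_ne_zero_iff]
  intro τ _
  rw [Finset.prod_ne_zero_iff]
  intro τ' h' h0
  have := h (sub_eq_zero.mp h0)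
  simp only [Finset.mem_erase] at h'
  exact h'.1 (by simpa using this)

lemma inj_of_wt {S : Type} [CommRing S] {θ : Th d → S} {x : ∀ i, Fin (d i) → S}
    (h : Function.Injective (wt θ x)) (i : Fin s) : Function.Injective (x i) := by
  classical
  intro j l hjl
  by_contra hne
  have h1 : wt θ x (Function.update 1 i (Equiv.swap j l)) = wt θ x 1 := by
    unfold wt
    refine Finset.sum_congr rfl ?_
    rintro ⟨i', m⟩ -
    by_cases hi : i' = i
    · subst hi
      simp only [Function.update_self]
      congr 1
      rw [Equiv.swap_apply_def]
      split_ifs with h1 h2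
      · subst h1; exact hjl.symm
      · subst h2; exact hjl
      · rfl
    · simp [Function.update_of_ne hi]
  have h2 := congrFun (h h1) i
  simp only [Function.update_self, Pi.one_apply, Equiv.swap_eq_one_iff] at h2
  exact hne h2

section degree
variable {K : Type} [Field K]

lemma eval₂_totalDegree (P : MvPolynomial (Th d) (MvPolynomial (Th d) ℤ)) (θ : Th d → K)
    (v : Th d → MvPolynomial (Fin 2) K) (e : ℕ) (hv : ∀ p, (v p).totalDegree ≤ e) :
    (MvPolynomial.eval₂ (th (fun p => (MvPolynomial.C (θ p) : MvPolynomial (Fin 2) K))) v P).totalDegree ≤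
      P.totalDegree * e := by
  rw [MvPolynomial.eval₂_eq]
  refine MvPolynomial.totalDegree_finsetSum_le fun m hm => ?_
  refine (MvPolynomial.totalDegree_mul _ _).trans ?_
  have h1 : th (fun p => (MvPolynomial.C (θ p) : MvPolynomial (Fin 2) K)) = MvPolynomial.C.comp (th θ) :=
    (th_map (MvPolynomial.C : K →+* MvPolynomial (Fin 2) K) θ).symm
  rw [h1, RingHom.comp_apply, MvPolynomial.totalDegree_C, zero_add]
  refine (MvPolynomial.totalDegree_finsetProd _ _).trans ?_
  calc _ ≤ ∑ i ∈ m.support, m i * e := Finset.sum_le_sum fun i _ =>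
        (MvPolynomial.totalDegree_pow _ _).trans (Nat.mul_le_mul_left _ (hv i))
    _ = (m.sum fun _ n => n) * e := by rw [Finsupp.sum, Finset.sum_mul]
    _ ≤ _ := Nat.mul_le_mul_right _ (MvPolynomial.le_totalDegree hm)

lemma dl_totalDegree (θ : Th d → K) (v : Th d → MvPolynomial (Fin 2) K) (e : ℕ)
    (hv : ∀ p, (v p).totalDegree ≤ e) :
    (dl (fun p => (MvPolynomial.C (θ p) : MvPolynomial (Fin 2) K)) v).totalDegree ≤ (Pdl d).totalDegree * e :=
  eval₂_totalDegree _ θ v e hv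

lemma res_totalDegree (θ : Th d → K) (v : Th d → MvPolynomial (Fin 2) K) (e : ℕ)
    (hv : ∀ p, (v p).totalDegree ≤ e) (i : ℕ) :
    ((res (fun p => (MvPolynomial.C (θ p) : MvPolynomial (Fin 2) K)) v).coeff i).totalDegree
      ≤ (Pres d).totalDegree * e := by
  unfold res
  rw [MvPolynomial.eval₂_eq, finsetSum_coeff]
  refine MvPolynomial.totalDegree_finsetSum_le fun m hm => ?_
  have h1 : th (fun p => (MvPolynomial.C (θ p) : MvPolynomial (Fin 2) K)) = MvPolynomial.C.comp (th θ) :=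
    (th_map (MvPolynomial.C : K →+* MvPolynomial (Fin 2) K) θ).symm
  have h2 : ∏ i ∈ m.support, (C (v i)) ^ m i = C (∏ i ∈ m.support, v i ^ m i) := by
    rw [map_prod]; simp
  rw [h2, coeff_mul_C]
  refine (MvPolynomial.totalDegree_mul _ _).trans ?_
  rw [coe_mapRingHom, coeff_map]
  rw [h1, RingHom.comp_apply, MvPolynomial.totalDegree_C, zero_add]
  refine (MvPolynomial.totalDegree_finsetProd _ _).trans ?_
  calc _ ≤ ∑ i ∈ m.support, m i * e := Finset.sum_le_sum fun i _ =>
        (MvPolynomial.totalDegree_pow _ _).trans (Nat.mul_le_mul_left _ (hv i))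
    _ = (m.sum fun _ n => n) * e := by rw [Finsupp.sum, Finset.sum_mul]
    _ ≤ _ := Nat.mul_le_mul_right _ (MvPolynomial.le_totalDegree hm)

end degree
end BW

namespace BW

lemma theta_exists (k : Type) [Field k] [Fintype k] (n : ℕ) (σ : Equiv.Perm (Fin n))
    (hn : n * n < Fintype.card k) :
    ∃ θ : Fin n → AlgebraicClosure k, Function.Injective θ ∧
      ∀ j, θ j ^ Fintype.card k = θ (σ j) := by
  classical
  set q := Fintype.card k with hq
  set K := AlgebraicClosure k
  have hq1 : 1 < q := Fintype.one_lt_card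
  obtain ⟨u⟩ : Nonempty (Fin n ↪ k) := Function.Embedding.nonempty_of_card_le (by
    rw [Fintype.card_fin]; nlinarith)
  obtain ⟨m, hm⟩ : ∃ m, orderOf σ = m + 1 := ⟨orderOf σ - 1, by
    have := orderOf_pos σ; omega⟩
  let p : Fin n → Fin n → K[X] := fun j l => ∑ r ∈ Finset.range (m + 1),
    C (algebraMap k K (u ((σ⁻¹ ^ r) j) - u ((σ⁻¹ ^ r) l))) * X ^ (q ^ r)
  have hp0 : ∀ j l, j ≠ l → p j l ≠ 0 := by
    intro j l hjl h0
    have h1 : (p j l).coeff 1 = algebraMap k K (u j - u l) := by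
      simp only [p, finsetSum_coeff, coeff_C_mul, coeff_X_pow]
      rw [Finset.sum_eq_single 0]
      · simp
      · intro r _ hr
        have : 1 ≠ q ^ r := (Nat.one_lt_pow hr hq1).ne
        simp [this]
      · simp
    rw [h0, coeff_zero] at h1
    have := (map_eq_zero _).mp h1.symm
    exact hjl (u.injective (sub_eq_zero.mp this))
  have hpd : ∀ j l, (p j l).natDegree ≤ q ^ m := by
    intro j l
    refine natDegree_sum_le_of_forall_le _ _ fun r hr => ?_
    refine (natDegree_C_mul_X_pow_le _ _).trans (Nat.pow_le_pow_right (by omega) ?_)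
    have := Finset.mem_range.mp hr; omega
  obtain ⟨p0, hp⟩ := CharP.exists k
  have := Fact.mk (CharP.char_is_prime k p0)
  have : CharP K p0 := charP_of_injective_algebraMap (algebraMap k K).injective p0
  obtain ⟨f, hf1, hf⟩ := FiniteField.card k p0
  let S : Finset K := (X ^ (q ^ (m + 1)) - X : K[X]).roots.toFinset
  have hS : S.card = q ^ (m + 1) := by
    have hsep : (X ^ (q ^ (m + 1)) - X : K[X]).Separable := by
      refine galois_poly_separable p0 _ ?_
      rw [hq, hf, ← pow_mul]
      exact dvd_pow_self _ (by positivity)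
    have hqq : 1 < q ^ (m + 1) := Nat.one_lt_pow (by omega) hq1
    rw [Multiset.toFinset_card_of_nodup (nodup_roots hsep)]
    rw [← (IsAlgClosed.splits _).natDegree_eq_card_roots]
    exact FiniteField.X_pow_card_sub_X_natDegree_eq K hqq
  let Bd : Finset K := ((Finset.univ : Finset (Fin n × Fin n)).filter (fun z => z.1 ≠ z.2)).biUnion
    (fun z => (p z.1 z.2).roots.toFinset)
  have hB : Bd.card ≤ (n * n) * q ^ m := by
    refine (Finset.card_biUnion_le_card_mul _ _ (q ^ m) ?_).trans ?_
    · intro z _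
      exact (Multiset.toFinset_card_le _).trans ((card_roots' _).trans (hpd _ _))
    · refine Nat.mul_le_mul_right _ ((Finset.card_le_univ _).trans ?_)
      simp
  have : Bd.card < S.card := by
    rw [hS, pow_succ, mul_comm (q ^ m)]
    exact lt_of_le_of_lt hB (Nat.mul_lt_mul_of_pos_right hn (by positivity))
  obtain ⟨η, hη, hηB⟩ := Finset.exists_mem_notMem_of_card_lt_card this
  have hη' : η ^ q ^ (m + 1) = η := by
    have h1 := (Multiset.mem_toFinset.mp hη)
    have h2 := isRoot_of_mem_roots h1
    simpa [sub_eq_zero] using h2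
  refine ⟨fun j => ∑ r ∈ Finset.range (m + 1), algebraMap k K (u ((σ⁻¹ ^ r) j)) * η ^ q ^ r, ?_, ?_⟩
  · intro j l hjl
    by_contra hne
    apply hηB
    simp only [Bd, Finset.mem_biUnion, Finset.mem_filter, Finset.mem_univ, true_and, Multiset.mem_toFinset]
    refine ⟨(j, l), hne, ?_⟩
    rw [mem_roots (hp0 _ _ hne)]
    simp only [p, IsRoot, eval_finsetSum, eval_mul, eval_C, eval_pow, eval_X]
    simp only [map_sub, sub_mul, Finset.sum_sub_distrib]
    exact sub_eq_zero.mpr hjl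
  · intro j
    have h1 : ∀ z : K, z ^ q = FiniteField.frobeniusAlgHom k K z := by
      intro z; rw [FiniteField.coe_frobeniusAlgHom]
    simp only [h1]
    rw [map_sum]
    simp only [map_mul, AlgHom.commutes]
    simp only [← h1]
    let F : ℕ → K := fun r => algebraMap k K (u ((σ⁻¹ ^ r) (σ j))) * η ^ q ^ r
    have h2 : ∀ r, algebraMap k K (u ((σ⁻¹ ^ r) j)) * (η ^ q ^ r) ^ q = F (r + 1) := by
      intro r
      simp only [F]
      rw [← pow_mul, ← pow_succ, pow_succ σ⁻¹]
      simp
    have h3 : F (m + 1) = F 0 := by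
      simp only [F, hη', pow_zero, pow_one]
      rw [← hm, inv_pow, pow_orderOf_eq_one, inv_one]
    have h4 := Finset.sum_range_succ F (m + 1)
    rw [Finset.sum_range_succ', h3] at h4
    simp only [h2]
    exact add_right_cancel h4

end BW

namespace BW

variable {s : ℕ} {d : Fin s → ℕ}

/-- full monodromy of a family of monic polynomials with coefficients `v` -/
def FullMono {k : Type} [Field k] (v : Th d → MvPolynomial (Fin 2) k) : Prop :=
  ∃ (L : Type) (_ : Field L) (ι : MvPolynomial (Fin 2) (AlgebraicClosure k) →+* L)
    (x : ∀ i, Fin (d i) → L), Function.Injective ι ∧ (∀ i, Function.Injective (x i)) ∧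
    (∀ p : Th d, cf (x p.1) p.2 = ι (MvPolynomial.map (algebraMap k (AlgebraicClosure k)) (v p))) ∧
    ∀ τ : GG d, ∃ γ : L →+* L, γ.comp ι = ι ∧ ∀ i j, γ (x i j) = x i (τ i j)

lemma wt_eq {S : Type} [CommRing S] (θ : Th d → S) (x : ∀ i, Fin (d i) → S) (τ : GG d) :
    wt θ x τ = ∑ p : Th d, θ ⟨p.1, (τ p.1).symm p.2⟩ * x p.1 p.2 := by
  unfold wt
  rw [Fintype.sum_sigma, Fintype.sum_sigma]
  refine Finset.sum_congr rfl fun i _ => ?_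
  rw [← Equiv.sum_comp (τ i) (fun y => θ ⟨i, (τ i).symm y⟩ * x i y)]
  simp

lemma wt_inj {k L : Type} [Field k] [Field L] (ι : MvPolynomial (Fin 2) k →+* L)
    (x : ∀ i, Fin (d i) → L) (hx : ∀ i, Function.Injective (x i))
    (hγ : ∀ τ : GG d, ∃ γ : L →+* L, γ.comp ι = ι ∧ ∀ i j, γ (x i j) = x i (τ i j))
    (hd : ∀ i, (d i : L) ≠ 0)
    (θ : Th d → k) (hθ : ∀ i, Function.Injective (fun j => θ ⟨i, j⟩)) :
    Function.Injective (wt (fun p => ι (MvPolynomial.C (θ p))) x) := by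
  classical
  have hιC : Function.Injective (fun z => ι (MvPolynomial.C z)) := (ι.comp MvPolynomial.C).injective
  intro τ τ' h
  let A : Th d → L := fun p => ι (MvPolynomial.C (θ ⟨p.1, (τ p.1).symm p.2⟩)) -
    ι (MvPolynomial.C (θ ⟨p.1, (τ' p.1).symm p.2⟩))
  have hA : ∑ p : Th d, A p * x p.1 p.2 = 0 := by
    simp only [A, sub_mul, Finset.sum_sub_distrib]
    rw [← wt_eq (fun p => ι (MvPolynomial.C (θ p))), ← wt_eq (fun p => ι (MvPolynomial.C (θ p))), h, sub_self]
  have hAρ : ∀ ρ : GG d, ∑ p : Th d, A p * x p.1 (ρ p.1 p.2) = 0 := by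
    intro ρ
    obtain ⟨γ, h1, h2⟩ := hγ ρ
    have h3 : ∀ z, γ (ι z) = ι z := fun z => DFunLike.congr_fun h1 z
    have := congrArg γ hA
    simpa [A, map_sum, h3, h2] using this
  have hc : ∀ i j l, A ⟨i, j⟩ = A ⟨i, l⟩ := by
    intro i j l
    by_cases hjl : j = l
    · rw [hjl]
    have h1 := hAρ (Function.update 1 i (Equiv.swap j l))
    have h2 : ∑ p : Th d, A p * (x p.1 p.2 - x p.1 ((Function.update 1 i (Equiv.swap j l) : GG d) p.1 p.2)) = 0 := by
      simp only [mul_sub, Finset.sum_sub_distrib, hA, h1, sub_zero]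
    rw [Fintype.sum_eq_add (⟨i, j⟩ : Th d) ⟨i, l⟩ (by simpa using hjl)] at h2
    · simp only [Function.update_self, Equiv.swap_apply_left, Equiv.swap_apply_right] at h2
      have h3 : (A ⟨i, j⟩ - A ⟨i, l⟩) * (x i j - x i l) = 0 := by rw [← h2]; ring
      rcases mul_eq_zero.mp h3 with h4 | h4
      · exact sub_eq_zero.mp h4
      · exact absurd (hx i (sub_eq_zero.mp h4)) hjl
    · rintro ⟨i', m⟩ ⟨h3, h4⟩
      by_cases hi : i' = i
      · subst hi
        have h5 : m ≠ j := fun hh => h3 (by rw [hh])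
        have h6 : m ≠ l := fun hh => h4 (by rw [hh])
        simp [Equiv.swap_apply_of_ne_of_ne h5 h6]
      · simp [Function.update_of_ne hi]
  have hA0 : ∀ p, A p = 0 := by
    rintro ⟨i, j⟩
    have h1 : ∑ l, A ⟨i, l⟩ = 0 := by
      simp only [A, Finset.sum_sub_distrib]
      rw [Equiv.sum_comp (τ i).symm (fun l => ι (MvPolynomial.C (θ ⟨i, l⟩))),
        Equiv.sum_comp (τ' i).symm (fun l => ι (MvPolynomial.C (θ ⟨i, l⟩))), sub_self]
    rw [Finset.sum_congr rfl (fun l _ => hc i l j)] at h1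
    simp only [Finset.sum_const, Finset.card_univ, Fintype.card_fin, nsmul_eq_mul] at h1
    exact (mul_eq_zero.mp h1).resolve_left (hd i)
  funext i
  have : (τ i).symm = (τ' i).symm := by
    ext j
    have h1 := hιC (sub_eq_zero.mp (hA0 ⟨i, j⟩))
    exact congrArg Fin.val (hθ i h1)
  simpa using congrArg Equiv.symm this

lemma mem_of_pow {k : Type} [Field k] [Fintype k] (z : AlgebraicClosure k) (hz : z ^ Fintype.card k = z) :
    z ∈ Set.range (algebraMap k (AlgebraicClosure k)) := by
  classical
  have hne : (X ^ Fintype.card k - X : k[X]) ≠ 0 := FiniteField.X_pow_card_sub_X_ne_zero k Fintype.one_lt_card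
  have h1 : (X ^ Fintype.card k - X : k[X]) = (((X ^ Fintype.card k - X : k[X]).roots).map (fun a => X - C a)).prod := by
    refine ((prod_multiset_X_sub_C_of_monic_of_roots_card_eq ?_ ?_)).symm
    · exact monic_X_pow_sub (by rw [degree_X]; exact_mod_cast Fintype.one_lt_card)
    · rw [FiniteField.roots_X_pow_card_sub_X, FiniteField.X_pow_card_sub_X_natDegree_eq k Fintype.one_lt_card]
      simp
  have h2 := congrArg (aeval z) h1
  rw [map_multiset_prod] at h2
  simp only [map_sub, map_pow, aeval_X, hz, sub_self] at h2
  have h3 := Multiset.prod_eq_zero_iff.mp h2.symm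
  simp only [Multiset.map_map, Multiset.mem_map] at h3
  obtain ⟨a, _, ha⟩ := h3
  refine ⟨a, ?_⟩
  simp only [Function.comp_apply, map_sub, aeval_X, aeval_C] at ha
  exact (sub_eq_zero.mp ha).symm

lemma totalDegree_map_inj {R S τ : Type*} [CommSemiring R] [CommSemiring S] {f : R →+* S}
    (hf : Function.Injective f) (p : MvPolynomial τ R) :
    (MvPolynomial.map f p).totalDegree = p.totalDegree := by
  unfold MvPolynomial.totalDegree
  rw [MvPolynomial.support_map_of_injective _ hf]

lemma descend {k : Type} [Field k] [Fintype k] (c : MvPolynomial (Fin 2) (AlgebraicClosure k))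
    (hc : MvPolynomial.map (FiniteField.frobeniusAlgHom k (AlgebraicClosure k) : AlgebraicClosure k →+* AlgebraicClosure k) c = c) :
    ∃ c', MvPolynomial.map (algebraMap k (AlgebraicClosure k)) c' = c := by
  have : c ∈ Set.range (MvPolynomial.map (σ := Fin 2) (algebraMap k (AlgebraicClosure k))) := by
    rw [MvPolynomial.mem_range_map_iff_coeffs_subset]
    intro z hz
    obtain ⟨n, _, rfl⟩ := MvPolynomial.mem_coeffs_iff.mp hz
    apply mem_of_pow
    have := congrArg (MvPolynomial.coeff n) hc
    rw [MvPolynomial.coeff_map] at this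
    simpa using this
  exact this

theorem exists_h {k : Type} [Field k] [Fintype k] {v : Th d → MvPolynomial (Fin 2) k} (hv : FullMono v)
    (hd : ∀ i, (d i : k) ≠ 0) (e : ℕ) (hve : ∀ p, (v p).totalDegree ≤ e)
    (σ : GG d) (θ : Th d → AlgebraicClosure k) (hθ : ∀ i, Function.Injective (fun j => θ ⟨i, j⟩))
    (hσ : ∀ i j, θ ⟨i, j⟩ ^ Fintype.card k = θ ⟨i, σ i j⟩) :
    (dl (fun p => (MvPolynomial.C (θ p) : MvPolynomial (Fin 2) (AlgebraicClosure k)))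
      (fun p => MvPolynomial.map (algebraMap k (AlgebraicClosure k)) (v p)) ≠ 0) ∧
    ∃ h : (MvPolynomial (Fin 2) k)[X], h.Monic ∧ Irreducible h ∧ h.natDegree = Fintype.card (GG d) ∧
      (∀ i, (h.coeff i).totalDegree ≤ (Pres d).totalDegree * e) ∧
      h.map (MvPolynomial.map (algebraMap k (AlgebraicClosure k))) =
        res (fun p => MvPolynomial.C (θ p)) (fun p => MvPolynomial.map (algebraMap k (AlgebraicClosure k)) (v p)) := by
  classical
  obtain ⟨L, _, ι, x, hι, hx, hcf, hγ⟩ := hv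
  set m := MvPolynomial.map (σ := Fin 2) (algebraMap k (AlgebraicClosure k)) with hm
  set θ' : Th d → MvPolynomial (Fin 2) (AlgebraicClosure k) := fun p => MvPolynomial.C (θ p) with hθ'
  have hdL : ∀ i, (d i : L) ≠ 0 := by
    intro i
    have := ((ι.comp MvPolynomial.C).comp (algebraMap k (AlgebraicClosure k))).injective.ne (hd i)
    simpa using this
  have hinj : Function.Injective (wt (ι ∘ θ') x) := wt_inj ι x hx hγ hdL θ hθ
  have hvι : (ι ∘ fun p => m (v p)) = fun p : Th d => cf (x p.1) p.2 := by
    funext p; exact (hcf p).symm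
  have hres : (res θ' (fun p => m (v p))).map ι = ∏ τ : GG d, (X - C (wt (ι ∘ θ') x τ)) := by
    rw [res_map, hvι, res_cf]
  have hmon : (res θ' (fun p => m (v p))).Monic := by
    refine Polynomial.monic_of_injective hι ?_
    rw [hres]; exact monic_prod_of_monic _ _ fun τ _ => monic_X_sub_C _
  refine ⟨?_, ?_⟩
  · intro h0
    have := congrArg ι h0
    rw [dl_map, hvι, map_zero] at this
    exact dl_ne (x := x) (θ := ι ∘ θ') hinj this
  -- descent
  let φ : (AlgebraicClosure k) →+* (AlgebraicClosure k) := (FiniteField.frobeniusAlgHom k (AlgebraicClosure k) : (AlgebraicClosure k) →+* (AlgebraicClosure k))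
  have hφ : ∀ z, φ z = z ^ Fintype.card k := fun z => by
    simp only [φ, RingHom.coe_coe]; rw [FiniteField.coe_frobeniusAlgHom]
  have hfix : (res θ' (fun p => m (v p))).map (MvPolynomial.map φ) = res θ' (fun p => m (v p)) := by
    apply Polynomial.map_injective ι hι
    rw [res_map, res_map, hres]
    have e1 : (ι ∘ ((MvPolynomial.map φ) ∘ fun p => m (v p))) = fun p : Th d => cf (x p.1) p.2 := by
      rw [← hvι]
      funext p
      simp only [Function.comp_apply, hm, MvPolynomial.map_map]
      have e0 : φ.comp (algebraMap k (AlgebraicClosure k)) = algebraMap k (AlgebraicClosure k) :=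
        RingHom.ext fun z => (FiniteField.frobeniusAlgHom k (AlgebraicClosure k)).commutes z
      rw [e0]
    rw [e1, res_cf]
    refine Fintype.prod_equiv (Equiv.mulRight σ⁻¹) _ _ ?_
    intro τ
    congr 2
    unfold wt
    rw [Fintype.sum_sigma, Fintype.sum_sigma]
    refine Finset.sum_congr rfl fun i _ => ?_
    rw [← Equiv.sum_comp (σ i) (fun y => (ι ∘ θ') ⟨i, y⟩ * x i ((Equiv.mulRight σ⁻¹) τ i y)) ]
    refine Finset.sum_congr rfl fun j _ => ?_
    congr 1
    · simp only [Function.comp_apply, hθ', MvPolynomial.map_C, hφ, hσ]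
    · simp
  have hl : ∀ n, ∃ c', m c' = (res θ' (fun p => m (v p))).coeff n := by
    intro n
    refine descend _ ?_
    have := congrArg (fun P => P.coeff n) hfix
    simpa only [coeff_map] using this
  have hl' : res θ' (fun p => m (v p)) ∈ lifts m := by
    rw [lifts_iff_coeff_lifts]
    exact fun n => hl n
  obtain ⟨h, hh, hhd, hhm⟩ := lifts_and_natDegree_eq_and_monic hl' hmon
  have hmi : Function.Injective m := MvPolynomial.map_injective _ (algebraMap k (AlgebraicClosure k)).injective
  have hcard : h.natDegree = Fintype.card (GG d) := by
    rw [hhd, ← natDegree_map_eq_of_injective hι, hres, natDegree_prod_of_monic _ _ (fun τ _ => monic_X_sub_C _)]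
    simp
  refine ⟨h, hhm, ?_, hcard, ?_, hh⟩
  · have hroot : ∀ (P : (MvPolynomial (Fin 2) k)[X]) (τ τ' : GG d),
        (P.map (ι.comp m)).eval (wt (ι ∘ θ') x τ) = 0 → (P.map (ι.comp m)).eval (wt (ι ∘ θ') x τ') = 0 := by
      intro P τ τ' h0
      obtain ⟨γ, h1, h2⟩ := hγ (τ' * τ⁻¹)
      have h3 : ∀ z, γ (ι z) = ι z := fun z => DFunLike.congr_fun h1 z
      have h4 : γ (wt (ι ∘ θ') x τ) = wt (ι ∘ θ') x τ' := by
        simp [wt, map_sum, h3, h2]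
      have h5 := congrArg γ h0
      rw [map_zero, ← evm, h4, Polynomial.map_map, ← RingHom.comp_assoc, h1] at h5
      exact h5
    have hdeg : ∀ P : (MvPolynomial (Fin 2) k)[X], P.Monic →
        (P.map (ι.comp m)).eval (wt (ι ∘ θ') x 1) = 0 → Fintype.card (GG d) ≤ P.natDegree := by
      intro P hP h0
      rw [← hP.natDegree_map (ι.comp m)]
      have h1 : (Finset.univ.image (wt (ι ∘ θ') x)) ⊆ (P.map (ι.comp m)).roots.toFinset := by
        intro z hz
        obtain ⟨τ, _, rfl⟩ := Finset.mem_image.mp hz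
        rw [Multiset.mem_toFinset, mem_roots (hP.map _).ne_zero]
        exact hroot P 1 τ h0
      have h2 := Finset.card_le_card h1
      rw [Finset.card_image_of_injective _ hinj, Finset.card_univ] at h2
      exact h2.trans ((Multiset.toFinset_card_le _).trans (card_roots' _))
    have h1 : h ≠ 1 := by
      rintro rfl
      rw [natDegree_one] at hcard
      exact Fintype.card_ne_zero hcard.symm
    rw [hhm.irreducible_iff_natDegree]
    refine ⟨h1, ?_⟩
    intro P Q hP hQ hPQ
    have h2 : (h.map (ι.comp m)).eval (wt (ι ∘ θ') x 1) = 0 := by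
      rw [← Polynomial.map_map, hh, hres, eval_prod]
      exact Finset.prod_eq_zero (Finset.mem_univ 1) (by simp)
    rw [← hPQ, Polynomial.map_mul, eval_mul] at h2
    have h3 : P.natDegree + Q.natDegree = Fintype.card (GG d) := by
      rw [← hcard, ← hPQ, hP.natDegree_mul hQ]
    rcases mul_eq_zero.mp h2 with h4 | h4
    · right; have := hdeg P hP h4; omega
    · left; have := hdeg Q hQ h4; omega
  · intro i
    have h1 := res_totalDegree θ (fun p => m (v p)) e (fun p => by
      rw [hm, totalDegree_map_inj (algebraMap k (AlgebraicClosure k)).injective]; exact hve p) i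
    have h2 : m (h.coeff i) = (res θ' (fun p => m (v p))).coeff i := by rw [← hh, coeff_map]
    have h3 : (m (h.coeff i)).totalDegree ≤ (Pres d).totalDegree * e := by rw [h2]; exact h1
    rwa [hm, totalDegree_map_inj (algebraMap k (AlgebraicClosure k)).injective] at h3

end BW

namespace BW

lemma sz {k K : Type} [Field k] [Fintype k] [DecidableEq k] [Field K] (f : k →+* K) (P : MvPolynomial (Fin 2) K) (hP : P ≠ 0) (D : ℕ)
    (hD : P.totalDegree ≤ D) (T : Finset (k × k))
    (hT : ∀ z ∈ T, MvPolynomial.eval ![f z.1, f z.2] P = 0) : T.card ≤ D * Fintype.card k := by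
  classical
  let S : Finset K := Finset.univ.image f
  have hS : S.card = Fintype.card k := by
    rw [Finset.card_image_of_injective _ f.injective, Finset.card_univ]
  have h1 := MvPolynomial.schwartz_zippel_totalDegree hP S
  have hq : (0 : ℚ≥0) < Fintype.card k := by exact_mod_cast Fintype.card_pos
  rw [hS] at h1
  set W := (Fintype.piFinset fun _ : Fin 2 => S).filter (fun g => MvPolynomial.eval g P = 0) with hW
  have h2 : T.card ≤ W.card := by
    refine Finset.card_le_card_of_injOn (fun z => ![f z.1, f z.2]) ?_ ?_
    · intro z hz
      simp only [hW, Finset.coe_filter, Set.mem_ofPred_eq, Fintype.mem_piFinset]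
      refine ⟨?_, hT z hz⟩
      intro i
      fin_cases i <;> simp [S]
    · rintro ⟨a, b⟩ _ ⟨a', b'⟩ _ h
      have h1 := congrFun h 0
      have h2 := congrFun h 1
      simp only [Matrix.cons_val_zero, Matrix.cons_val_one] at h1 h2
      rw [f.injective h1, f.injective h2]
  refine h2.trans ?_
  have h3 : (W.card : ℚ≥0) ≤ P.totalDegree * Fintype.card k := by
    rw [div_le_div_iff₀ (by positivity) hq, pow_two, ← mul_assoc] at h1
    exact le_of_mul_le_mul_right h1 hq
  have h4 : W.card ≤ P.totalDegree * Fintype.card k := by exact_mod_cast h3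
  exact h4.trans (Nat.mul_le_mul_right _ hD)

lemma roots_exist {K : Type} [Field K] [IsAlgClosed K] (P : K[X]) (hP : P.Monic) (n : ℕ) (hn : P.natDegree = n) :
    ∃ y : Fin n → K, P = ∏ j, (X - C (y j)) := by
  have h1 := (IsAlgClosed.splits P).natDegree_eq_card_roots
  have h2 := (IsAlgClosed.splits P).eq_prod_roots_of_monic hP
  have h4 : P.roots.toList.length = n := by rw [Multiset.length_toList, ← h1, hn]
  refine ⟨fun j => P.roots.toList.get (j.cast h4.symm), ?_⟩
  subst h4
  conv_lhs => rw [h2]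
  conv_lhs => rw [← Multiset.coe_toList P.roots]
  rw [Multiset.map_coe, Multiset.prod_coe]
  rw [← List.prod_ofFn]
  congr 1
  apply List.ext_getElem <;> simp

/-- the monic polynomial with lower coefficients `v` -/
noncomputable def mp {S : Type} [CommRing S] {n : ℕ} (v : Fin n → S) : S[X] := X ^ n + ∑ j, C (v j) * X ^ (j : ℕ)

lemma mp_deg {S : Type} [CommRing S] {n : ℕ} (v : Fin n → S) : (∑ j, C (v j) * X ^ (j : ℕ) : S[X]).degree < (n : WithBot ℕ) := by
  rw [← mem_degreeLT]
  refine Submodule.sum_mem _ fun j _ => ?_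
  rw [mem_degreeLT]
  exact (degree_C_mul_X_pow_le _ _).trans_lt (by exact_mod_cast j.2)

lemma mp_monic {S : Type} [CommRing S] {n : ℕ} (v : Fin n → S) : (mp v).Monic := monic_X_pow_add (mp_deg v)

lemma mp_natDegree {S : Type} [CommRing S] [Nontrivial S] {n : ℕ} (v : Fin n → S) : (mp v).natDegree = n := by
  refine natDegree_eq_of_degree_eq_some ?_
  rw [mp, degree_add_eq_left_of_degree_lt, degree_X_pow]
  rw [degree_X_pow]; exact mp_deg v

lemma mp_coeff {S : Type} [CommRing S] {n : ℕ} (v : Fin n → S) (j : Fin n) : (mp v).coeff j = v j := by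
  simp only [mp, coeff_add, coeff_X_pow, finsetSum_coeff, coeff_C_mul]
  rw [Finset.sum_eq_single j]
  · simp [j.2.ne]
  · intro b _ hb
    have : (j : ℕ) ≠ b := fun h => hb (Fin.ext h.symm)
    simp [this]
  · simp

lemma mp_map {S S' : Type} [CommRing S] [CommRing S'] (f : S →+* S') {n : ℕ} (v : Fin n → S) :
    (mp v).map f = mp (f ∘ v) := by
  simp [mp, Polynomial.map_sum]

lemma frob_perm {k : Type} [Field k] [Fintype k] {n : ℕ} (v : Fin n → k) (y : Fin n → AlgebraicClosure k)
    (hy : mp (algebraMap k (AlgebraicClosure k) ∘ v) = ∏ j, (X - C (y j))) (hinj : Function.Injective y) :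
    ∃ π : Equiv.Perm (Fin n), ∀ j, y j ^ Fintype.card k = y (π j) := by
  have hφ : ∀ z, FiniteField.frobeniusAlgHom k (AlgebraicClosure k) z = z ^ Fintype.card k := fun z => by
    rw [FiniteField.coe_frobeniusAlgHom]
  have h1 : ∀ j, ∃ l, y j ^ Fintype.card k = y l := by
    intro j
    have h2 : aeval (y j) (mp v) = 0 := by
      rw [aeval_def, ← eval_map, mp_map, hy, eval_prod]
      exact Finset.prod_eq_zero (Finset.mem_univ j) (by simp)
    have h3 := congrArg (FiniteField.frobeniusAlgHom k (AlgebraicClosure k)) h2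
    rw [← aeval_algHom_apply, map_zero, hφ, aeval_def, ← eval_map, mp_map, hy, eval_prod] at h3
    obtain ⟨l, _, hl⟩ := Finset.prod_eq_zero_iff.mp h3
    refine ⟨l, ?_⟩
    simpa [sub_eq_zero] using hl
  choose π hπ using h1
  have hi : Function.Injective π := by
    intro j l hjl
    have : y j ^ Fintype.card k = y l ^ Fintype.card k := by rw [hπ, hπ, hjl]
    rw [← hφ, ← hφ] at this
    exact hinj ((FiniteField.frobeniusAlgHom k (AlgebraicClosure k)).toRingHom.injective this)
  exact ⟨Equiv.ofBijective π hi.bijective_of_finite, hπ⟩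

lemma irr_of_cycle {k : Type} [Field k] [Fintype k] {n : ℕ} (hn : 1 ≤ n) (v : Fin n → k) (y : Fin n → AlgebraicClosure k)
    (hy : mp (algebraMap k (AlgebraicClosure k) ∘ v) = ∏ j, (X - C (y j))) (hinj : Function.Injective y)
    (π : Equiv.Perm (Fin n)) (hπ : ∀ j, y j ^ Fintype.card k = y (π j))
    (τ : Equiv.Perm (Fin n)) (hτ : π * τ = τ * finRotate n) : Irreducible (mp v) := by
  classical
  have hφ : ∀ z, FiniteField.frobeniusAlgHom k (AlgebraicClosure k) z = z ^ Fintype.card k := fun z => by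
    rw [FiniteField.coe_frobeniusAlgHom]
  obtain ⟨n, rfl⟩ : ∃ n', n = n' + 1 := ⟨n - 1, by omega⟩
  have hall : ∀ (P : k[X]) (j), aeval (y j) P = 0 → ∀ l, aeval (y l) P = 0 := by
    intro P j hj
    have step : ∀ l, aeval (y l) P = 0 → aeval (y (π l)) P = 0 := by
      intro l hl
      rw [← hπ, ← hφ, aeval_algHom_apply, hl, map_zero]
    have h2 : ∀ m : ℕ, ∀ l, aeval (y (τ l)) P = 0 → aeval (y (τ (((finRotate (n + 1)) ^ m) l))) P = 0 := by
      intro m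
      induction m with
      | zero => intro l hl; simpa using hl
      | succ m ih =>
        intro l hl
        have h3 := step _ (ih l hl)
        have h4 : ∀ z, π (τ z) = τ (finRotate (n + 1) z) := fun z => DFunLike.congr_fun hτ z
        rw [h4] at h3
        rw [pow_succ', Equiv.Perm.mul_apply]; exact h3
    intro l
    have h5 : aeval (y (τ (τ.symm j))) P = 0 := by simpa using hj
    obtain ⟨m, hm⟩ : ∃ m : ℕ, ((finRotate (n + 1)) ^ m) (τ.symm j) = τ.symm l := by
      have key : ∀ (m : ℕ) (z : Fin (n + 1)), ((finRotate (n + 1)) ^ m) z = z + (Fin.ofNat (n + 1) m) := by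
        intro m
        induction m with
        | zero => intro z; simp
        | succ m ih =>
          intro z
          rw [pow_succ', Equiv.Perm.mul_apply, ih, finRotate_apply, add_assoc]
          congr 1
          apply Fin.ext
          simp [Fin.val_add]
      refine ⟨(τ.symm l - τ.symm j : Fin (n + 1)).val, ?_⟩
      rw [key]
      have : Fin.ofNat (n + 1) (τ.symm l - τ.symm j : Fin (n + 1)).val = τ.symm l - τ.symm j := by
        simp
      rw [this]; abel
    have := h2 m _ h5
    rw [hm] at this
    simpa using this
  have hroot : ∀ j, aeval (y j) (mp v) = 0 := by
    intro j
    rw [aeval_def, ← eval_map, mp_map, hy, eval_prod]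
    exact Finset.prod_eq_zero (Finset.mem_univ j) (by simp)
  have hint : IsIntegral k (y 0) := ⟨mp v, mp_monic v, by rw [← aeval_def]; exact hroot 0⟩
  have hdvd := minpoly.dvd k (y 0) (hroot 0)
  have hdeg : n + 1 ≤ (minpoly k (y 0)).natDegree := by
    rw [← (minpoly.monic hint).natDegree_map (algebraMap k (AlgebraicClosure k))]
    have h1 : Finset.univ.image y ⊆ ((minpoly k (y 0)).map (algebraMap k (AlgebraicClosure k))).roots.toFinset := by
      intro z hz
      obtain ⟨l, _, rfl⟩ := Finset.mem_image.mp hz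
      rw [Multiset.mem_toFinset, mem_roots ((minpoly.monic hint).map _).ne_zero, IsRoot, eval_map, ← aeval_def]
      exact hall _ 0 (minpoly.aeval k _) l
    have h2 := Finset.card_le_card h1
    rw [Finset.card_image_of_injective _ hinj, Finset.card_univ, Fintype.card_fin] at h2
    exact h2.trans ((Multiset.toFinset_card_le _).trans (card_roots' _))
  have : mp v = minpoly k (y 0) := (eq_of_monic_of_dvd_of_natDegree_le (minpoly.monic hint) (mp_monic v) hdvd (by
    rw [mp_natDegree]; exact hdeg))
  rw [this]
  exact minpoly.irreducible hint

end BW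

namespace BW

variable {s : ℕ} {d : Fin s → ℕ}

lemma mp_eq_prod {S : Type} [CommRing S] [Nontrivial S] {n : ℕ} (v x : Fin n → S) (h : ∀ j, cf x j = v j) :
    mp v = ∏ j, (X - C (x j)) := by
  have hm : (∏ j, (X - C (x j))).Monic := monic_prod_of_monic _ _ fun _ _ => monic_X_sub_C _
  have hd : (∏ j, (X - C (x j))).natDegree = n := by
    rw [natDegree_prod_of_monic _ _ fun _ _ => monic_X_sub_C _]; simp
  ext i
  rcases lt_trichotomy i n with hi | hi | hi
  · have h1 := mp_coeff v ⟨i, hi⟩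
    have h2 := h ⟨i, hi⟩
    simp only [cf] at h1 h2
    rw [h1, h2]
  · subst hi
    have h1 := (mp_monic v).coeff_natDegree
    have h2 := hm.coeff_natDegree
    rw [mp_natDegree] at h1
    rw [hd] at h2
    rw [h1, h2]
  · rw [coeff_eq_zero_of_natDegree_lt (by rwa [mp_natDegree]), coeff_eq_zero_of_natDegree_lt (by rwa [hd])]

/-- at a good point -/
lemma point {k : Type} [Field k] [Fintype k] (v0 : Th d → k) (y : ∀ i, Fin (d i) → AlgebraicClosure k)
    (hy : ∀ i, mp (fun j => algebraMap k (AlgebraicClosure k) (v0 ⟨i, j⟩)) = ∏ j, (X - C (y i j)))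
    (θ : Th d → AlgebraicClosure k) (σ : GG d)
    (hσ : ∀ i j, θ ⟨i, j⟩ ^ Fintype.card k = θ ⟨i, σ i j⟩)
    (π : GG d) (hπ : ∀ i j, y i j ^ Fintype.card k = y i (π i j)) (τ : GG d) (hτ : π * τ = τ * σ) :
    ∃ w : k, algebraMap k (AlgebraicClosure k) w = wt θ y τ := by
  apply mem_of_pow
  have hφ : ∀ z, FiniteField.frobeniusAlgHom k (AlgebraicClosure k) z = z ^ Fintype.card k := fun z => by
    rw [FiniteField.coe_frobeniusAlgHom]
  rw [← hφ]
  unfold wt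
  rw [map_sum]
  simp only [map_mul, hφ]
  rw [Fintype.sum_sigma, Fintype.sum_sigma]
  refine Finset.sum_congr rfl fun i _ => ?_
  rw [← Equiv.sum_comp (σ i) (fun j => θ ⟨i, j⟩ * y i (τ i j))]
  refine Finset.sum_congr rfl fun j _ => ?_
  simp only [mul_pow, hσ, hπ]
  have : π i (τ i j) = τ i (σ i j) := DFunLike.congr_fun (congrFun hτ i) j
  rw [this]

theorem cheb (s : ℕ) (d : Fin s → ℕ) (e A : ℕ) (hd1 : ∀ i, 1 ≤ d i) : ∃ N, ∀ (k : Type) [Field k] [Fintype k],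
    N ≤ Fintype.card k → (∀ i, (d i : k) ≠ 0) → ∀ v : Th d → MvPolynomial (Fin 2) k,
    (∀ p, (v p).totalDegree ≤ e) → FullMono v → ∀ c : MvPolynomial (Fin 2) k, c ≠ 0 → c.totalDegree ≤ e →
    ∃ T : Finset (k × k), A ≤ T.card ∧ ∀ z ∈ T, MvPolynomial.eval ![z.1, z.2] c ≠ 0 ∧
      ∀ i, Irreducible (mp (fun j => MvPolynomial.eval ![z.1, z.2] (v ⟨i, j⟩))) := by
  classical
  set g := Fintype.card (GG d) with hg
  have hg1 : 1 ≤ g := Fintype.card_pos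
  set E := (Pres d).totalDegree * e with hE
  set Cc := e + g * ((Pdl d).totalDegree * e) with hCc
  obtain ⟨N, hN⟩ := U2 g E (2 * g) hg1
  refine ⟨max N (2 * g * Cc + 2 * g * A * g + 1 + ∑ i, d i * d i), ?_⟩
  intro k _ _ hk hdk v hve hmono c hc0 hce
  set q := Fintype.card k with hq
  have hqN : N ≤ q := (le_max_left _ _).trans hk
  have hqC : 2 * g * Cc + 2 * g * A * g + 1 + ∑ i, d i * d i ≤ q := (le_max_right _ _).trans hk
  -- choose theta
  have hth : ∀ σ : GG d, ∃ θ : Th d → AlgebraicClosure k, (∀ i, Function.Injective (fun j => θ ⟨i, j⟩)) ∧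
      ∀ i j, θ ⟨i, j⟩ ^ q = θ ⟨i, σ i j⟩ := by
    intro σ
    have : ∀ i, ∃ θ : Fin (d i) → AlgebraicClosure k, Function.Injective θ ∧
      ∀ j, θ j ^ Fintype.card k = θ (σ i j) := by
      intro i
      refine theta_exists k (d i) (σ i) ?_
      have : d i * d i ≤ ∑ i, d i * d i := Finset.single_le_sum (f := fun i => d i * d i) (fun _ _ => Nat.zero_le _) (Finset.mem_univ i)
      omega
    choose θ h1 h2 using this
    exact ⟨fun p => θ p.1 p.2, h1, h2⟩
  choose θ hθi hθσ using hth
  have hH := fun σ => exists_h hmono hdk e hve σ (θ σ) (hθi σ) (hθσ σ)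
  choose hdl h hhm hhirr hhd hhe hhres using hH
  -- roots at points
  let ev : k × k → MvPolynomial (Fin 2) k →+* k := fun z => MvPolynomial.eval ![z.1, z.2]
  let al := algebraMap k (AlgebraicClosure k)
  have hY : ∀ z : k × k, ∃ y : ∀ i, Fin (d i) → AlgebraicClosure k,
      ∀ i, mp (fun j => al (ev z (v ⟨i, j⟩))) = ∏ j, (X - C (y i j)) := by
    intro z
    have := fun i => roots_exist (mp (fun j : Fin (d i) => al (ev z (v ⟨i, j⟩)))) (mp_monic _) (d i) (mp_natDegree _)
    choose y hy using this
    exact ⟨y, hy⟩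
  choose y hy using hY
  have hycf : ∀ z, (fun p : Th d => al (ev z (v p))) = fun p => cf (y z p.1) p.2 := by
    intro z
    funext p
    rw [cf, ← hy, mp_coeff]
  -- evaluation
  let evK : k × k → MvPolynomial (Fin 2) (AlgebraicClosure k) →+* AlgebraicClosure k :=
    fun z => MvPolynomial.eval ![al z.1, al z.2]
  have hev : ∀ z, (evK z).comp (MvPolynomial.map al) = al.comp (ev z) := by
    intro z
    apply MvPolynomial.ringHom_ext
    · intro r; simp [evK, ev]
    · intro i; fin_cases i <;> simp [evK, ev]
  have hev' : ∀ z, (evK z ∘ fun p => MvPolynomial.map al (v p)) = fun p : Th d => cf (y z p.1) p.2 := by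
    intro z
    rw [← hycf]
    funext p
    exact DFunLike.congr_fun (hev z) (v p)
  have hevC : ∀ z σ, (evK z ∘ fun p => MvPolynomial.C (θ σ p)) = θ σ := by
    intro z σ; funext p; simp [evK]
  let dK : GG d → MvPolynomial (Fin 2) (AlgebraicClosure k) := fun σ =>
    dl (fun p => MvPolynomial.C (θ σ p)) (fun p => MvPolynomial.map al (v p))
  let good : Finset (k × k) := Finset.univ.filter (fun z => ev z c ≠ 0 ∧ ∀ σ, evK z (dK σ) ≠ 0)
  have hgoodw : ∀ z ∈ good, ∀ σ, Function.Injective (wt (θ σ) (y z)) := by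
    intro z hz σ
    have h1 := (Finset.mem_filter.mp hz).2.2 σ
    simp only [dK] at h1
    rw [dl_map, hev', hevC] at h1
    exact wt_ne_of_dl h1
  have hgoody : ∀ z ∈ good, ∀ i, Function.Injective (y z i) := fun z hz i => inj_of_wt (hgoodw z hz 1) i
  have hP : ∀ z ∈ good, ∃ π : GG d, ∀ i j, y z i j ^ q = y z i (π i j) := by
    intro z hz
    have := fun i => frob_perm (fun j => ev z (v ⟨i, j⟩)) (y z i) (hy z i) (hgoody z hz i)
    choose π hπ using this
    exact ⟨π, hπ⟩
  choose! π hπ using hP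
  have hW : ∀ σ, ∀ zt : (k × k) × GG d, zt.1 ∈ good ∧ π zt.1 * zt.2 = zt.2 * σ → ∃ w : k,
      al w = wt (θ σ) (y zt.1) zt.2 := by
    rintro σ ⟨z, τ⟩ ⟨hz, h1⟩
    exact point (fun p => ev z (v p)) (y z) (hy z) (θ σ) σ (hθσ σ) (π z) (hπ z hz) τ h1
  choose! w hw using hW
  let S : GG d → Finset ((k × k) × GG d) := fun σ =>
    (good ×ˢ Finset.univ).filter (fun zt => zt.2⁻¹ * π zt.1 * zt.2 = σ)
  have hSmem : ∀ σ zt, zt ∈ S σ ↔ zt.1 ∈ good ∧ π zt.1 * zt.2 = zt.2 * σ := by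
    intro σ zt
    simp only [S, Finset.mem_filter, Finset.mem_product, Finset.mem_univ, and_true]
    rw [mul_assoc, inv_mul_eq_iff_eq_mul]
  have hScard : ∀ σ, 2 * g * (S σ).card ≤ (2 * g + 1) * q ^ 2 := by
    intro σ
    let S' : Finset (k × k × k) := (S σ).image (fun zt => (zt.1.1, zt.1.2, w σ zt))
    have hc1 : S'.card = (S σ).card := by
      apply Finset.card_image_of_injOn
      rintro ⟨⟨a, b⟩, τ⟩ h1 ⟨⟨a', b'⟩, τ'⟩ h2 h12
      simp only [Prod.mk.injEq] at h12
      obtain ⟨rfl, rfl, h3⟩ := h12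
      have h1' := (hSmem σ _).mp h1
      have h2' := (hSmem σ _).mp h2
      have h4 := hw σ _ h1'
      have h5 := hw σ _ h2'
      rw [h3, h5] at h4
      have h6 := hgoodw _ h1'.1 σ h4
      simp only at h6
      rw [h6]
    rw [← hc1]
    refine hN k hqN (h σ) (hhm σ) (hhirr σ) (hhd σ) (hhe σ) S' ?_
    intro yy hyy
    obtain ⟨⟨z, τ⟩, hzt, rfl⟩ := Finset.mem_image.mp hyy
    have hzt' := (hSmem σ _).mp hzt
    have hw' := hw σ _ hzt'
    have hz := hzt'.1
    simp only at hz hw'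
    have hmap : ((h σ).map (ev z)).map al = ∏ τ : GG d, (X - C (wt (θ σ) (y z) τ)) := by
      rw [Polynomial.map_map, ← hev, ← Polynomial.map_map, hhres, res_map, hev', hevC, res_cf]
    have hsep : (∏ τ : GG d, (X - C (wt (θ σ) (y z) τ))).Separable :=
      separable_prod_X_sub_C_iff.mpr (hgoodw z hz σ)
    have hroot : (∏ τ : GG d, (X - C (wt (θ σ) (y z) τ))).eval (wt (θ σ) (y z) τ) = 0 := by
      rw [eval_prod]; exact Finset.prod_eq_zero (Finset.mem_univ τ) (by simp)
    constructor
    · apply al.injective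
      change al (eval _ ((h σ).map (ev z))) = _
      rw [← evm, hmap, hw', map_zero]; exact hroot
    · intro h0
      have h1 : al (eval (w σ (z, τ)) (derivative ((h σ).map (ev z)))) = 0 := by
        change eval _ (derivative ((h σ).map (ev z))) = 0 at h0
        rw [h0, map_zero]
      rw [← evm, ← derivative_map, hmap, hw'] at h1
      have := hsep.eval₂_derivative_ne_zero (RingHom.id _) (x := wt (θ σ) (y z) τ) (by
        rw [eval₂_id]; exact hroot)
      rw [eval₂_id] at this
      exact this h1
  have hgood : q ^ 2 ≤ good.card + Cc * q := by
    have h1 : (Finset.univ : Finset (k × k)).card = q ^ 2 := by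
      rw [Finset.card_univ, Fintype.card_prod, pow_two]
    have h2 : (Finset.univ : Finset (k × k)) ⊆ good ∪ (Finset.univ.filter (fun z => ev z c = 0) ∪
        Finset.univ.biUnion (fun σ => Finset.univ.filter (fun z => evK z (dK σ) = 0))) := by
      intro z _
      simp only [good, Finset.mem_union, Finset.mem_filter, Finset.mem_univ, true_and, Finset.mem_biUnion]
      by_cases h3 : ev z c = 0
      · right; left; exact h3
      · by_cases h4 : ∃ σ, evK z (dK σ) = 0
        · right; right; exact h4
        · left; push Not at h4; exact ⟨h3, h4⟩
    rw [← h1]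
    refine (Finset.card_le_card h2).trans ((Finset.card_union_le _ _).trans ?_)
    refine Nat.add_le_add_left ((Finset.card_union_le _ _).trans ?_) _
    rw [hCc, add_mul]
    refine Nat.add_le_add ?_ ?_
    · exact sz (RingHom.id k) c hc0 e hce _ (fun z hz => (Finset.mem_filter.mp hz).2)
    · refine (Finset.card_biUnion_le_card_mul _ _ ((Pdl d).totalDegree * e * q) ?_).trans ?_
      · intro σ _
        refine sz al (dK σ) (hdl σ) _ ?_ _ (fun z hz => (Finset.mem_filter.mp hz).2)
        exact dl_totalDegree (θ σ) _ e (fun p => by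
          rw [totalDegree_map_inj al.injective]; exact hve p)
      · rw [Finset.card_univ, ← hg, mul_assoc g]
  have hsum : ∑ σ, (S σ).card = good.card * g := by
    have h1 := Finset.card_eq_sum_card_fiberwise (s := good ×ˢ (Finset.univ : Finset (GG d)))
      (f := fun zt => zt.2⁻¹ * π zt.1 * zt.2) (t := Finset.univ) (fun _ _ => Finset.mem_univ _)
    rw [Finset.card_product, Finset.card_univ] at h1
    exact h1.symm
  let σ0 : GG d := fun i => finRotate (d i)
  have hσ0 : q ^ 2 ≤ 2 * g * (S σ0).card := by
    have h1 : 2 * g * ∑ σ, (S σ).card ≤ 2 * g * (S σ0).card + (g - 1) * ((2 * g + 1) * q ^ 2) := by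
      rw [← Finset.add_sum_erase _ _ (Finset.mem_univ σ0), mul_add, Finset.mul_sum]
      refine Nat.add_le_add_left ?_ _
      refine (Finset.sum_le_card_nsmul _ _ _ (fun σ _ => hScard σ)).trans ?_
      rw [Finset.card_erase_of_mem (Finset.mem_univ _), Finset.card_univ, smul_eq_mul]
    rw [hsum] at h1
    obtain ⟨g', hg'⟩ : ∃ g', g = g' + 1 := ⟨g - 1, by omega⟩
    have h3 : 2 * g * Cc * q ≤ q * q := Nat.mul_le_mul_right _ (by omega)
    rw [hg'] at h1 h3 ⊢
    simp only [Nat.add_sub_cancel] at h1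
    have h4 : 2 * (g' + 1) * (q ^ 2 * (g' + 1)) ≤ 2 * (g' + 1) * ((good.card + Cc * q) * (g' + 1)) :=
      Nat.mul_le_mul_left _ (Nat.mul_le_mul_right _ hgood)
    have h5 : (g' + 1) * (2 * (g' + 1) * Cc * q) ≤ (g' + 1) * (q * q) := Nat.mul_le_mul_left _ h3
    nlinarith
  refine ⟨(S σ0).image Prod.fst, ?_, ?_⟩
  · have h1 : (S σ0).card ≤ g * ((S σ0).image Prod.fst).card := by
      refine Finset.card_le_mul_card_image _ _ ?_
      intro z _
      calc _ ≤ (Finset.univ : Finset (GG d)).card := by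
            refine Finset.card_le_card_of_injOn Prod.snd (fun _ _ => Finset.mem_coe.mpr (Finset.mem_univ _)) ?_
            rintro ⟨z1, τ1⟩ h1 ⟨z2, τ2⟩ h2 h3
            simp only [Finset.coe_filter, Set.mem_ofPred_eq] at h1 h2
            rw [Prod.mk.injEq]; exact ⟨h1.2.trans h2.2.symm, h3⟩
        _ = g := by rw [Finset.card_univ]
    by_contra hlt
    push Not at hlt
    have h2 : 2 * g * (S σ0).card ≤ 2 * g * (g * A) := Nat.mul_le_mul_left _ (h1.trans (Nat.mul_le_mul_left _ hlt.le))
    have h3 : 2 * g * A * g + 1 ≤ q := by omega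
    have h4 : q ≤ q ^ 2 := Nat.le_self_pow (by norm_num) q
    nlinarith
  · intro z hz
    obtain ⟨⟨z', τ⟩, hzt, rfl⟩ := Finset.mem_image.mp hz
    have hzt' := (hSmem σ0 _).mp hzt
    refine ⟨(Finset.mem_filter.mp hzt'.1).2.1, ?_⟩
    intro i
    exact irr_of_cycle (hd1 i) _ (y z' i) (hy z' i) (hgoody z' hzt'.1 i) (π z' i) (hπ z' hzt'.1 i) (τ i)
      (congrFun hzt'.2 i)

end BW

namespace BW
section
variable {K : Type*} [Field K]

/-- chain rule for derivations -/
lemma chain_rule {σ : Type*} [Fintype σ] {A : Type*} [CommRing A] [Algebra K A] (D : Derivation K A A)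
    (x : σ → A) (p : MvPolynomial σ K) :
    D (MvPolynomial.aeval x p) = ∑ i, MvPolynomial.aeval x (MvPolynomial.pderiv i p) * D (x i) := by
  classical
  induction p using MvPolynomial.induction_on with
  | C a => simp
  | add p q hp hq => simp [hp, hq, add_mul, Finset.sum_add_distrib]
  | mul_X p i hp =>
    simp only [map_mul, MvPolynomial.aeval_X, Derivation.leibniz, hp, smul_eq_mul, MvPolynomial.pderiv_X, map_add,
      add_mul, Finset.sum_add_distrib, Finset.mul_sum]
    congr 1
    · simp [Pi.single_apply, apply_ite]
    · refine Finset.sum_congr rfl fun j _ => by ring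

lemma hom_aeval {S : Type*} [CommRing S] [Algebra K S] (x : Fin 3 → S) (d : ℕ) (f : MvPolynomial (Fin 2) K) :
    MvPolynomial.aeval x (homogenization d f) = ∑ m ∈ f.support,
      algebraMap K S (MvPolynomial.coeff m f) * (x 0 ^ m 0 * x 1 ^ m 1 * x 2 ^ (d - (m 0 + m 1))) := by
  unfold homogenization
  rw [map_sum]
  refine Finset.sum_congr rfl fun m _ => ?_
  rw [MvPolynomial.aeval_monomial, Finsupp.prod_fintype _ _ (by simp)]
  simp [Fin.prod_univ_three, Finsupp.single_apply]

lemma aeval2 {S : Type*} [CommRing S] [Algebra K S] (x : Fin 2 → S) (f : MvPolynomial (Fin 2) K) :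
    MvPolynomial.aeval x f = ∑ m ∈ f.support,
      algebraMap K S (MvPolynomial.coeff m f) * (x 0 ^ m 0 * x 1 ^ m 1) := by
  rw [MvPolynomial.aeval_def, MvPolynomial.eval₂_eq']
  simp

lemma supp_le {f : MvPolynomial (Fin 2) K} {d : ℕ} (h : f.totalDegree ≤ d) {m} (hm : m ∈ f.support) :
    m 0 + m 1 ≤ d := by
  have := (MvPolynomial.le_totalDegree hm).trans h
  rwa [Finsupp.sum_fintype _ _ (by simp), Fin.sum_univ_two] at this

lemma hom_one {S : Type*} [CommRing S] [Algebra K S] (u v : S) (d : ℕ) (f : MvPolynomial (Fin 2) K) :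
    MvPolynomial.aeval ![u, v, 1] (homogenization d f) = MvPolynomial.aeval ![u, v] f := by
  rw [hom_aeval, aeval2]; simp

lemma hom_homog {f : MvPolynomial (Fin 2) K} {d : ℕ} (h : f.totalDegree ≤ d) :
    (homogenization d f).IsHomogeneous d := by
  unfold homogenization
  refine MvPolynomial.IsHomogeneous.sum _ _ _ fun m hm => MvPolynomial.isHomogeneous_monomial _ ?_
  have := supp_le h hm
  rw [map_add, map_add]
  rw [Finsupp.degree_single, Finsupp.degree_single, Finsupp.degree_single]
  omega

lemma hom_map {L : Type*} [Field L] (φ : K →+* L) (d : ℕ) (f : MvPolynomial (Fin 2) K) :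
    MvPolynomial.map φ (homogenization d f) = homogenization d (MvPolynomial.map φ f) := by
  unfold homogenization
  rw [map_sum, MvPolynomial.support_map_of_injective _ φ.injective]
  simp [MvPolynomial.map_monomial, MvPolynomial.coeff_map]

lemma hom_scale {S : Type*} [CommRing S] [Algebra K S] {G : MvPolynomial (Fin 3) K} {n : ℕ} (h : G.IsHomogeneous n)
    (x : Fin 3 → S) (t : S) : MvPolynomial.aeval (fun i => t * x i) G = t ^ n * MvPolynomial.aeval x G := by
  rw [MvPolynomial.aeval_def, MvPolynomial.eval₂_eq', MvPolynomial.aeval_def, MvPolynomial.eval₂_eq', Finset.mul_sum]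
  refine Finset.sum_congr rfl fun m hm => ?_
  have := h (MvPolynomial.mem_support_iff.mp hm)
  rw [Finsupp.weight_apply, Finsupp.sum_fintype _ _ (by simp)] at this
  simp only [Pi.one_apply, smul_eq_mul, mul_one] at this
  rw [Fin.sum_univ_three] at this
  rw [← this]
  simp only [mul_pow, Fin.prod_univ_three, pow_add]
  ring

lemma hom_pd0 {S : Type*} [CommRing S] [Algebra K S] (u v : S) (d : ℕ) (f : MvPolynomial (Fin 2) K) :
    MvPolynomial.aeval ![u, v, 1] (MvPolynomial.pderiv 0 (homogenization d f)) =
      MvPolynomial.aeval ![u, v] (MvPolynomial.pderiv 0 f) := by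
  have h := chain_rule (MvPolynomial.pderiv 0) ![(MvPolynomial.X 0 : MvPolynomial (Fin 2) K), MvPolynomial.X 1, 1]
    (homogenization d f)
  rw [hom_one] at h
  simp only [Fin.sum_univ_three] at h
  have h2 : MvPolynomial.aeval ![(MvPolynomial.X 0 : MvPolynomial (Fin 2) K), MvPolynomial.X 1] f = f := by
    convert MvPolynomial.aeval_X_left_apply f using 2
    congr 1; funext i; fin_cases i <;> rfl
  rw [h2] at h
  simp only [Matrix.cons_val, MvPolynomial.pderiv_X, Pi.single_apply] at h
  simp at h
  rw [h, ← AlgHom.comp_apply]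
  congr 1
  ext i; fin_cases i <;> simp

lemma hom_pd1 {S : Type*} [CommRing S] [Algebra K S] (u v : S) (d : ℕ) (f : MvPolynomial (Fin 2) K) :
    MvPolynomial.aeval ![u, v, 1] (MvPolynomial.pderiv 1 (homogenization d f)) =
      MvPolynomial.aeval ![u, v] (MvPolynomial.pderiv 1 f) := by
  have h := chain_rule (MvPolynomial.pderiv 1) ![(MvPolynomial.X 0 : MvPolynomial (Fin 2) K), MvPolynomial.X 1, 1]
    (homogenization d f)
  rw [hom_one] at h
  simp only [Fin.sum_univ_three] at h
  have h2 : MvPolynomial.aeval ![(MvPolynomial.X 0 : MvPolynomial (Fin 2) K), MvPolynomial.X 1] f = f := by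
    convert MvPolynomial.aeval_X_left_apply f using 2
    congr 1; funext i; fin_cases i <;> rfl
  rw [h2] at h
  simp only [Matrix.cons_val, MvPolynomial.pderiv_X, Pi.single_apply] at h
  simp at h
  rw [h, ← AlgHom.comp_apply]
  congr 1
  ext i; fin_cases i <;> simp

lemma euler {S : Type*} [CommRing S] [Algebra K S] {G : MvPolynomial (Fin 3) K} {n : ℕ} (h : G.IsHomogeneous n)
    (x : Fin 3 → S) : x 0 * MvPolynomial.aeval x (MvPolynomial.pderiv 0 G) +
      x 1 * MvPolynomial.aeval x (MvPolynomial.pderiv 1 G) + x 2 * MvPolynomial.aeval x (MvPolynomial.pderiv 2 G)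
      = n * MvPolynomial.aeval x G := by
  have := congrArg (MvPolynomial.aeval x) h.sum_X_mul_pderiv
  simpa [Fin.sum_univ_three] using this

lemma hom_pd2 {S : Type*} [CommRing S] [Algebra K S] (u v : S) {d : ℕ} {f : MvPolynomial (Fin 2) K}
    (h : f.totalDegree ≤ d) :
    MvPolynomial.aeval ![u, v, 1] (MvPolynomial.pderiv 2 (homogenization d f)) =
      d * MvPolynomial.aeval ![u, v] f - u * MvPolynomial.aeval ![u, v] (MvPolynomial.pderiv 0 f)
       - v * MvPolynomial.aeval ![u, v] (MvPolynomial.pderiv 1 f) := by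
  have := euler (hom_homog h) ![u, v, 1]
  rw [hom_pd0, hom_pd1, hom_one] at this
  simp only [Matrix.cons_val] at this
  linear_combination this

lemma hom_mul [Infinite K] {g h : MvPolynomial (Fin 2) K} {m n : ℕ} (hg : g.totalDegree ≤ m) (hh : h.totalDegree ≤ n) :
    homogenization (m + n) (g * h) = homogenization m g * homogenization n h := by
  have key : MvPolynomial.X 2 * (homogenization (m + n) (g * h) - homogenization m g * homogenization n h) = 0 := by
    apply MvPolynomial.funext
    intro x
    rw [map_mul, map_zero, MvPolynomial.eval_X]
    by_cases hx : x 2 = 0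
    · rw [hx, zero_mul]
    · have hxx : x = fun i => x 2 * (![x 0 / x 2, x 1 / x 2, 1] : Fin 3 → K) i := by
        funext i; fin_cases i <;> simp <;> field_simp
      have e : ∀ (p : MvPolynomial (Fin 2) K) (l : ℕ), p.totalDegree ≤ l → MvPolynomial.eval x (homogenization l p) =
          x 2 ^ l * MvPolynomial.aeval ![x 0 / x 2, x 1 / x 2] p := by
        intro p l hp
        rw [← hom_one _ _ l, ← hom_scale (hom_homog hp), ← hxx]
        rfl
      rw [map_sub, map_mul, e _ _ hg, e _ _ hh, e _ _ ((MvPolynomial.totalDegree_mul _ _).trans (Nat.add_le_add hg hh)),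
        map_mul]
      ring
  rcases mul_eq_zero.mp key with h | h
  · exact absurd h (MvPolynomial.X_ne_zero _)
  · exact sub_eq_zero.mp h

end
end BW

namespace BW
section
variable {K : Type*} [Field K]

lemma height3 (m : Ideal (MvPolynomial (Fin 3) K)) [m.IsPrime] (hm : ∀ i, MvPolynomial.X i ∈ m) : 3 ≤ m.height := by
  let φ1 : MvPolynomial (Fin 3) K →ₐ[K] MvPolynomial (Fin 3) K := MvPolynomial.aeval ![0, MvPolynomial.X 1, MvPolynomial.X 2]
  let φ2 : MvPolynomial (Fin 3) K →ₐ[K] MvPolynomial (Fin 3) K := MvPolynomial.aeval ![0, 0, MvPolynomial.X 2]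
  let p1 := RingHom.ker φ1.toRingHom
  let p2 := RingHom.ker φ2.toRingHom
  have : p1.IsPrime := RingHom.ker_isPrime _
  have : p2.IsPrime := RingHom.ker_isPrime _
  have h01 : (⊥ : Ideal (MvPolynomial (Fin 3) K)) < p1 := by
    rw [bot_lt_iff_ne_bot, Submodule.ne_bot_iff]
    exact ⟨MvPolynomial.X 0, by simp [p1, φ1], MvPolynomial.X_ne_zero _⟩
  have h12 : p1 < p2 := by
    refine lt_of_le_of_ne ?_ ?_
    · intro g hg
      have h : φ2 = φ2.comp φ1 := by
        ext i; fin_cases i <;> simp [φ1, φ2]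
      change φ2 g = 0
      rw [h, AlgHom.comp_apply, show φ1 g = 0 from hg, map_zero]
    · intro h
      have h1 : (MvPolynomial.X 1 : MvPolynomial (Fin 3) K) ∈ p1 := by
        rw [h]; simp [p2, φ2]
      simp [p1, φ1, MvPolynomial.X_ne_zero] at h1
  have h23 : p2 < m := by
    refine lt_of_le_of_ne ?_ ?_
    · intro g hg
      have h : ∀ q : MvPolynomial (Fin 3) K, q - φ2 q ∈ m := by
        intro q
        induction q using MvPolynomial.induction_on with
        | C a => simp [φ2]
        | add p q hp hq => rw [map_add, add_sub_add_comm]; exact m.add_mem hp hq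
        | mul_X p i hp =>
          have : p * MvPolynomial.X i - φ2 (p * MvPolynomial.X i) = (p - φ2 p) * MvPolynomial.X i
            + φ2 p * (MvPolynomial.X i - φ2 (MvPolynomial.X i)) := by rw [map_mul]; ring
          rw [this]
          refine m.add_mem (m.mul_mem_right _ hp) (m.mul_mem_left _ ?_)
          fin_cases i <;> simp [φ2, hm]
      have := h g
      rwa [show φ2 g = 0 from hg, sub_zero] at this
    · intro h
      have h1 := hm 2
      rw [← h] at h1
      simp [p2, φ2, MvPolynomial.X_ne_zero] at h1
  have a1 : 1 ≤ p1.height := by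
    have := Ideal.height_add_one_le_of_lt_of_isPrime h01
    exact le_trans (by simp) this
  have a2 := Ideal.height_add_one_le_of_lt_of_isPrime h12
  have a3 := Ideal.height_add_one_le_of_lt_of_isPrime h23
  calc (3 : ℕ∞) = 1 + 1 + 1 := by norm_num
    _ ≤ p1.height + 1 + 1 := by gcongr
    _ ≤ p2.height + 1 := by gcongr
    _ ≤ _ := a3

lemma common_zero [IsAlgClosed K] (G H : MvPolynomial (Fin 3) K) (hG : MvPolynomial.eval 0 G = 0)
    (hH : MvPolynomial.eval 0 H = 0) : ∃ x : Fin 3 → K, x ≠ 0 ∧ MvPolynomial.eval x G = 0 ∧ MvPolynomial.eval x H = 0 := by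
  classical
  by_contra hcon
  push Not at hcon
  let I : Ideal (MvPolynomial (Fin 3) K) := Ideal.span (({G, H} : Finset _) : Set (MvPolynomial (Fin 3) K))
  have hz : MvPolynomial.zeroLocus K I = {0} := by
    rw [MvPolynomial.zeroLocus_span]
    ext x
    simp only [Finset.coe_insert, Finset.coe_singleton, Set.mem_insert_iff, Set.mem_singleton_iff, forall_eq_or_imp,
      forall_eq]
    constructor
    · rintro ⟨h1, h2⟩
      by_contra hx
      exact hcon x hx h1 h2
    · rintro rfl
      exact ⟨hG, hH⟩
  have hr := MvPolynomial.vanishingIdeal_zeroLocus_eq_radical (K := K) I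
  rw [hz] at hr
  have hm : ∀ i, MvPolynomial.X i ∈ I.radical := by
    intro i
    rw [← hr, MvPolynomial.mem_vanishingIdeal_singleton_iff]; simp
  have : I.radical.IsPrime := by
    rw [← hr]
    have : MvPolynomial.vanishingIdeal K ({0} : Set (Fin 3 → K)) = RingHom.ker (MvPolynomial.aeval (R := K) (0 : Fin 3 → K)).toRingHom := by
      ext p; rw [MvPolynomial.mem_vanishingIdeal_singleton_iff]; rfl
    rw [this]; exact RingHom.ker_isPrime _
  have h1 := height3 I.radical hm
  have h2 : I.radical ∈ I.minimalPrimes := by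
    rw [← Ideal.radical_minimalPrimes, Ideal.minimalPrimes_eq_subsingleton_self]; rfl
  have h3 := Ideal.height_le_card_of_mem_minimalPrimes_span_finset h2
  have h4 : (({G, H} : Finset (MvPolynomial (Fin 3) K)).card : ℕ∞) ≤ 2 := by exact_mod_cast Finset.card_le_two
  have := h1.trans (h3.trans h4)
  exact absurd this (by norm_num)

/-- smooth plane curve of degree `d`, in base change stable form -/
structure Sm (f : MvPolynomial (Fin 2) K) (d : ℕ) : Prop where
  deg : f.totalDegree = d
  sm : ∀ j : Fin 3, ∃ n, MvPolynomial.X j ^ n ∈ Ideal.span (insert (homogenization d f)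
    (Set.range fun i => MvPolynomial.pderiv i (homogenization d f)))

lemma Sm.of_smooth [IsAlgClosed K] {f : MvPolynomial (Fin 2) K} {d : ℕ} (hd : f.totalDegree = d)
    (h : ∀ x : Fin 3 → K, (MvPolynomial.eval x (homogenization d f) = 0 ∧
      ∀ j : Fin 3, MvPolynomial.eval x (MvPolynomial.pderiv j (homogenization d f)) = 0) → x = 0) : Sm f d := by
  refine ⟨hd, fun j => ?_⟩
  rw [← Ideal.mem_radical_iff, ← MvPolynomial.vanishingIdeal_zeroLocus_eq_radical (K := K), MvPolynomial.mem_vanishingIdeal_iff]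
  intro x hx
  rw [MvPolynomial.zeroLocus_span] at hx
  have h1 : x = 0 := h x ⟨hx _ (Set.mem_insert _ _), fun j => hx _ (Set.mem_insert_of_mem _ ⟨j, rfl⟩)⟩
  rw [h1]; simp

lemma Sm.map {L : Type*} [Field L] (φ : K →+* L) {f : MvPolynomial (Fin 2) K} {d : ℕ} (h : Sm f d) :
    Sm (MvPolynomial.map φ f) d := by
  refine ⟨?_, fun j => ?_⟩
  · rw [← h.deg]
    simp only [MvPolynomial.totalDegree, MvPolynomial.support_map_of_injective _ φ.injective]
  · obtain ⟨n, hn⟩ := h.sm j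
    refine ⟨n, ?_⟩
    have := Ideal.mem_map_of_mem (MvPolynomial.map φ) hn
    rw [Ideal.map_span, map_pow, MvPolynomial.map_X] at this
    refine Ideal.span_mono ?_ this
    rintro _ ⟨g, hg, rfl⟩
    rcases hg with rfl | ⟨i, rfl⟩
    · left; exact hom_map _ _ _
    · right; refine ⟨i, ?_⟩
      simp only [← hom_map, MvPolynomial.pderiv_map]

lemma Sm.zero {f : MvPolynomial (Fin 2) K} {d : ℕ} (h : Sm f d) {L : Type*} [Field L] [Algebra K L] (x : Fin 3 → L)
    (h0 : MvPolynomial.aeval x (homogenization d f) = 0)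
    (h1 : ∀ j : Fin 3, MvPolynomial.aeval x (MvPolynomial.pderiv j (homogenization d f)) = 0) : x = 0 := by
  funext j
  obtain ⟨n, hn⟩ := h.sm j
  have : Ideal.span (insert (homogenization d f)
    (Set.range fun i => MvPolynomial.pderiv i (homogenization d f))) ≤ RingHom.ker (MvPolynomial.aeval (R := K) x).toRingHom := by
    rw [Ideal.span_le]
    rintro g (rfl | ⟨i, rfl⟩)
    · exact h0
    · exact h1 i
  have h2 : MvPolynomial.aeval (R := K) x (MvPolynomial.X j ^ n) = 0 := this hn
  rw [map_pow, MvPolynomial.aeval_X] at h2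
  exact eq_zero_of_pow_eq_zero h2

lemma Sm.aff {f : MvPolynomial (Fin 2) K} {d : ℕ} (h : Sm f d) {L : Type*} [Field L] [Algebra K L] {u v : L}
    (h0 : MvPolynomial.aeval ![u, v] f = 0) (h1 : MvPolynomial.aeval ![u, v] (MvPolynomial.pderiv 0 f) = 0)
    (h2 : MvPolynomial.aeval ![u, v] (MvPolynomial.pderiv 1 f) = 0) : False := by
  have := h.zero ![u, v, 1] (by rw [hom_one, h0]) (by
    intro j
    fin_cases j
    · simp only [Fin.zero_eta]; rw [hom_pd0, h1]
    · simp only [Fin.mk_one]; rw [hom_pd1, h2]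
    · simp only [Fin.reduceFinMk]; rw [hom_pd2 _ _ h.deg.le, h0, h1, h2]; simp)
  have h3 := congrFun this 2
  simp at h3

lemma isUnit_of_deg {f : MvPolynomial (Fin 2) K} (h0 : f ≠ 0) (h : f.totalDegree = 0) : IsUnit f := by
  obtain ⟨c, rfl⟩ : ∃ c, f = MvPolynomial.C c := ⟨_, MvPolynomial.totalDegree_eq_zero_iff_eq_C.mp h⟩
  refine IsUnit.map _ (isUnit_iff_ne_zero.mpr ?_)
  rintro rfl; simp at h0

lemma hom_eval_zero {f : MvPolynomial (Fin 2) K} {d : ℕ} (h : f.totalDegree ≤ d) (hd : d ≠ 0) :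
    MvPolynomial.eval 0 (homogenization d f) = 0 := by
  have := hom_scale (hom_homog h) (0 : Fin 3 → K) 0
  rw [zero_pow hd, zero_mul] at this
  rw [← this]
  change _ = MvPolynomial.eval _ _
  congr 2
  funext i; simp

lemma Sm.irr {f : MvPolynomial (Fin 2) K} {d : ℕ} (h : Sm f d) (hd : d ≠ 0) : Irreducible f := by
  have hf0 : f ≠ 0 := by
    rintro rfl
    apply hd; rw [← h.deg]; simp
  refine ⟨?_, ?_⟩
  · intro hu
    apply hd
    rw [← h.deg]
    exact (MvPolynomial.isUnit_iff_totalDegree_of_isReduced.mp hu).2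
  · intro g1 g2 hg
    have hg1 : g1 ≠ 0 := by rintro rfl; simp [hg] at hf0
    have hg2 : g2 ≠ 0 := by rintro rfl; simp [hg] at hf0
    by_contra hcon
    push Not at hcon
    have e1 : g1.totalDegree ≠ 0 := fun e => hcon.1 (isUnit_of_deg hg1 e)
    have e2 : g2.totalDegree ≠ 0 := fun e => hcon.2 (isUnit_of_deg hg2 e)
    have hde : g1.totalDegree + g2.totalDegree = d := by
      rw [← h.deg, hg, MvPolynomial.totalDegree_mul_of_isDomain hg1 hg2]
    let φ := algebraMap K (AlgebraicClosure K)
    have h1 := h.map φ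
    have d1 : (MvPolynomial.map φ g1).totalDegree ≤ g1.totalDegree := by
      simp only [MvPolynomial.totalDegree, MvPolynomial.support_map_of_injective _ φ.injective]; rfl
    have d2 : (MvPolynomial.map φ g2).totalDegree ≤ g2.totalDegree := by
      simp only [MvPolynomial.totalDegree, MvPolynomial.support_map_of_injective _ φ.injective]; rfl
    obtain ⟨x, hx0, hx1, hx2⟩ := common_zero _ _ (hom_eval_zero d1 e1) (hom_eval_zero d2 e2)
    have hF : homogenization d (MvPolynomial.map φ f) = homogenization g1.totalDegree (MvPolynomial.map φ g1)
      * homogenization g2.totalDegree (MvPolynomial.map φ g2) := by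
      rw [← hde, hg, map_mul, hom_mul d1 d2]
    refine hx0 (h1.zero x ?_ ?_)
    · change MvPolynomial.eval x _ = 0
      rw [hF, map_mul, hx1, zero_mul]
    · intro j
      change MvPolynomial.eval x _ = 0
      rw [hF, Derivation.leibniz, smul_eq_mul, smul_eq_mul, map_add, map_mul, map_mul, hx1, hx2, zero_mul, zero_mul, add_zero]
end
end BW

namespace BW
section
variable {K : Type*} [Field K] {L : Type*} [Field L] [Algebra K L]

open IntermediateField in
/-- elements algebraic over `K(u)` -/
noncomputable def NN (K : Type*) [Field K] {L : Type*} [Field L] [Algebra K L] (u : L) : IntermediateField K L :=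
  (algebraicClosure K⟮u⟯ L).restrictScalars K

open IntermediateField in
lemma mem_NN {u z : L} : z ∈ NN K u ↔ IsAlgebraic K⟮u⟯ z := by
  unfold NN
  rw [IntermediateField.mem_restrictScalars, mem_algebraicClosure_iff]

open IntermediateField in
lemma self_mem_NN (u : L) : u ∈ NN K u := by
  rw [mem_NN]
  exact isAlgebraic_algebraMap (⟨u, IntermediateField.mem_adjoin_simple_self K u⟩ : K⟮u⟯)

lemma alg_mono {M N : IntermediateField K L} (h : M ≤ N) {z : L} (hz : IsAlgebraic M z) : IsAlgebraic N z := by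
  letI := (IntermediateField.inclusion h).toRingHom.toAlgebra
  haveI : IsScalarTower M N L := IsScalarTower.of_algebraMap_eq fun _ => rfl
  exact hz.tower_top (L := N)

open IntermediateField in
lemma NN_closed {M : IntermediateField K L} {u : L} (h : M ≤ NN K u) {z : L} (hz : IsAlgebraic M z) : z ∈ NN K u := by
  have h1 : IsAlgebraic (NN K u) z := alg_mono h hz
  have h2 : IsAlgebraic (algebraicClosure K⟮u⟯ L) z := h1
  rw [mem_NN]
  exact h2.restrictScalars K⟮u⟯

open IntermediateField in
lemma ind2 {p q : L} : AlgebraicIndependent K ![p, q] ↔ Transcendental K p ∧ Transcendental K⟮p⟯ q := by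
  have h := AlgebraicIndependent.option_iff (R := K) (x := fun _ : Unit => p) (a := q)
  have e : AlgebraicIndependent K (fun o : Option Unit => o.elim q (fun _ => p)) ↔ AlgebraicIndependent K ![p, q] := by
    let eq : Option Unit ≃ Fin 2 := 
      ⟨fun o => o.elim 1 (fun _ => 0), ![some (), none], fun o => by rcases o with _ | _ <;> rfl,
        fun i => by fin_cases i <;> rfl⟩
    have h1 := algebraicIndependent_equiv (R := K) eq (f := ![p, q])
    rw [← h1]
    congr! 1
    funext o
    rcases o with _ | _ <;> rfl
  rw [← e, h]
  refine and_congr ?_ ?_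
  · exact algebraicIndependent_singleton_iff ()
  · have : Set.range (fun _ : Unit => p) = {p} := by ext; simp [eq_comm]
    rw [this]
    exact not_congr IntermediateField.isAlgebraic_adjoin_iff.symm

lemma ind2_swap {p q : L} : AlgebraicIndependent K ![p, q] ↔ AlgebraicIndependent K ![q, p] := by
  have h1 := algebraicIndependent_equiv (R := K) (Equiv.swap (0 : Fin 2) 1) (f := ![p, q])
  rw [← h1]
  congr! 1
  funext o
  fin_cases o <;> rfl

open IntermediateField in
lemma NN_not {a b u : L} (h : AlgebraicIndependent K ![a, b]) (ha : a ∈ NN K u) (hb : b ∈ NN K u) : False := by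
  have h1 : ¬ AlgebraicIndependent K ![u, a] := fun h' => (ind2.mp h').2 (mem_NN.mp ha)
  rw [ind2_swap, ind2] at h1
  obtain ⟨h2, h3⟩ := ind2.mp h
  have h4 : u ∈ NN K a := by
    rw [mem_NN]
    by_contra h5
    exact h1 ⟨h2, h5⟩
  have h6 : K⟮u⟯ ≤ NN K a := by
    rw [IntermediateField.adjoin_simple_le_iff]; exact h4
  exact h3 (mem_NN.mp (NN_closed h6 (mem_NN.mp hb)))

lemma NN_curve {f : MvPolynomial (Fin 2) K} (hf : f ≠ 0) {p q : L} (h : MvPolynomial.aeval ![p, q] f = 0) :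
    ∃ u, p ∈ NN K u ∧ q ∈ NN K u := by
  have h1 : ¬ AlgebraicIndependent K ![p, q] := fun h' => hf (h' (by rw [h, map_zero]))
  rw [ind2, not_and_or, Transcendental, not_not, Transcendental, not_not] at h1
  rcases h1 with h1 | h1
  · exact ⟨q, mem_NN.mpr (h1.tower_top _), self_mem_NN q⟩
  · exact ⟨p, self_mem_NN p, mem_NN.mpr h1⟩

/-- generic point lemma -/
lemma GP {f : MvPolynomial (Fin 2) K} (hf : Irreducible f) {P : Fin 2 → L} (h0 : MvPolynomial.aeval P f = 0)
    (hP : ¬ ∀ i, IsAlgebraic K (P i)) (g : MvPolynomial (Fin 2) K) (hg : MvPolynomial.aeval P g = 0) : f ∣ g := by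
  let p := RingHom.ker (MvPolynomial.aeval (R := K) P).toRingHom
  have hp : p.IsPrime := RingHom.ker_isPrime _
  have hs : (Ideal.span {f}).IsPrime := (Ideal.span_singleton_prime hf.ne_zero).mpr hf.prime
  rw [← Ideal.mem_span_singleton]
  by_contra hcon
  apply hP
  have h01 : (⊥ : Ideal (MvPolynomial (Fin 2) K)) < Ideal.span {f} := by
    rw [bot_lt_iff_ne_bot, Submodule.ne_bot_iff]
    exact ⟨f, Ideal.mem_span_singleton_self f, hf.ne_zero⟩
  have h12 : Ideal.span {f} < p := by
    refine lt_of_le_of_ne ?_ ?_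
    · rw [Ideal.span_singleton_le_iff_mem]; exact h0
    · intro h; apply hcon; rw [h]; exact hg
  have hmax : p.IsMaximal := by
    obtain ⟨m, hm, hpm⟩ := p.exists_le_maximal hp.ne_top
    rcases hpm.eq_or_lt with h | h
    · rw [h]; exact hm
    · exfalso
      have a1 : 1 ≤ (Ideal.span {f}).height := le_trans (by simp) (Ideal.height_add_one_le_of_lt_of_isPrime h01)
      have a2 := Ideal.height_add_one_le_of_lt_of_isPrime h12
      have a3 := Ideal.height_add_one_le_of_lt_of_isPrime h
      have a4 : (3 : ℕ∞) ≤ m.height := by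
        calc (3 : ℕ∞) = 1 + 1 + 1 := by norm_num
          _ ≤ (Ideal.span {f}).height + 1 + 1 := by gcongr
          _ ≤ p.height + 1 := by gcongr
          _ ≤ _ := a3
      have a5 : ringKrullDim (MvPolynomial (Fin 2) K) ≤ 2 := by
        rw [MvPolynomial.ringKrullDim_of_isNoetherianRing]; simp
      have a6 := (ringKrullDim_le_iff_height_le 2).mp a5 hm.isPrime
      have a7 : m.height ≤ 2 := WithBot.coe_le_coe.mp (a6 : (m.height : WithBot ℕ∞) ≤ ((2:ℕ∞) : WithBot ℕ∞))
      exact absurd (a4.trans a7) (by norm_num)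
  letI := Ideal.Quotient.field p
  have hfin : Module.Finite K (MvPolynomial (Fin 2) K ⧸ p) := finite_of_finite_type_of_isJacobsonRing K _
  let φ : (MvPolynomial (Fin 2) K ⧸ p) →ₐ[K] L := Ideal.Quotient.liftₐ p (MvPolynomial.aeval P) (fun a ha => ha)
  intro i
  have h1 : IsAlgebraic K (Ideal.Quotient.mk p (MvPolynomial.X i)) := Algebra.IsAlgebraic.isAlgebraic _
  have h2 := h1.algHom φ
  have h3 : φ (Ideal.Quotient.mk p (MvPolynomial.X i)) = P i := by
    change MvPolynomial.aeval P (MvPolynomial.X i) = P i; simp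
  rwa [h3] at h2

/-- existence of derivations -/
lemma der_exists [IsAlgClosed K] {ι : Type*} [Finite ι] (x : ι → L) (h : ∃ i, Transcendental K (x i)) :
    ∃ (W : IntermediateField K L) (w : ι → W) (D : Derivation K W W), (∀ i, (w i : L) = x i) ∧ ∃ i, D (w i) ≠ 0 := by
  classical
  let W := IntermediateField.adjoin K (Set.range x)
  let w : ι → W := fun i => ⟨x i, IntermediateField.subset_adjoin _ _ ⟨i, rfl⟩⟩
  haveI : Algebra.EssFiniteType K W := IntermediateField.essFiniteType_iff.mpr
    ⟨(Set.finite_range x).toFinset, by simp [W]⟩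
  by_contra hcon
  have hz : ∀ D : Derivation K W W, ∀ i, D (w i) = 0 := by
    intro D i; by_contra h'; exact hcon ⟨W, w, D, fun _ => rfl, i, h'⟩
  have hD : ∀ D : Derivation K W W, D = 0 := by
    intro D
    have key : ∀ z (hz : z ∈ IntermediateField.adjoin K (Set.range x)), D ⟨z, hz⟩ = 0 := by
      intro z hzz
      induction hzz using IntermediateField.adjoin_induction with
      | mem z hz' => obtain ⟨i, rfl⟩ := hz'; exact hz D i
      | algebraMap z => exact D.map_algebraMap z
      | add y z hy hz' h1 h2 =>
        have := D.map_add ⟨y, hy⟩ ⟨z, hz'⟩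
        rw [h1, h2, add_zero] at this; exact this
      | inv y hy h1 =>
        have := D.leibniz_inv (⟨y, hy⟩ : W)
        rw [h1, smul_zero] at this; exact this
      | mul y z hy hz' h1 h2 =>
        have := D.leibniz ⟨y, hy⟩ ⟨z, hz'⟩
        rw [h1, h2, smul_zero, smul_zero, add_zero] at this; exact this
    ext z; exact congrArg _ (key z.1 z.2)
  have hsub : Subsingleton (Ω[W⁄K]) := by
    rw [← Module.subsingleton_dual_iff W]
    refine ⟨fun a b => ?_⟩
    apply (KaehlerDifferential.linearMapEquivDerivation K W).injective
    exact (hD _).trans (hD _).symm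
  haveI : Algebra.FormallyUnramified K W := ⟨hsub⟩
  have : Algebra.IsSeparable K W := Algebra.FormallyUnramified.isSeparable K W
  obtain ⟨i, hi⟩ := h
  apply hi
  have h1 : IsAlgebraic K (w i) := Algebra.IsAlgebraic.isAlgebraic _
  exact h1.algHom W.val
end
end BW

namespace BW
section
variable {K : Type*} [Field K]

/-- restriction of a ternary form to a line -/
noncomputable def gs {S : Type*} [CommRing S] [Algebra K S] (G : MvPolynomial (Fin 3) K) (a b z : S) : S[X] :=
  MvPolynomial.aeval ![X, C a * X + C b, C z] G

lemma gs_map {S T : Type*} [CommRing S] [Algebra K S] [CommRing T] [Algebra K T] (φ : S →ₐ[K] T)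
    (G : MvPolynomial (Fin 3) K) (a b z : S) :
    (gs G a b z).map (φ : S →+* T) = gs G (φ a) (φ b) (φ z) := by
  have : (gs G a b z).map (φ : S →+* T) = Polynomial.mapAlgHom φ (gs G a b z) := by simp [Polynomial.mapAlgHom]
  rw [this]; unfold gs
  rw [← AlgHom.comp_apply, MvPolynomial.comp_aeval]
  congr 2
  funext i
  fin_cases i <;> simp

lemma gs_eval {S : Type*} [CommRing S] [Algebra K S] (G : MvPolynomial (Fin 3) K) (a b z r : S) :
    (gs G a b z).eval r = MvPolynomial.aeval ![r, a * r + b, z] G := by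
  have : (gs G a b z).eval r = ((Polynomial.aeval (R := S) r).restrictScalars K) (gs G a b z) := by
    simp [Polynomial.aeval_def]
  rw [this]; unfold gs
  rw [← AlgHom.comp_apply, MvPolynomial.comp_aeval]
  congr 2
  funext i
  fin_cases i <;> simp

lemma gs_eq {S : Type*} [CommRing S] [Algebra K S] (G : MvPolynomial (Fin 3) K) (a b z : S) :
    gs G a b z = ∑ m ∈ G.support, C (algebraMap K S (MvPolynomial.coeff m G) * z ^ m 2) *
      (X ^ m 0 * (C a * X + C b) ^ m 1) := by
  unfold gs
  rw [MvPolynomial.aeval_def, MvPolynomial.eval₂_eq']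
  refine Finset.sum_congr rfl fun m _ => ?_
  simp only [Fin.prod_univ_three, Matrix.cons_val_zero, Matrix.cons_val_one, Matrix.cons_val]
  rw [C_mul, ← C_pow]
  change C _ * _ = _
  ring

lemma lin_deg {S : Type*} [CommRing S] (a b : S) : (C a * X + C b).natDegree ≤ 1 := natDegree_linear_le

lemma homog_sum {G : MvPolynomial (Fin 3) K} {d : ℕ} (h : G.IsHomogeneous d) {m} (hm : m ∈ G.support) :
    m 0 + m 1 + m 2 = d := by
  have := h (MvPolynomial.mem_support_iff.mp hm)
  rw [Finsupp.weight_apply, Finsupp.sum_fintype _ _ (by simp)] at this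
  simpa [Fin.sum_univ_three] using this

lemma term_deg {S : Type*} [CommRing S] (a b : S) (m n : ℕ) : (X ^ m * (C a * X + C b) ^ n).natDegree ≤ m + n := by
  refine natDegree_mul_le.trans (add_le_add (natDegree_X_pow_le m) ?_)
  exact (natDegree_pow_le_of_le n (lin_deg a b)).trans (by simp)

lemma gs_deg {S : Type*} [CommRing S] [Algebra K S] {G : MvPolynomial (Fin 3) K} {d : ℕ} (h : G.IsHomogeneous d)
    (a b z : S) : (gs G a b z).natDegree ≤ d := by
  rw [gs_eq]
  refine natDegree_sum_le_of_forall_le _ _ fun m hm => ?_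
  refine (natDegree_C_mul_le _ _).trans ((term_deg a b _ _).trans ?_)
  have := homog_sum h hm
  omega

lemma gs_coeff {S : Type*} [CommRing S] [Algebra K S] {G : MvPolynomial (Fin 3) K} {d : ℕ} (h : G.IsHomogeneous d)
    (a b z : S) : (gs G a b z).coeff d = MvPolynomial.aeval ![1, a, 0] G := by
  rw [gs_eq, finsetSum_coeff, MvPolynomial.aeval_def, MvPolynomial.eval₂_eq']
  refine Finset.sum_congr rfl fun m hm => ?_
  have h1 := homog_sum h hm
  simp only [Fin.prod_univ_three, Matrix.cons_val_zero, Matrix.cons_val_one, Matrix.cons_val]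
  rw [coeff_C_mul, one_pow, one_mul]
  rcases Nat.eq_zero_or_pos (m 2) with h2 | h2
  · rw [h2, pow_zero, pow_zero, mul_one, mul_one]
    have h3 : d = m 1 + m 0 := by omega
    rw [h3, coeff_X_pow_mul]
    congr 1
    have := coeff_pow_of_natDegree_le (p := C a * X + C b) (n := 1) (m := m 1) (lin_deg a b)
    rw [mul_one] at this
    rw [this]; simp
  · rw [coeff_eq_zero_of_natDegree_lt, zero_pow h2.ne']
    · simp
    · have := term_deg a b (m 0) (m 1)
      omega

/-- leading coefficient polynomial -/
noncomputable def lcp (d : ℕ) (f : MvPolynomial (Fin 2) K) : K[X] := MvPolynomial.aeval ![1, X, 0] (homogenization d f)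

lemma lcp_aeval {S : Type*} [CommRing S] [Algebra K S] (d : ℕ) (f : MvPolynomial (Fin 2) K) (a : S) :
    Polynomial.aeval a (lcp d f) = MvPolynomial.aeval ![1, a, 0] (homogenization d f) := by
  unfold lcp
  rw [← AlgHom.comp_apply, MvPolynomial.comp_aeval]
  congr 2
  funext i
  fin_cases i <;> simp

lemma lcp_ne {d : ℕ} {f : MvPolynomial (Fin 2) K} (h : f.totalDegree = d) (hd : d ≠ 0) : lcp d f ≠ 0 := by
  have hf : f ≠ 0 := by rintro rfl; apply hd; rw [← h]; simp
  obtain ⟨m, hm, hmd⟩ := Finset.exists_mem_eq_sup f.support (MvPolynomial.support_nonempty.mpr hf)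
    (fun s => s.sum fun _ e => e)
  have hmd' : m 0 + m 1 = d := by
    rw [← h, MvPolynomial.totalDegree, hmd, Finsupp.sum_fintype _ _ (by simp), Fin.sum_univ_two]
  intro h0
  have h1 : (lcp d f).coeff (m 1) = MvPolynomial.coeff m f := by
    unfold lcp
    rw [hom_aeval, finsetSum_coeff, Finset.sum_eq_single m]
    · simp [hmd']
    · intro n hn hnm
      have h3 := supp_le h.le hn
      change (C _ * _).coeff _ = 0
      rw [coeff_C_mul]
      simp only [Matrix.cons_val_zero, Matrix.cons_val_one, Matrix.cons_val, one_pow, one_mul]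
      by_cases h2 : n 0 + n 1 = d
      · rw [h2, Nat.sub_self, pow_zero, mul_one, coeff_X_pow, if_neg, mul_zero]
        intro h4
        apply hnm
        ext i
        fin_cases i
        · change n 0 = m 0; omega
        · exact h4.symm
      · rw [zero_pow (by omega)]; simp
    · intro h; exact absurd hm h
  rw [h0] at h1
  exact MvPolynomial.mem_support_iff.mp hm (by rw [← h1, coeff_zero])

/-- restriction of a binary polynomial to a line -/
noncomputable def gp {S : Type*} [CommRing S] [Algebra K S] (f : MvPolynomial (Fin 2) K) (a b : S) : S[X] :=
  MvPolynomial.aeval ![X, C a * X + C b] f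

lemma gp_gs {S : Type*} [CommRing S] [Algebra K S] (d : ℕ) (f : MvPolynomial (Fin 2) K) (a b : S) :
    gp f a b = gs (homogenization d f) a b 1 := by
  unfold gp gs
  rw [C_1, hom_one]

lemma gp_map {S T : Type*} [CommRing S] [Algebra K S] [CommRing T] [Algebra K T] (φ : S →ₐ[K] T)
    (f : MvPolynomial (Fin 2) K) (a b : S) :
    (gp f a b).map (φ : S →+* T) = gp f (φ a) (φ b) := by
  rw [gp_gs 0, gs_map, gp_gs 0, map_one]

lemma gp_eval {S : Type*} [CommRing S] [Algebra K S] (f : MvPolynomial (Fin 2) K) (a b r : S) :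
    (gp f a b).eval r = MvPolynomial.aeval ![r, a * r + b] f := by
  rw [gp_gs 0, gs_eval, hom_one]

lemma gp_deg {S : Type*} [CommRing S] [Algebra K S] {f : MvPolynomial (Fin 2) K} {d : ℕ} (h : f.totalDegree ≤ d) (a b : S) :
    (gp f a b).natDegree ≤ d := by
  rw [gp_gs d]; exact gs_deg (hom_homog h) _ _ _

lemma gp_coeff {S : Type*} [CommRing S] [Algebra K S] {f : MvPolynomial (Fin 2) K} {d : ℕ} (h : f.totalDegree ≤ d) (a b : S) :
    (gp f a b).coeff d = Polynomial.aeval a (lcp d f) := by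
  rw [gp_gs d, gs_coeff (hom_homog h), lcp_aeval]

lemma gp_der {S : Type*} [CommRing S] [Algebra K S] (f : MvPolynomial (Fin 2) K) (a b : S) :
    derivative (gp f a b) = gp (MvPolynomial.pderiv 0 f) a b + C a * gp (MvPolynomial.pderiv 1 f) a b := by
  have h := chain_rule ((Polynomial.derivative' (R := S)).restrictScalars K) ![X, C a * X + C b] f
  have e : ∀ p : S[X], ((Polynomial.derivative' (R := S)).restrictScalars K) p = derivative p := fun _ => rfl
  simp only [Fin.sum_univ_two, e, Matrix.cons_val_zero, Matrix.cons_val_one] at h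
  unfold gp
  rw [h]
  simp; ring
end
end BW

namespace BW
section
variable {K : Type*} [Field K]

lemma roots_ex {S : Type*} [Field S] [IsAlgClosed S] (P : S[X]) (n : ℕ) (hn : P.natDegree = n) :
    ∃ y : Fin n → S, P = C P.leadingCoeff * ∏ j, (X - C (y j)) := by
  have h1 := (IsAlgClosed.splits P).natDegree_eq_card_roots
  have h2 := (IsAlgClosed.splits P).eq_prod_roots
  rw [hn] at h1
  have h3 : P.roots.toList.length = n := by rw [Multiset.length_toList, h1]
  refine ⟨fun j => P.roots.toList.get (Fin.cast h3.symm j), ?_⟩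
  conv_lhs => rw [h2]
  congr 1
  have h4 : P.roots = Multiset.map (fun j : Fin n => P.roots.toList.get (Fin.cast h3.symm j)) Finset.univ.val := by
    conv_lhs => rw [← Multiset.coe_toList P.roots]
    have : P.roots.toList = List.ofFn (fun j : Fin n => P.roots.toList.get (Fin.cast h3.symm j)) := by
      apply List.ext_get
      · simp [h3]
      · intro i h5 h6; simp
    conv_lhs => rw [this]
    simp
  conv_lhs => rw [h4]
  rw [Multiset.map_map]; rfl

/-- the resultant of two forms restricted to a line -/
noncomputable def rr {S : Type*} [CommRing S] [Algebra K S] (F H : MvPolynomial (Fin 3) K) (d n : ℕ) (t : K) (y z : S) : S :=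
  resultant (gs F (algebraMap K S t) y z) (gs H (algebraMap K S t) y z) d n

lemma rr_map {S T : Type*} [CommRing S] [Algebra K S] [CommRing T] [Algebra K T] (φ : S →ₐ[K] T)
    (F H : MvPolynomial (Fin 3) K) (d n : ℕ) (t : K) (y z : S) :
    φ (rr F H d n t y z) = rr F H d n t (φ y) (φ z) := by
  unfold rr
  have := resultant_map_map (gs F (algebraMap K S t) y z) (gs H (algebraMap K S t) y z) d n (φ : S →+* T)
  rw [gs_map, gs_map, AlgHom.commutes] at this
  exact this.symm

lemma rr_prod {S : Type*} [Field S] [Algebra K S] {F H : MvPolynomial (Fin 3) K} {d n : ℕ}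
    (hH : H.IsHomogeneous n) (t : K) (y z : S) (c : S) (hc : c ≠ 0) (ξ : Fin d → S)
    (h : gs F (algebraMap K S t) y z = C c * ∏ j, (X - C (ξ j))) :
    rr F H d n t y z = c ^ n * ∏ j, MvPolynomial.aeval ![ξ j, algebraMap K S t * ξ j + y, z] H := by
  unfold rr
  set P := gs F (algebraMap K S t) y z
  have hm : (∏ j, (X - C (ξ j))).Monic := monic_prod_of_monic _ _ fun j _ => monic_X_sub_C _
  have hd : P.natDegree = d := by
    rw [h, natDegree_C_mul hc, natDegree_prod_of_monic _ _ fun j _ => monic_X_sub_C _]; simp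
  have hl : P.leadingCoeff = c := by
    rw [h, leadingCoeff_mul, hm.leadingCoeff, leadingCoeff_C, mul_one]
  have hr : P.roots = Finset.univ.val.map ξ := by
    rw [h, roots_C_mul _ hc]
    have := roots_multiset_prod_X_sub_C (Finset.univ.val.map ξ)
    rw [Multiset.map_map] at this
    exact this
  have hs : P.Splits := by
    rw [h]
    exact (Splits.C c).mul (Splits.prod fun j _ => Splits.X_sub_C _)
  have := resultant_eq_prod_eval P (gs H (algebraMap K S t) y z) n (gs_deg hH _ _ _) hs
  rw [hd, hl, hr, Multiset.map_map] at this
  rw [this]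
  congr 1
  change ∏ j, _ = _
  refine Finset.prod_congr rfl fun j _ => ?_
  simp [gs_eval]

lemma gs_split {S : Type*} [Field S] [IsAlgClosed S] [Algebra K S] {F : MvPolynomial (Fin 3) K} {d : ℕ}
    (hF : F.IsHomogeneous d) (a y z : S) (h0 : MvPolynomial.aeval ![1, a, 0] F ≠ 0) :
    ∃ ξ : Fin d → S, gs F a y z = C (MvPolynomial.aeval ![1, a, 0] F) * ∏ j, (X - C (ξ j)) := by
  have h1 := gs_coeff hF a y z
  have hd : (gs F a y z).natDegree = d :=
    natDegree_eq_of_le_of_coeff_ne_zero (gs_deg hF _ _ _) (by rw [h1]; exact h0)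
  have hl : (gs F a y z).leadingCoeff = MvPolynomial.aeval ![1, a, 0] F := by rw [leadingCoeff, hd, h1]
  rw [← hl]
  exact roots_ex _ _ hd

lemma lc_map {S : Type*} [CommRing S] [Algebra K S] (F : MvPolynomial (Fin 3) K) (t : K) :
    MvPolynomial.aeval ![1, algebraMap K S t, 0] F = algebraMap K S (MvPolynomial.aeval ![1, t, 0] F) := by
  have : algebraMap K S (MvPolynomial.aeval ![1, t, 0] F) = Algebra.ofId K S (MvPolynomial.aeval ![1, t, 0] F) := rfl
  rw [this, ← AlgHom.comp_apply, MvPolynomial.comp_aeval]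
  congr 2
  funext i
  fin_cases i <;> simp [Algebra.ofId]

lemma rr_eval {S : Type*} [CommRing S] [Algebra K S] (F H : MvPolynomial (Fin 3) K) (d n : ℕ) (t : K) (y : S) :
    Polynomial.aeval y (rr F H d n t (X : K[X]) 1) = rr F H d n t y 1 := by
  rw [rr_map, aeval_X, map_one]

lemma rr_eval' {S : Type*} [CommRing S] [Algebra K S] (F H : MvPolynomial (Fin 3) K) (d n : ℕ) (t : K) (y : S) :
    Polynomial.aeval y (rr F H d n t (1 : K[X]) X) = rr F H d n t 1 y := by
  rw [rr_map, aeval_X, map_one]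

lemma rr_scale [IsAlgClosed K] {F H : MvPolynomial (Fin 3) K} {d n : ℕ}
    (hF : F.IsHomogeneous d) (hH : H.IsHomogeneous n) (t : K) (h0 : MvPolynomial.aeval ![1, t, 0] F ≠ 0)
    (y : K) (hy : y ≠ 0) : rr F H d n t y 1 = y ^ (d * n) * rr F H d n t 1 y⁻¹ := by
  obtain ⟨ξ, hξ⟩ := gs_split hF t 1 y⁻¹ h0
  have h2 : gs F t y 1 = C (MvPolynomial.aeval ![1, t, 0] F) * ∏ j, (X - C (y * ξ j)) := by
    apply Polynomial.funext
    intro r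
    have h3 := congrArg (Polynomial.eval (y⁻¹ * r)) hξ
    rw [gs_eval, eval_mul, eval_C, eval_prod] at h3
    rw [gs_eval, eval_mul, eval_C, eval_prod]
    have h4 := hom_scale hF ![y⁻¹ * r, t * (y⁻¹ * r) + 1, y⁻¹] y
    rw [h3] at h4
    have h5 : (fun i => y * ![y⁻¹ * r, t * (y⁻¹ * r) + 1, y⁻¹] i) = ![r, t * r + y, 1] := by
      funext i
      fin_cases i
      · simp [hy]
      · simp; field_simp
      · simp [hy]
    rw [h5] at h4
    rw [h4, mul_left_comm]
    congr 1
    have : y ^ d = ∏ _j : Fin d, y := by simp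
    rw [this, ← Finset.prod_mul_distrib]
    refine Finset.prod_congr rfl fun j _ => ?_
    simp; field_simp
  rw [rr_prod hH t y 1 _ h0 _ h2, rr_prod hH t 1 y⁻¹ _ h0 ξ hξ, mul_left_comm]
  congr 1
  have : y ^ (d * n) = ∏ _j : Fin d, y ^ n := by simp [pow_mul']
  rw [this, ← Finset.prod_mul_distrib]
  refine Finset.prod_congr rfl fun j _ => ?_
  rw [← hom_scale hH]
  congr 2
  funext i
  fin_cases i
  · simp
  · simp; ring
  · simp [hy]

lemma rr_deg [IsAlgClosed K] {F H : MvPolynomial (Fin 3) K} {d n : ℕ}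
    (hF : F.IsHomogeneous d) (hH : H.IsHomogeneous n) (t : K) (h0 : MvPolynomial.aeval ![1, t, 0] F ≠ 0)
    (h1 : rr F H d n t (1 : K) 0 ≠ 0) : (rr F H d n t (X : K[X]) 1).natDegree = d * n := by
  set R := rr F H d n t (X : K[X]) 1 with hR
  set Q := rr F H d n t (1 : K[X]) X with hQ
  have hQ0 : Q.coeff 0 ≠ 0 := by
    rw [coeff_zero_eq_eval_zero, ← coe_aeval_eq_eval]
    change Polynomial.aeval (0 : K) Q ≠ 0
    rw [hQ, rr_eval']; exact h1
  have hQn : Q ≠ 0 := by rintro h; rw [h] at hQ0; simp at hQ0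
  have key : R * X ^ Q.natDegree = X ^ (d * n) * Q.reverse := by
    have : Infinite K := IsAlgClosed.instInfinite
    apply Polynomial.eq_of_infinite_eval_eq
    refine Set.Infinite.mono ?_ (Set.finite_singleton (0 : K)).infinite_compl
    intro y hy
    have hy : y ≠ 0 := hy
    change eval y _ = eval y _
    have e1 : eval y R = y ^ (d * n) * eval y⁻¹ Q := by
      have a1 : eval y R = rr F H d n t y 1 := by rw [← rr_eval, coe_aeval_eq_eval]
      have a2 : eval y⁻¹ Q = rr F H d n t 1 y⁻¹ := by rw [← rr_eval', coe_aeval_eq_eval]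
      rw [a1, a2]; exact rr_scale hF hH t h0 y hy
    letI : Invertible y⁻¹ := invertibleOfNonzero (inv_ne_zero hy)
    have e2 := eval₂_reverse_mul_pow (RingHom.id K) y⁻¹ Q
    simp only [invOf_eq_inv, inv_inv] at e2
    change eval y Q.reverse * _ = eval y⁻¹ Q at e2
    rw [eval_mul, eval_mul, eval_pow, eval_pow, eval_X, e1, ← e2, mul_assoc, mul_assoc, ← mul_pow, inv_mul_cancel₀ hy, one_pow, mul_one]
  have hrev : Q.reverse.natDegree = Q.natDegree := by
    rw [reverse_natDegree, natTrailingDegree_eq_zero.mpr (Or.inr hQ0), Nat.sub_zero]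
  have hrev0 : Q.reverse ≠ 0 := by simpa using hQn
  have hR0 : R ≠ 0 := by
    rintro h; rw [h, zero_mul] at key
    exact (mul_ne_zero (pow_ne_zero _ X_ne_zero) hrev0) key.symm
  have := congrArg natDegree key
  rw [natDegree_mul hR0 (pow_ne_zero _ X_ne_zero), natDegree_mul (pow_ne_zero _ X_ne_zero) hrev0, natDegree_X_pow, natDegree_X_pow, hrev] at this
  omega
end
end BW

namespace BW
section
variable {K : Type*} [Field K]

/-- numerator of the second derivative of an implicit function -/
noncomputable def Hess (f : MvPolynomial (Fin 2) K) : MvPolynomial (Fin 2) K :=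
  MvPolynomial.pderiv 0 (MvPolynomial.pderiv 0 f) * MvPolynomial.pderiv 1 f ^ 2
    - 2 * MvPolynomial.pderiv 0 (MvPolynomial.pderiv 1 f) * MvPolynomial.pderiv 0 f * MvPolynomial.pderiv 1 f
    + MvPolynomial.pderiv 1 (MvPolynomial.pderiv 1 f) * MvPolynomial.pderiv 0 f ^ 2

lemma pd_comm (f : MvPolynomial (Fin 2) K) : MvPolynomial.pderiv 1 (MvPolynomial.pderiv 0 f) =
    MvPolynomial.pderiv 0 (MvPolynomial.pderiv 1 f) := by
  classical
  induction f using MvPolynomial.induction_on with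
  | C a => simp
  | add p q hp hq => simp [hp, hq]
  | mul_X p i hp =>
    fin_cases i
    · simp [hp, MvPolynomial.pderiv_X]; ring
    · simp [hp, MvPolynomial.pderiv_X]; ring

lemma av2 {S T : Type*} [CommRing S] [Algebra K S] [CommRing T] [Algebra K T] (φ : S →ₐ[K] T) (p q : S)
    (g : MvPolynomial (Fin 2) K) : φ (MvPolynomial.aeval ![p, q] g) = MvPolynomial.aeval ![φ p, φ q] g := by
  rw [← AlgHom.comp_apply, MvPolynomial.comp_aeval]
  congr 2
  funext i
  fin_cases i <;> simp

lemma chain2 {W : Type*} [Field W] [Algebra K W] (D : Derivation K W W) (x y : W) (g : MvPolynomial (Fin 2) K) :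
    D (MvPolynomial.aeval ![x, y] g) = MvPolynomial.aeval ![x, y] (MvPolynomial.pderiv 0 g) * D x +
      MvPolynomial.aeval ![x, y] (MvPolynomial.pderiv 1 g) * D y := by
  rw [chain_rule, Fin.sum_univ_two]; simp

/-- infinitesimal variation of the gradient -/
lemma grad_var {W : Type*} [Field W] [Algebra K W] (D : Derivation K W W) {f : MvPolynomial (Fin 2) K} {d : ℕ} (h : Sm f d)
    (x y : W) (h0 : MvPolynomial.aeval ![x, y] f = 0) (hH : MvPolynomial.aeval ![x, y] (Hess f) = 0) :
    MvPolynomial.aeval ![x, y] (MvPolynomial.pderiv 0 f) * D (MvPolynomial.aeval ![x, y] (MvPolynomial.pderiv 1 f)) =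
     MvPolynomial.aeval ![x, y] (MvPolynomial.pderiv 1 f) * D (MvPolynomial.aeval ![x, y] (MvPolynomial.pderiv 0 f)) := by
  have e1 := chain2 D x y f
  rw [h0, map_zero] at e1
  rw [chain2, chain2, pd_comm]
  simp only [Hess, map_add, map_sub, map_mul, map_pow, map_ofNat] at hH
  have hA := fun u v => h.aff h0 u v
  generalize MvPolynomial.aeval ![x, y] (MvPolynomial.pderiv 0 f) = A at *
  generalize MvPolynomial.aeval ![x, y] (MvPolynomial.pderiv 1 f) = B at *
  generalize MvPolynomial.aeval ![x, y] (MvPolynomial.pderiv 0 (MvPolynomial.pderiv 0 f)) = fxx at *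
  generalize MvPolynomial.aeval ![x, y] (MvPolynomial.pderiv 0 (MvPolynomial.pderiv 1 f)) = fxy at *
  generalize MvPolynomial.aeval ![x, y] (MvPolynomial.pderiv 1 (MvPolynomial.pderiv 1 f)) = fyy at *
  by_cases hA0 : A = 0
  · have hB : B ≠ 0 := fun hb => hA hA0 hb
    apply mul_left_cancel₀ hB
    linear_combination (-(A * fyy - B * fxy)) * e1 - D x * hH
  · apply mul_left_cancel₀ hA0
    linear_combination (A * fxy - B * fxx) * (-e1) + D y * hH

lemma wr {W : Type*} [Field W] {A B DA DB x y Dx Dy l1 l2 m1 m2 : W}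
    (h : A * DB = B * DA) (h' : 0 = A * Dx + B * Dy) :
    (DA + l1 * DB + l2 * (- (Dx * A + x * DA) - (Dy * B + y * DB))) * (A + m1 * B + m2 * (- x * A - y * B)) =
    (A + l1 * B + l2 * (- x * A - y * B)) * (DA + m1 * DB + m2 * (- (Dx * A + x * DA) - (Dy * B + y * DB))) := by
  have e : ∀ n : W, n * (- (Dx * A + x * DA) - (Dy * B + y * DB)) = n * (- x * DA - y * DB) := by
    intro n; linear_combination n * h'
  rw [e, e]
  linear_combination (-((1 - l2 * x) * (m1 - m2 * y)) + (l1 - l2 * y) * (1 - m2 * x)) * h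

lemma prodD {W : Type*} [Field W] [Algebra K W] (D : Derivation K W W) {ι : Type*} (s : Finset ι) (u v : ι → W)
    (h : ∀ j ∈ s, D (u j) * v j = u j * D (v j)) : D (∏ j ∈ s, u j) * ∏ j ∈ s, v j = (∏ j ∈ s, u j) * D (∏ j ∈ s, v j) := by
  classical
  induction s using Finset.induction_on with
  | empty => simp
  | insert a s ha ih =>
    rw [Finset.prod_insert ha, Finset.prod_insert ha, D.leibniz, D.leibniz]
    have h1 := h a (Finset.mem_insert_self _ _)
    have h2 := ih fun j hj => h j (Finset.mem_insert_of_mem hj)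
    simp only [smul_eq_mul]
    linear_combination (u a * v a) * h2 + (∏ j ∈ s, u j) * (∏ j ∈ s, v j) * h1

lemma gen_l [Infinite K] (S : Finset (Fin 3 → K)) (hS : ∀ s ∈ S, s ≠ 0) :
    ∃ τ : K, ∀ s ∈ S, s 0 + τ * s 1 + τ ^ 2 * s 2 ≠ 0 := by
  classical
  let p : K[X] := ∏ s ∈ S, (C (s 0) + X * C (s 1) + X ^ 2 * C (s 2))
  have hp : p ≠ 0 := by
    refine Finset.prod_ne_zero_iff.mpr fun s hs h => hS s hs ?_
    have h0 := congrArg (fun q => coeff q 0) h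
    have h1 := congrArg (fun q => coeff q 1) h
    have h2 := congrArg (fun q => coeff q 2) h
    simp [coeff_X, coeff_C, coeff_X_pow] at h0 h1 h2
    funext i
    fin_cases i
    · exact h0
    · exact h1
    · exact h2
  obtain ⟨τ, hτ⟩ := Polynomial.exists_eval_ne_zero_of_natDegree_lt_card p hp (by
    exact Cardinal.natCast_lt_aleph0.trans_le (Cardinal.aleph0_le_mk K))
  refine ⟨τ, fun s hs => ?_⟩
  rw [eval_prod] at hτ
  have := Finset.prod_ne_zero_iff.mp hτ s hs
  intro h; apply this; simp only [eval_add, eval_mul, eval_C, eval_X, eval_pow]; exact h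

lemma not_dvd_der {S : Type*} [Field S] {P : S[X]} {d : ℕ} (hP : P.natDegree ≤ d) (hc : P.coeff d ≠ 0) (hd : (d : S) ≠ 0) :
    ¬ P ∣ derivative P := by
  intro h
  have hd0 : d ≠ 0 := by rintro rfl; simp at hd
  have h1 : P.natDegree = d := natDegree_eq_of_le_of_coeff_ne_zero hP hc
  have h2 := eq_zero_of_dvd_of_natDegree_lt h (natDegree_derivative_lt (by rw [h1]; exact hd0))
  have h3 := congrArg (fun q => coeff q (d - 1)) h2
  simp only [coeff_derivative, coeff_zero] at h3
  rw [Nat.sub_add_cancel (by omega)] at h3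
  have h4 : (((d - 1 : ℕ) : S) + 1) = d := by
    have : d - 1 + 1 = d := by omega
    rw [← Nat.cast_succ, Nat.succ_eq_add_one, this]
  rw [h4] at h3
  exact (mul_ne_zero hc hd) h3
end
end BW

namespace BW
section
variable {K : Type*} [Field K]

/-- polar curve -/
noncomputable def pol (F : MvPolynomial (Fin 3) K) (τ : K) : MvPolynomial (Fin 3) K :=
  MvPolynomial.pderiv 0 F + MvPolynomial.C τ * MvPolynomial.pderiv 1 F + MvPolynomial.C (τ ^ 2) * MvPolynomial.pderiv 2 F

lemma pol_homog {F : MvPolynomial (Fin 3) K} {d : ℕ} (hF : F.IsHomogeneous d) (τ : K) : (pol F τ).IsHomogeneous (d - 1) := by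
  unfold pol
  refine (MvPolynomial.IsHomogeneous.add hF.pderiv ?_).add ?_
  · have := (MvPolynomial.isHomogeneous_C (Fin 3) τ).mul (hF.pderiv (i := 1))
    rwa [zero_add] at this
  · have := (MvPolynomial.isHomogeneous_C (Fin 3) (τ ^ 2)).mul (hF.pderiv (i := 2))
    rwa [zero_add] at this

lemma rr_good [IsAlgClosed K] {f : MvPolynomial (Fin 2) K} {d : ℕ} (h : Sm f d) (t : K)
    (h0 : MvPolynomial.aeval ![1, t, 0] (homogenization d f) ≠ 0) (y z : K) (hyz : ¬ (y = 0 ∧ z = 0)) :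
    ∃ S : Finset (Fin 3 → K), (∀ s ∈ S, s ≠ 0) ∧ ∀ τ : K, (∀ s ∈ S, s 0 + τ * s 1 + τ ^ 2 * s 2 ≠ 0) →
      rr (homogenization d f) (pol (homogenization d f) τ) d (d - 1) t y z ≠ 0 := by
  classical
  set F := homogenization d f
  have hF : F.IsHomogeneous d := hom_homog h.deg.le
  obtain ⟨ξ, hξ⟩ := gs_split hF t y z h0
  have hz : ∀ j, MvPolynomial.aeval ![ξ j, t * ξ j + y, z] F = 0 := by
    intro j
    rw [← gs_eval, hξ, eval_mul, eval_prod, Finset.prod_eq_zero (Finset.mem_univ j), mul_zero]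
    simp
  refine ⟨Finset.univ.image fun j i => MvPolynomial.aeval ![ξ j, t * ξ j + y, z] (MvPolynomial.pderiv i F), ?_, ?_⟩
  · intro s hs
    obtain ⟨j, -, rfl⟩ := Finset.mem_image.mp hs
    intro h1
    have h2 := h.zero ![ξ j, t * ξ j + y, z] (hz j) (fun i => congrFun h1 i)
    apply hyz
    have e0 := congrFun h2 0
    have e1 := congrFun h2 1
    have e2 := congrFun h2 2
    simp at e0 e1 e2
    rw [e0] at e1
    exact ⟨by simpa using e1, e2⟩
  · intro τ hτ
    rw [rr_prod (pol_homog hF τ) t y z _ h0 ξ hξ]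
    refine mul_ne_zero (pow_ne_zero _ h0) (Finset.prod_ne_zero_iff.mpr fun j _ => ?_)
    have := hτ _ (Finset.mem_image_of_mem _ (Finset.mem_univ j))
    simp only [pol, map_add, map_mul, MvPolynomial.aeval_C]
    exact this

lemma two_pol [IsAlgClosed K] {f : MvPolynomial (Fin 2) K} {d : ℕ} (h : Sm f d) (t : K)
    (h0 : MvPolynomial.aeval ![1, t, 0] (homogenization d f) ≠ 0) (hdn : d * (d - 1) ≠ 0) :
    ∃ τ σ : K, 
      (rr (homogenization d f) (pol (homogenization d f) τ) d (d - 1) t (X : K[X]) 1).natDegree = d * (d - 1) ∧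
      IsCoprime (rr (homogenization d f) (pol (homogenization d f) τ) d (d - 1) t (X : K[X]) 1)
        (rr (homogenization d f) (pol (homogenization d f) σ) d (d - 1) t (X : K[X]) 1) := by
  classical
  have : Infinite K := IsAlgClosed.instInfinite
  set F := homogenization d f
  have hF : F.IsHomogeneous d := hom_homog h.deg.le
  obtain ⟨S1, hS1, h1⟩ := rr_good h t h0 1 0 (by simp)
  obtain ⟨τ, hτ⟩ := gen_l S1 hS1
  have hd := rr_deg hF (pol_homog hF τ) t h0 (h1 τ hτ)
  choose T hT1 hT2 using fun y : K => rr_good h t h0 y 1 (by simp)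
  set R := rr F (pol F τ) d (d - 1) t (X : K[X]) 1
  obtain ⟨σ, hσ⟩ := gen_l (R.roots.toFinset.biUnion T) (by
    intro s hs
    obtain ⟨y, -, hy⟩ := Finset.mem_biUnion.mp hs
    exact hT1 y s hy)
  refine ⟨τ, σ, hd, ?_⟩
  have hR : R ≠ 0 := by
    intro hR
    rw [hR, natDegree_zero] at hd; exact hdn hd.symm
  refine (Polynomial.isCoprime_iff_aeval_ne_zero_of_isAlgClosed (k := K) K _ _).mpr ?_
  intro y
  by_contra! hcon
  have hy : y ∈ R.roots.toFinset := by
    rw [Multiset.mem_toFinset, mem_roots hR, IsRoot]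
    have := hcon.1
    rwa [coe_aeval_eq_eval] at this
  have := hT2 y σ fun s hs => hσ s (Finset.mem_biUnion.mpr ⟨y, hy, hs⟩)
  apply this
  have h3 := rr_eval F (pol F σ) d (d - 1) t y
  rw [← h3]; exact hcon.2

lemma pol_aff {S : Type*} [CommRing S] [Algebra K S] {f : MvPolynomial (Fin 2) K} {d : ℕ} (h : f.totalDegree ≤ d) (τ : K) (u v : S)
    (h0 : MvPolynomial.aeval ![u, v] f = 0) :
    MvPolynomial.aeval ![u, v, 1] (pol (homogenization d f) τ) =
      MvPolynomial.aeval ![u, v] (MvPolynomial.pderiv 0 f) + algebraMap K S τ * MvPolynomial.aeval ![u, v] (MvPolynomial.pderiv 1 f)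
      + algebraMap K S (τ ^ 2) * (- u * MvPolynomial.aeval ![u, v] (MvPolynomial.pderiv 0 f) - v * MvPolynomial.aeval ![u, v] (MvPolynomial.pderiv 1 f)) := by
  simp only [pol, map_add, map_mul, MvPolynomial.aeval_C]
  rw [hom_pd0, hom_pd1, hom_pd2 _ _ h, h0]; ring

set_option maxHeartbeats 1000000 in
theorem F0 [IsAlgClosed K] {f : MvPolynomial (Fin 2) K} {d : ℕ} (h : Sm f d) (hd : (d : K) ≠ 0) (hd1 : ((d - 1 : ℕ) : K) ≠ 0) :
    ¬ f ∣ Hess f := by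
  rintro ⟨q, hq⟩
  have : Infinite K := IsAlgClosed.instInfinite
  have hd0 : d ≠ 0 := by rintro rfl; simp at hd
  have hd10 : d - 1 ≠ 0 := by intro h; rw [h] at hd1; simp at hd1
  have hirr := h.irr hd0
  obtain ⟨t, ht⟩ := Polynomial.exists_eval_ne_zero_of_natDegree_lt_card (lcp d f) (lcp_ne h.deg hd0) (by
    exact Cardinal.natCast_lt_aleph0.trans_le (Cardinal.aleph0_le_mk K))
  have h0 : MvPolynomial.aeval ![1, t, 0] (homogenization d f) ≠ 0 := by
    rw [← lcp_aeval, coe_aeval_eq_eval]; exact ht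
  obtain ⟨τ, σ, hdeg, hcop⟩ := two_pol h t h0 (Nat.mul_ne_zero hd0 hd10)
  set F := homogenization d f with hFdef
  have hF : F.IsHomogeneous d := hom_homog h.deg.le
  set R1 := rr F (pol F τ) d (d - 1) t (X : K[X]) 1 with hR1
  set R2 := rr F (pol F σ) d (d - 1) t (X : K[X]) 1 with hR2
  -- the generic line of slope `t`
  let Ω := AlgebraicClosure (FractionRing K[X])
  let b : Ω := algebraMap K[X] Ω X
  have hb : Transcendental K b :=
    (transcendental_algebraMap_iff (by
      rw [IsScalarTower.algebraMap_eq K[X] (FractionRing K[X]) Ω]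
      exact (algebraMap (FractionRing K[X]) Ω).injective.comp (IsFractionRing.injective K[X] (FractionRing K[X])))).mpr (transcendental_X K)
  have h0' : MvPolynomial.aeval ![1, algebraMap K Ω t, 0] F ≠ 0 := by
    rw [lc_map]; simpa using h0
  obtain ⟨ξ, hξ⟩ := gs_split hF (algebraMap K Ω t) b 1 h0'
  obtain ⟨W, w, D, hw, i, hi⟩ := der_exists (K := K) (fun o : Option (Fin d) => o.elim b ξ) ⟨none, hb⟩
  have hbW : Transcendental K (w none) := by
    rw [← transcendental_algebraMap_iff (A := Ω) (FaithfulSMul.algebraMap_injective W Ω)]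
    change Transcendental K ((w none : W) : Ω)
    rw [hw]; exact hb
  have h0W : MvPolynomial.aeval ![1, algebraMap K W t, 0] F ≠ 0 := by
    rw [lc_map]; simpa using h0
  have hgW : gs F (algebraMap K W t) (w none) 1 = C (MvPolynomial.aeval ![1, algebraMap K W t, 0] F) *
      ∏ j, (X - C (w (some j))) := by
    apply Polynomial.map_injective (W.val : W →+* Ω) W.val.injective
    rw [gs_map, Polynomial.map_mul, Polynomial.map_C, Polynomial.map_prod, lc_map]
    have e1 : W.val (w none) = b := hw none
    rw [e1, map_one, AlgHom.commutes, hξ, lc_map]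
    refine congrArg₂ _ (congrArg C (AlgHom.commutes W.val _).symm) (Finset.prod_congr rfl fun j _ => ?_)
    rw [Polynomial.map_sub, map_X, map_C]
    congr 2
    exact (hw (some j)).symm
  have hz : ∀ j, MvPolynomial.aeval ![w (some j), algebraMap K W t * w (some j) + w none] f = 0 := by
    intro j
    rw [← gp_eval, gp_gs d, hgW, eval_mul, eval_prod, Finset.prod_eq_zero (Finset.mem_univ j), mul_zero]
    simp
  have hDc : ∀ c : K, D (algebraMap K W c) = 0 := fun c => D.map_algebraMap c
  have hDy : ∀ j, D (algebraMap K W t * w (some j) + w none) = algebraMap K W t * D (w (some j)) + D (w none) := by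
    intro j
    rw [map_add, D.leibniz, hDc]; simp
  have hsep : ∀ j, MvPolynomial.aeval ![w (some j), algebraMap K W t * w (some j) + w none] (MvPolynomial.pderiv 0 f) +
      algebraMap K W t * MvPolynomial.aeval ![w (some j), algebraMap K W t * w (some j) + w none] (MvPolynomial.pderiv 1 f) ≠ 0 := by
    intro j hj
    have h1 : f ∣ MvPolynomial.pderiv 0 f + MvPolynomial.C t * MvPolynomial.pderiv 1 f := by
      refine GP hirr (hz j) ?_ _ (by simpa using hj)
      intro hal
      apply hbW
      have a0 : IsAlgebraic K (w (some j)) := hal 0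
      have a1 : IsAlgebraic K (algebraMap K W t * w (some j) + w none) := hal 1
      have := a1.sub ((isAlgebraic_algebraMap (A := W) t).mul a0)
      simpa using this
    obtain ⟨g, hg⟩ := h1
    apply not_dvd_der (P := gp f (algebraMap K W t) (w none)) (d := d) (gp_deg h.deg.le _ _)
      (by rw [gp_coeff h.deg.le, lcp_aeval]; exact h0W)
      (by have := (algebraMap K W).injective.ne hd; simpa using this)
    rw [gp_der]
    refine ⟨gp g (algebraMap K W t) (w none), ?_⟩
    have := congrArg (MvPolynomial.aeval ![X, C (algebraMap K W t) * X + C (w none)]) hg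
    rw [map_mul, map_add, map_mul, MvPolynomial.aeval_C] at this
    exact this
  have hDf : ∀ j, 0 = MvPolynomial.aeval ![w (some j), algebraMap K W t * w (some j) + w none] (MvPolynomial.pderiv 0 f) * D (w (some j)) +
      MvPolynomial.aeval ![w (some j), algebraMap K W t * w (some j) + w none] (MvPolynomial.pderiv 1 f) * D (algebraMap K W t * w (some j) + w none) := by
    intro j
    rw [← chain2, hz, map_zero]
  have hDb : D (w none) ≠ 0 := by
    intro hb0
    rcases i with _ | j
    · exact hi hb0
    · have := hDf j
      rw [hDy, hb0] at this
      apply mul_ne_zero (hsep j) hi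
      linear_combination -this
  -- main computation
  have hR : ∀ τ : K, Polynomial.aeval (w none) (rr F (pol F τ) d (d - 1) t (X : K[X]) 1) =
      algebraMap K W ((MvPolynomial.aeval ![1, t, 0] F) ^ (d - 1)) *
       ∏ j, MvPolynomial.aeval ![w (some j), algebraMap K W t * w (some j) + w none, 1] (pol F τ) := by
    intro τ
    rw [rr_eval, rr_prod (pol_homog hF τ) t (w none) 1 _ h0W _ hgW, lc_map, map_pow]
  have hprod := prodD D Finset.univ
    (fun j => MvPolynomial.aeval ![w (some j), algebraMap K W t * w (some j) + w none, 1] (pol F τ))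
    (fun j => MvPolynomial.aeval ![w (some j), algebraMap K W t * w (some j) + w none, 1] (pol F σ)) (by
      intro j _
      have hg := grad_var D h _ _ (hz j) (by rw [hq, map_mul, hz j, zero_mul])
      rw [pol_aff h.deg.le _ _ _ (hz j), pol_aff h.deg.le _ _ _ (hz j)]
      have := wr (l1 := algebraMap K W τ) (l2 := algebraMap K W (τ ^ 2)) (m1 := algebraMap K W σ) (m2 := algebraMap K W (σ ^ 2))
        (x := w (some j)) (y := algebraMap K W t * w (some j) + w none) hg (hDf j)
      simp only [map_add, map_sub, D.leibniz, hDc, smul_eq_mul, mul_zero, add_zero, map_neg, neg_mul] at this ⊢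
      convert this using 2 <;> ring)
  have hW : D (Polynomial.aeval (w none) R1) * Polynomial.aeval (w none) R2 =
      Polynomial.aeval (w none) R1 * D (Polynomial.aeval (w none) R2) := by
    rw [hR1, hR2, hR, hR, D.leibniz, D.leibniz, hDc]
    simp only [smul_eq_mul, mul_zero, add_zero]
    rw [mul_mul_mul_comm, hprod, mul_mul_mul_comm]
  rw [D.map_aeval, D.map_aeval, smul_eq_mul, smul_eq_mul] at hW
  have hpoly : derivative R1 * R2 = R1 * derivative R2 := by
    apply transcendental_iff_injective.mp hbW
    rw [map_mul, map_mul]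
    apply mul_right_cancel₀ hDb
    linear_combination hW
  have hdvd : R1 ∣ derivative R1 := hcop.dvd_of_dvd_mul_right ⟨_, hpoly⟩
  have hR10 : R1 ≠ 0 := by
    intro h; rw [h, natDegree_zero] at hdeg; exact Nat.mul_ne_zero hd0 hd10 hdeg.symm
  refine not_dvd_der (d := d * (d - 1)) hdeg.le ?_ ?_ hdvd
  · rw [← hdeg]; simpa using hR10
  · rw [Nat.cast_mul]; exact mul_ne_zero hd hd1
end
end BW

namespace BW

lemma mem_of_eq {α σ : Type*} [SetLike σ α] {S : σ} {x y : α} (e : x = y) (h : y ∈ S) : x ∈ S := by rw [e]; exact h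

lemma ext_alg {R : Type*} [CommRing R] [IsDomain R] {S T : Type*} [Field S] [Field T] [IsAlgClosed T]
    (φ : R →+* S) (ψ : R →+* T) (hφ : Function.Injective φ) (hψ : Function.Injective ψ)
    (halg : ∀ s : S, ∃ p : R[X], p ≠ 0 ∧ p.eval₂ φ s = 0) : ∃ γ : S →+* T, ∀ r, γ (φ r) = ψ r := by
  letI := φ.toAlgebra
  letI := ψ.toAlgebra
  haveI : Algebra.IsAlgebraic R S := ⟨fun s => halg s⟩
  haveI : FaithfulSMul R S := (faithfulSMul_iff_algebraMap_injective R S).mpr hφ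
  haveI : FaithfulSMul R T := (faithfulSMul_iff_algebraMap_injective R T).mpr hψ
  let γ : S →ₐ[R] T := IsAlgClosed.lift
  exact ⟨γ, fun r => γ.commutes r⟩

section
variable {K : Type*} [Field K] {Ω : Type*} [Field Ω] [IsAlgClosed Ω] [Algebra K Ω]

lemma EXT (M : IntermediateField K Ω) {f : MvPolynomial (Fin 2) K} (hf : Irreducible (MvPolynomial.map (algebraMap K M) f))
    (P P' : Fin 2 → Ω) (h0 : MvPolynomial.aeval P f = 0) (h0' : MvPolynomial.aeval P' f = 0)
    (hP : ¬ ∀ i, IsAlgebraic M (P i)) (hP' : ¬ ∀ i, IsAlgebraic M (P' i))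
    (hal : ∀ z : Ω, IsAlgebraic (IntermediateField.adjoin M (Set.range P)) z) :
    ∃ γ : Ω →+* Ω, (∀ m ∈ M, γ m = m) ∧ ∀ i, γ (P i) = P' i := by
  have e0 : MvPolynomial.aeval P (MvPolynomial.map (algebraMap K M) f) = 0 := by
    rw [MvPolynomial.aeval_map_algebraMap, h0]
  have e0' : MvPolynomial.aeval P' (MvPolynomial.map (algebraMap K M) f) = 0 := by
    rw [MvPolynomial.aeval_map_algebraMap, h0']
  have hker : ∀ g : MvPolynomial (Fin 2) M, MvPolynomial.aeval P g = 0 ↔ MvPolynomial.aeval P' g = 0 := by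
    intro g
    constructor
    · intro hg
      obtain ⟨q, rfl⟩ := GP hf e0 hP g hg
      rw [map_mul, e0', zero_mul]
    · intro hg
      obtain ⟨q, rfl⟩ := GP hf e0' hP' g hg
      rw [map_mul, e0, zero_mul]
  let φ := MvPolynomial.aeval (R := M) P
  let ψ : φ.range →ₐ[M] Ω := AlgHom.liftOfSurjective φ.rangeRestrict φ.rangeRestrict_surjective
    (MvPolynomial.aeval (R := M) P') (by
      intro g hg
      have : φ.rangeRestrict g = 0 := hg
      have h1 : φ g = 0 := congrArg Subtype.val this
      exact (hker g).mp h1)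
  have hψ : ∀ g, ψ (φ.rangeRestrict g) = MvPolynomial.aeval P' g := fun g =>
    AlgHom.liftOfSurjective_apply _ _ _ _ _
  obtain ⟨γ, hγ⟩ := ext_alg (algebraMap φ.range Ω) (ψ : φ.range →+* Ω) Subtype.val_injective (by
    rw [injective_iff_map_eq_zero]
    intro z hz
    obtain ⟨g, rfl⟩ := φ.rangeRestrict_surjective z
    have h1 : MvPolynomial.aeval P' g = 0 := by rw [← hψ]; exact hz
    exact Subtype.ext ((hker g).mpr h1)) (by
    intro z
    have := hal z
    rw [IntermediateField.isAlgebraic_adjoin_iff, Algebra.adjoin_range_eq_range_aeval] at this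
    exact this)
  have hγ' : ∀ g : MvPolynomial (Fin 2) M, γ (MvPolynomial.aeval P g) = MvPolynomial.aeval P' g := fun g =>
    (hγ (φ.rangeRestrict g)).trans (hψ g)
  refine ⟨γ, fun m hm => ?_, fun i => ?_⟩
  · have := hγ' (MvPolynomial.C ⟨m, hm⟩)
    simpa using this
  · have := hγ' (MvPolynomial.X i)
    simpa using this

/-- `y = aT + b` is a generic line, and `Ω` is algebraic over the field generated by `a, b`. -/
structure GenL (K : Type*) [Field K] {Ω : Type*} [Field Ω] [Algebra K Ω] (a b : Ω) : Prop where
  ind : AlgebraicIndependent K ![a, b]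
  alg : ∀ z : Ω, IsAlgebraic (IntermediateField.adjoin K {a, b}) z

variable {a b : Ω}

lemma GenL.alg' (h : GenL K a b) (M : IntermediateField K Ω) (S : Set Ω) (ha : a ∈ IntermediateField.adjoin M S)
    (hb : b ∈ IntermediateField.adjoin M S) (z : Ω) : IsAlgebraic (IntermediateField.adjoin M S) z := by
  have h1 : IntermediateField.adjoin K {a, b} ≤ (IntermediateField.adjoin M S).restrictScalars K := by
    rw [IntermediateField.adjoin_le_iff]
    rintro w (rfl | rfl)
    · exact ha
    · exact hb
  exact alg_mono h1 (h.alg z)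

lemma pt_ne (h : GenL K a b) (r : Ω) : ¬ ∀ i, IsAlgebraic (IntermediateField.adjoin K {a}) (![r, a * r + b] i) := by
  intro hal
  have h0 : IsAlgebraic (IntermediateField.adjoin K {a}) r := hal 0
  have h1 : IsAlgebraic (IntermediateField.adjoin K {a}) (a * r + b) := hal 1
  have ha : IsAlgebraic (IntermediateField.adjoin K {a}) a :=
    isAlgebraic_algebraMap (⟨a, IntermediateField.mem_adjoin_simple_self K a⟩ : IntermediateField.adjoin K {a})
  have := h1.sub (ha.mul h0)
  rw [add_sub_cancel_left] at this
  exact (ind2.mp h.ind).2 this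

lemma pt_ne' (h : GenL K a b) (r : Ω) : ¬ ∀ i, IsAlgebraic K (![r, a * r + b] i) := by
  intro hal
  exact pt_ne h r fun i => (hal i).tower_top _

/-- a point of a curve other than the first point of the generic line is not algebraic over the first one. -/
lemma pt2_ne (h : GenL K a b) {f : MvPolynomial (Fin 2) K} (hf : f ≠ 0) {r r' : Ω}
    (h0 : MvPolynomial.aeval ![r, a * r + b] f = 0) (hr : r ≠ r') :
    ¬ ∀ i, IsAlgebraic (IntermediateField.adjoin K {r, a * r + b}) (![r', a * r' + b] i) := by
  intro hal
  obtain ⟨u, hu1, hu2⟩ := NN_curve hf h0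
  have hM : IntermediateField.adjoin K {r, a * r + b} ≤ NN K u := by
    rw [IntermediateField.adjoin_le_iff]
    rintro w (rfl | rfl)
    · exact hu1
    · exact hu2
  have h1 : r' ∈ NN K u := NN_closed hM (hal 0)
  have h2 : a * r' + b ∈ NN K u := NN_closed hM (hal 1)
  have hne : r - r' ≠ 0 := sub_ne_zero.mpr hr
  have ha : a ∈ NN K u := by
    have : a = ((a * r + b) - (a * r' + b)) / (r - r') := by field_simp; ring
    exact mem_of_eq this (div_mem (sub_mem hu2 h2) (sub_mem hu1 h1))
  have hb : b ∈ NN K u := by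
    have : b = (a * r + b) - a * r := by ring
    exact mem_of_eq this (sub_mem hu2 (mul_mem ha hu1))
  exact NN_not h.ind ha hb

lemma gp_sep (h : GenL K a b) {f : MvPolynomial (Fin 2) K} {d : ℕ} (hs : Sm f d) (hd : d ≠ 0) {r : Ω}
    (h0 : (gp f a b).eval r = 0) : (derivative (gp f a b)).eval r ≠ 0 := by
  intro h1
  rw [gp_eval] at h0
  rw [gp_der, eval_add, eval_mul, eval_C, gp_eval, gp_eval] at h1
  have hB : MvPolynomial.aeval ![r, a * r + b] (MvPolynomial.pderiv 1 f) ≠ 0 := by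
    intro hB
    rw [hB, mul_zero, add_zero] at h1
    exact hs.aff h0 h1 hB
  obtain ⟨u, hu1, hu2⟩ := NN_curve (hs.irr hd).ne_zero h0
  have hmem : ∀ g : MvPolynomial (Fin 2) K, MvPolynomial.aeval ![r, a * r + b] g ∈ NN K u := by
    intro g
    have := av2 (NN K u).val ⟨r, hu1⟩ ⟨a * r + b, hu2⟩ g
    change _ = MvPolynomial.aeval ![r, a * r + b] g at this
    rw [← this]
    exact Subtype.property _
  have ha : a ∈ NN K u := by
    have : a = - MvPolynomial.aeval ![r, a * r + b] (MvPolynomial.pderiv 0 f) / MvPolynomial.aeval ![r, a * r + b] (MvPolynomial.pderiv 1 f) := by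
      rw [eq_div_iff hB]; linear_combination h1
    exact mem_of_eq this (div_mem (neg_mem (hmem _)) (hmem _))
  have hb : b ∈ NN K u := by
    have : b = (a * r + b) - a * r := by ring
    exact mem_of_eq this (sub_mem hu2 (mul_mem ha hu1))
  exact NN_not h.ind ha hb

/-- the automorphisms we use -/
def Fix (K : Type*) [Field K] {Ω : Type*} [Field Ω] [Algebra K Ω] (a b : Ω) (γ : Ω →+* Ω) : Prop :=
  (∀ k : K, γ (algebraMap K Ω k) = algebraMap K Ω k) ∧ γ a = a ∧ γ b = b

lemma trans1 (h : GenL K a b) {f : MvPolynomial (Fin 2) K} {d : ℕ} (hs : Sm f d) (hd : d ≠ 0) {r r' : Ω}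
    (h0 : (gp f a b).eval r = 0) (h0' : (gp f a b).eval r' = 0) : ∃ γ : Ω →+* Ω, Fix K a b γ ∧ γ r = r' := by
  rw [gp_eval] at h0 h0'
  have mem : ∀ i, ![r, a * r + b] i ∈ IntermediateField.adjoin (IntermediateField.adjoin K {a}) (Set.range ![r, a * r + b]) :=
    fun i => IntermediateField.subset_adjoin _ _ ⟨i, rfl⟩
  have ha : a ∈ IntermediateField.adjoin (IntermediateField.adjoin K {a}) (Set.range ![r, a * r + b]) :=
    IntermediateField.algebraMap_mem _ (⟨a, IntermediateField.mem_adjoin_simple_self K a⟩ : IntermediateField.adjoin K {a})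
  have hb : b ∈ IntermediateField.adjoin (IntermediateField.adjoin K {a}) (Set.range ![r, a * r + b]) := by
    have : b = ![r, a * r + b] 1 - a * ![r, a * r + b] 0 := by simp
    exact mem_of_eq this (sub_mem (mem 1) (mul_mem ha (mem 0)))
  obtain ⟨γ, h1, h2⟩ := EXT (IntermediateField.adjoin K {a}) ((hs.map (algebraMap K _)).irr hd) ![r, a * r + b] ![r', a * r' + b] h0 h0'
    (pt_ne h r) (pt_ne h r') (h.alg' _ _ ha hb)
  have e0 : γ r = r' := h2 0
  have e1 : γ (a * r + b) = a * r' + b := h2 1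
  have ea : γ a = a := h1 a (IntermediateField.mem_adjoin_simple_self K a)
  refine ⟨γ, ⟨fun k => h1 _ (IntermediateField.algebraMap_mem _ k), ea, ?_⟩, e0⟩
  rw [map_add, map_mul, e0, ea] at e1
  exact add_left_cancel e1

lemma trans2 (h : GenL K a b) {f : MvPolynomial (Fin 2) K} {d : ℕ} (hs : Sm f d) (hd : d ≠ 0) {s r r' : Ω}
    (hs0 : (gp f a b).eval s = 0)
    (h0 : (gp f a b).eval r = 0) (h0' : (gp f a b).eval r' = 0) (hr : s ≠ r) (hr' : s ≠ r') :
    ∃ γ : Ω →+* Ω, Fix K a b γ ∧ γ s = s ∧ γ r = r' := by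
  rw [gp_eval] at h0 h0' hs0
  set M := IntermediateField.adjoin K {s, a * s + b} with hM
  have ms : s ∈ M := IntermediateField.subset_adjoin _ _ (by simp)
  have mt : a * s + b ∈ M := IntermediateField.subset_adjoin _ _ (by simp)
  have mem : ∀ i, ![r, a * r + b] i ∈ IntermediateField.adjoin M (Set.range ![r, a * r + b]) :=
    fun i => IntermediateField.subset_adjoin _ _ ⟨i, rfl⟩
  have ms' : s ∈ IntermediateField.adjoin M (Set.range ![r, a * r + b]) :=
    IntermediateField.algebraMap_mem _ (⟨s, ms⟩ : M)
  have mt' : a * s + b ∈ IntermediateField.adjoin M (Set.range ![r, a * r + b]) :=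
    IntermediateField.algebraMap_mem _ (⟨_, mt⟩ : M)
  have hne : s - r ≠ 0 := sub_ne_zero.mpr hr
  have hne' : s - r' ≠ 0 := sub_ne_zero.mpr hr'
  have ha : a ∈ IntermediateField.adjoin M (Set.range ![r, a * r + b]) := by
    have : a = ((a * s + b) - ![r, a * r + b] 1) / (s - ![r, a * r + b] 0) := by
      simp only [Matrix.cons_val_zero, Matrix.cons_val_one]
      field_simp; ring
    exact mem_of_eq this (div_mem (sub_mem mt' (mem 1)) (sub_mem ms' (mem 0)))
  have hb : b ∈ IntermediateField.adjoin M (Set.range ![r, a * r + b]) := by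
    have : b = (a * s + b) - a * s := by ring
    exact mem_of_eq this (sub_mem mt' (mul_mem ha ms'))
  obtain ⟨γ, h1, h2⟩ := EXT M ((hs.map (algebraMap K _)).irr hd) ![r, a * r + b] ![r', a * r' + b] h0 h0'
    (pt2_ne h (hs.irr hd).ne_zero hs0 hr) (pt2_ne h (hs.irr hd).ne_zero hs0 hr') (h.alg' _ _ ha hb)
  have e0 : γ r = r' := h2 0
  have e1 : γ (a * r + b) = a * r' + b := h2 1
  have es : γ s = s := h1 s ms
  have et : γ (a * s + b) = a * s + b := h1 _ mt
  have ea : γ a = a := by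
    rw [map_add, map_mul, e0] at e1
    rw [map_add, map_mul, es] at et
    apply mul_right_cancel₀ hne'
    linear_combination et - e1
  refine ⟨γ, ⟨fun k => h1 _ (IntermediateField.algebraMap_mem _ k), ea, ?_⟩, es, e0⟩
  rw [map_add, map_mul, es, ea] at et
  exact add_left_cancel et
end
end BW

namespace BW
section
variable {K : Type*} [Field K]

lemma tang {W : Type*} [Field W] [Algebra K W] (D : Derivation K W W) {f : MvPolynomial (Fin 2) K} {x y m : W}
    (h0 : MvPolynomial.aeval ![x, y] f = 0)
    (hm : MvPolynomial.aeval ![x, y] (MvPolynomial.pderiv 0 f) + m * MvPolynomial.aeval ![x, y] (MvPolynomial.pderiv 1 f) = 0)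
    (hB : MvPolynomial.aeval ![x, y] (MvPolynomial.pderiv 1 f) ≠ 0) :
    D m * MvPolynomial.aeval ![x, y] (MvPolynomial.pderiv 1 f) ^ 3 = - (D x * MvPolynomial.aeval ![x, y] (Hess f)) ∧
    D y = m * D x := by
  have e1 := chain2 D x y f
  rw [h0, map_zero] at e1
  have e2 := chain2 D x y (MvPolynomial.pderiv 0 f)
  have e3 := chain2 D x y (MvPolynomial.pderiv 1 f)
  have e4 := congrArg D hm
  rw [map_add, D.leibniz, map_zero, smul_eq_mul, smul_eq_mul, e2, e3, pd_comm] at e4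
  simp only [Hess, map_add, map_sub, map_mul, map_pow, map_ofNat]
  generalize MvPolynomial.aeval ![x, y] (MvPolynomial.pderiv 0 f) = A at *
  generalize MvPolynomial.aeval ![x, y] (MvPolynomial.pderiv 1 f) = B at *
  generalize MvPolynomial.aeval ![x, y] (MvPolynomial.pderiv 0 (MvPolynomial.pderiv 0 f)) = fxx at *
  generalize MvPolynomial.aeval ![x, y] (MvPolynomial.pderiv 0 (MvPolynomial.pderiv 1 f)) = fxy at *
  generalize MvPolynomial.aeval ![x, y] (MvPolynomial.pderiv 1 (MvPolynomial.pderiv 1 f)) = fyy at *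
  obtain rfl : A = - (m * B) := by linear_combination hm
  have hy : D y = m * D x := by
    apply mul_left_cancel₀ hB
    linear_combination -e1
  refine ⟨?_, hy⟩
  rw [hy] at e4
  linear_combination B ^ 2 * e4

variable {L : Type*} [Field L] [Algebra K L]

lemma Hess_ne [IsAlgClosed K] {f : MvPolynomial (Fin 2) K} {d : ℕ} (h : Sm f d) (hd : (d : K) ≠ 0) (hd1 : ((d - 1 : ℕ) : K) ≠ 0)
    {P : Fin 2 → L} (h0 : MvPolynomial.aeval P f = 0) (hP : ¬ ∀ i, IsAlgebraic K (P i)) :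
    MvPolynomial.aeval P (Hess f) ≠ 0 := fun h' =>
  F0 h hd hd1 (GP (h.irr (by rintro rfl; simp at hd)) h0 hP _ h')

lemma fy_ne [IsAlgClosed K] {f : MvPolynomial (Fin 2) K} {d : ℕ} (h : Sm f d) (hd : (d : K) ≠ 0) (hd1 : ((d - 1 : ℕ) : K) ≠ 0)
    {P : Fin 2 → L} (h0 : MvPolynomial.aeval P f = 0) (hP : ¬ ∀ i, IsAlgebraic K (P i)) :
    MvPolynomial.aeval P (MvPolynomial.pderiv 1 f) ≠ 0 := by
  intro h'
  obtain ⟨q, hq⟩ := GP (h.irr (by rintro rfl; simp at hd)) h0 hP _ h'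
  refine F0 h hd hd1 ?_
  have h2 : f ∣ MvPolynomial.pderiv 1 (MvPolynomial.pderiv 1 f) := by
    rw [hq, Derivation.leibniz, hq]
    exact ⟨MvPolynomial.pderiv 1 q + q * q, by simp only [smul_eq_mul]; ring⟩
  have h1 : f ∣ MvPolynomial.pderiv 1 f := ⟨q, hq⟩
  unfold Hess
  refine dvd_add (dvd_sub ?_ ?_) ?_
  · exact (h1.trans (dvd_pow_self _ two_ne_zero)).mul_left _
  · exact h1.mul_left _
  · exact h2.mul_right _

lemma alg_mem_base [IsAlgClosed K] {z : L} (hz : IsAlgebraic K z) : ∃ c : K, algebraMap K L c = z := by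
  have h1 := minpoly.irreducible hz.isIntegral
  have h2 := IsAlgClosed.degree_eq_one_of_irreducible K h1
  exact minpoly.mem_range_of_degree_eq_one K z h2

lemma alg_aeval {P : Fin 2 → L} (hP : ∀ i, IsAlgebraic K (P i)) (g : MvPolynomial (Fin 2) K) :
    IsAlgebraic K (MvPolynomial.aeval P g) := by
  have : ∀ g : MvPolynomial (Fin 2) K, MvPolynomial.aeval P g ∈ algebraicClosure K L := by
    intro g
    induction g using MvPolynomial.induction_on with
    | C a => rw [MvPolynomial.aeval_C]; exact IntermediateField.algebraMap_mem _ _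
    | add p q hp hq => rw [map_add]; exact add_mem hp hq
    | mul_X p i hp => rw [map_mul, MvPolynomial.aeval_X]; exact mul_mem hp (mem_algebraicClosure_iff.mpr (hP i))
  exact mem_algebraicClosure_iff.mp (this g)

lemma aeW (W : IntermediateField K L) (p q : W) (g : MvPolynomial (Fin 2) K) :
    ((MvPolynomial.aeval ![p, q] g : W) : L) = MvPolynomial.aeval ![(p : L), (q : L)] g := av2 W.val p q g

lemma m_trans [IsAlgClosed K] {f : MvPolynomial (Fin 2) K} {d : ℕ} (h : Sm f d) (hd : (d : K) ≠ 0) (hd1 : ((d - 1 : ℕ) : K) ≠ 0)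
    {x y m : L} (h0 : MvPolynomial.aeval ![x, y] f = 0) (hP : ¬ ∀ i, IsAlgebraic K (![x, y] i))
    (hm : MvPolynomial.aeval ![x, y] (MvPolynomial.pderiv 0 f) + m * MvPolynomial.aeval ![x, y] (MvPolynomial.pderiv 1 f) = 0) :
    Transcendental K m := by
  intro hal
  obtain ⟨c, rfl⟩ := alg_mem_base hal
  have hB := fy_ne h hd hd1 h0 hP
  have hH := Hess_ne h hd hd1 h0 hP
  push Not at hP
  obtain ⟨W, w, D, hw, i, hi⟩ := der_exists (K := K) ![x, y] hP
  have ex : (w 0 : L) = x := hw 0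
  have ey : (w 1 : L) = y := hw 1
  have h0' : MvPolynomial.aeval ![w 0, w 1] f = 0 := by
    apply Subtype.ext; rw [aeW, ex, ey, h0]; rfl
  obtain ⟨t1, t2⟩ := tang D (m := algebraMap K W c) h0' (by
    apply Subtype.ext
    change ((MvPolynomial.aeval ![w 0, w 1] (MvPolynomial.pderiv 0 f) : W) : L) + algebraMap K L c * ((MvPolynomial.aeval ![w 0, w 1] (MvPolynomial.pderiv 1 f) : W) : L) = 0
    rw [aeW, aeW, ex, ey, hm]) (by
    intro h'
    have := congrArg (Subtype.val) h'
    rw [aeW, ex, ey] at this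
    exact hB this)
  rw [D.map_algebraMap, zero_mul, zero_eq_neg, mul_eq_zero] at t1
  have hx : D (w 0) = 0 := by
    refine t1.resolve_right fun h' => ?_
    have := congrArg (Subtype.val) h'
    rw [aeW, ex, ey] at this
    exact hH this
  rw [hx, mul_zero] at t2
  fin_cases i
  · exact hi hx
  · exact hi t2

lemma no_tang [IsAlgClosed K] {f f' : MvPolynomial (Fin 2) K} {d d' : ℕ} (h : Sm f d) (hd : (d : K) ≠ 0) (hd1 : ((d - 1 : ℕ) : K) ≠ 0)
    (h' : Sm f' d') (hd' : (d' : K) ≠ 0) (hd1' : ((d' - 1 : ℕ) : K) ≠ 0)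
    {x y m x' y' : L} (h0 : MvPolynomial.aeval ![x, y] f = 0) (hP : ¬ ∀ i, IsAlgebraic K (![x, y] i))
    (hm : MvPolynomial.aeval ![x, y] (MvPolynomial.pderiv 0 f) + m * MvPolynomial.aeval ![x, y] (MvPolynomial.pderiv 1 f) = 0)
    (h0' : MvPolynomial.aeval ![x', y'] f' = 0)
    (hm' : MvPolynomial.aeval ![x', y'] (MvPolynomial.pderiv 0 f') + m * MvPolynomial.aeval ![x', y'] (MvPolynomial.pderiv 1 f') = 0)
    (hl : y' = y + m * (x' - x)) : x' = x := by
  by_contra hne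
  have hmt := m_trans h hd hd1 h0 hP hm
  have hB' : MvPolynomial.aeval ![x', y'] (MvPolynomial.pderiv 1 f') ≠ 0 := by
    intro hB
    rw [hB, mul_zero, add_zero] at hm'
    exact h'.aff h0' hm' hB
  have hP' : ¬ ∀ i, IsAlgebraic K (![x', y'] i) := by
    intro hal
    apply hmt
    have e : m = - MvPolynomial.aeval ![x', y'] (MvPolynomial.pderiv 0 f') * (MvPolynomial.aeval ![x', y'] (MvPolynomial.pderiv 1 f'))⁻¹ := by
      rw [← div_eq_mul_inv, eq_div_iff hB']; linear_combination hm'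
    rw [e]
    exact (alg_aeval hal _).neg.mul (alg_aeval hal _).inv
  have hB := fy_ne h hd hd1 h0 hP
  have hH := Hess_ne h hd hd1 h0 hP
  have hH' := Hess_ne h' hd' hd1' h0' hP'
  obtain ⟨W, w, D, hw, i, hi⟩ := der_exists (K := K) ![x, y, x', y', m] ⟨4, hmt⟩
  have ex : (w 0 : L) = x := hw 0
  have ey : (w 1 : L) = y := hw 1
  have ex' : (w 2 : L) = x' := hw 2
  have ey' : (w 3 : L) = y' := hw 3
  have em : (w 4 : L) = m := hw 4
  obtain ⟨t1, t2⟩ := tang D (f := f) (x := w 0) (y := w 1) (m := w 4) (by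
    apply Subtype.ext; rw [aeW, ex, ey, h0]; rfl) (by
    apply Subtype.ext
    change ((MvPolynomial.aeval ![w 0, w 1] (MvPolynomial.pderiv 0 f) : W) : L) + (w 4 : L) * ((MvPolynomial.aeval ![w 0, w 1] (MvPolynomial.pderiv 1 f) : W) : L) = 0
    rw [aeW, aeW, ex, ey, em, hm]) (by
    intro h'
    have := congrArg (Subtype.val) h'
    rw [aeW, ex, ey] at this
    exact hB this)
  obtain ⟨s1, s2⟩ := tang D (f := f') (x := w 2) (y := w 3) (m := w 4) (by
    apply Subtype.ext; rw [aeW, ex', ey', h0']; rfl) (by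
    apply Subtype.ext
    change ((MvPolynomial.aeval ![w 2, w 3] (MvPolynomial.pderiv 0 f') : W) : L) + (w 4 : L) * ((MvPolynomial.aeval ![w 2, w 3] (MvPolynomial.pderiv 1 f') : W) : L) = 0
    rw [aeW, aeW, ex', ey', em, hm']) (by
    intro h'
    have := congrArg (Subtype.val) h'
    rw [aeW, ex', ey'] at this
    exact hB' this)
  have hH2 : MvPolynomial.aeval ![w 0, w 1] (Hess f) ≠ 0 := by
    intro h'
    have := congrArg (Subtype.val) h'
    rw [aeW, ex, ey] at this
    exact hH this
  have hH2' : MvPolynomial.aeval ![w 2, w 3] (Hess f') ≠ 0 := by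
    intro h'
    have := congrArg (Subtype.val) h'
    rw [aeW, ex', ey'] at this
    exact hH' this
  have hl2 : w 3 = w 1 + w 4 * (w 2 - w 0) := by
    apply Subtype.ext
    change (w 3 : L) = (w 1 : L) + (w 4 : L) * ((w 2 : L) - (w 0 : L))
    rw [ex, ey, ex', ey', em, hl]
  have hne2 : w 2 - w 0 ≠ 0 := by
    intro hc
    have := congrArg Subtype.val (sub_eq_zero.mp hc)
    rw [ex, ex'] at this
    exact hne this
  have e5 := congrArg D hl2
  rw [map_add, D.leibniz, map_sub, smul_eq_mul, smul_eq_mul, s2, t2] at e5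
  have hDm : D (w 4) = 0 := by
    have : (w 2 - w 0) * D (w 4) = 0 := by linear_combination -e5
    exact (mul_eq_zero.mp this).resolve_left hne2
  rw [hDm, zero_mul, zero_eq_neg, mul_eq_zero] at t1 s1
  have hx := t1.resolve_right hH2
  have hx' := s1.resolve_right hH2'
  rw [hx, mul_zero] at t2
  rw [hx', mul_zero] at s2
  fin_cases i
  · exact hi hx
  · exact hi t2
  · exact hi hx'
  · exact hi s2
  · exact hi hDm
end
end BW

namespace BW
section
variable {Ω : Type*} [Field Ω]

/-- the field of Puiseux-like series -/
abbrev Lam (Ω : Type*) [Field Ω] := AlgebraicClosure (FractionRing (PowerSeries Ω))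

noncomputable def jj (Ω : Type*) [Field Ω] : PowerSeries Ω →+* Lam Ω :=
  (algebraMap (FractionRing (PowerSeries Ω)) (Lam Ω)).comp (algebraMap (PowerSeries Ω) (FractionRing (PowerSeries Ω)))

lemma jj_inj : Function.Injective (jj Ω) :=
  (algebraMap (FractionRing (PowerSeries Ω)) (Lam Ω)).injective.comp (IsFractionRing.injective _ _)

lemma cc_eval (G : (PowerSeries Ω)[X]) (ω : PowerSeries Ω) :
    (G.map PowerSeries.constantCoeff).eval (PowerSeries.constantCoeff ω) = PowerSeries.constantCoeff (G.eval ω) :=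
  evm _ _ _

lemma lift_unique {G : (PowerSeries Ω)[X]} {ω ω' : PowerSeries Ω} (h : G.eval ω = 0) (h' : G.eval ω' = 0)
    (hc : PowerSeries.constantCoeff ω = PowerSeries.constantCoeff ω')
    (hs : (derivative (G.map PowerSeries.constantCoeff)).eval (PowerSeries.constantCoeff ω) ≠ 0) : ω' = ω := by
  by_contra hne
  obtain ⟨k, hk⟩ := Polynomial.binomExpansion G ω (ω' - ω)
  rw [add_sub_cancel, h', h, zero_add] at hk
  have hne' : ω' - ω ≠ 0 := sub_ne_zero.mpr hne
  have h1 : (derivative G).eval ω + k * (ω' - ω) = 0 := by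
    apply mul_right_cancel₀ hne'
    linear_combination -hk
  apply hs
  rw [derivative_map, cc_eval]
  have := congrArg PowerSeries.constantCoeff h1
  rw [map_add, map_mul, map_sub, hc, sub_self, mul_zero, add_zero, map_zero] at this
  exact this

lemma lifts (G : (PowerSeries Ω)[X]) (hG : G.Monic) (S : Finset Ω)
    (h : ∀ s ∈ S, (G.map PowerSeries.constantCoeff).eval s = 0 ∧ (derivative (G.map PowerSeries.constantCoeff)).eval s ≠ 0) :
    ∃ ω : Ω → PowerSeries Ω, (∀ s ∈ S, G.eval (ω s) = 0 ∧ PowerSeries.constantCoeff (ω s) = s) ∧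
      ∃ T : Finset (Lam Ω), T.card = S.card ∧ (∀ z ∈ T, (G.map (jj Ω)).eval z = 0) ∧ ∀ z, z ∈ T ↔ ∃ s ∈ S, jj Ω (ω s) = z := by
  classical
  have h1 : ∀ s : Ω, ∃ ω : PowerSeries Ω, s ∈ S → G.eval ω = 0 ∧ PowerSeries.constantCoeff ω = s := by
    intro s
    by_cases hs : s ∈ S
    · obtain ⟨ω, hω⟩ := hensel_ps G hG s (h s hs).1 (h s hs).2
      exact ⟨ω, fun _ => hω⟩
    · exact ⟨0, fun h => absurd h hs⟩
  choose ω hω using h1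
  refine ⟨ω, hω, S.image (fun s => jj Ω (ω s)), ?_, ?_, ?_⟩
  · apply Finset.card_image_of_injOn
    intro s hs t ht hst
    have := jj_inj hst
    rw [← (hω s hs).2, ← (hω t ht).2, this]
  · intro z hz
    obtain ⟨s, hs, rfl⟩ := Finset.mem_image.mp hz
    rw [evm, (hω s hs).1, map_zero]
  · intro z
    rw [Finset.mem_image]

lemma simple_mult {S : Type*} [Field S] {P : S[X]} (hP : P ≠ 0) {s : S} (h0 : P.eval s = 0) (h1 : (derivative P).eval s ≠ 0) :
    P.rootMultiplicity s = 1 := by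
  have h2 : 0 < P.rootMultiplicity s := (rootMultiplicity_pos hP).mpr h0
  by_contra h3
  have h4 : 1 < P.rootMultiplicity s := by omega
  rw [one_lt_rootMultiplicity_iff_isRoot hP] at h4
  exact h1 h4.2

variable [IsAlgClosed Ω]

lemma LS (G : (PowerSeries Ω)[X]) (hG : G.Monic)
    (hs : ∀ s, (G.map PowerSeries.constantCoeff).eval s = 0 → (derivative (G.map PowerSeries.constantCoeff)).eval s ≠ 0)
    (z : Lam Ω) (hz : (G.map (jj Ω)).eval z = 0) : ∃ o, jj Ω o = z := by
  classical
  set G0 := G.map PowerSeries.constantCoeff with hG0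
  have hG0m : G0.Monic := hG.map _
  have hd0 : G0.natDegree = G.natDegree := hG.natDegree_map _
  obtain ⟨ω, hω, T, hT, hT1, hT2⟩ := lifts G hG G0.roots.toFinset (by
    intro s hs'
    have : G0.eval s = 0 := (mem_roots hG0m.ne_zero).mp (Multiset.mem_toFinset.mp hs')
    exact ⟨this, hs s this⟩)
  have hcard : T.card = G.natDegree := by
    rw [hT, ← hd0, (IsAlgClosed.splits G0).natDegree_eq_card_roots, Multiset.toFinset_card_of_nodup]
    rw [Multiset.nodup_iff_count_le_one]
    intro s
    rw [count_roots]
    by_cases h : G0.eval s = 0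
    · exact (simple_mult hG0m.ne_zero h (hs s h)).le
    · rw [rootMultiplicity_eq_zero h]; exact Nat.zero_le _
  have hGL : (G.map (jj Ω)).Monic := hG.map _
  have hzT : z ∈ T := by
    by_contra hzT
    have h1 : insert z T ⊆ (G.map (jj Ω)).roots.toFinset := by
      intro w hw
      rw [Multiset.mem_toFinset, mem_roots hGL.ne_zero]
      rcases Finset.mem_insert.mp hw with rfl | hw
      · exact hz
      · exact hT1 w hw
    have h2 := Finset.card_le_card h1
    rw [Finset.card_insert_of_notMem hzT, hcard] at h2
    have h3 := (Multiset.toFinset_card_le (G.map (jj Ω)).roots).trans (card_roots' _)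
    rw [hG.natDegree_map] at h3
    omega
  obtain ⟨s, _, h⟩ := (hT2 z).mp hzT
  exact ⟨_, h⟩

set_option maxHeartbeats 1000000 in
lemma LD (G : (PowerSeries Ω)[X]) (hG : G.Monic) (x : Ω)
    (hx : (G.map PowerSeries.constantCoeff).rootMultiplicity x = 2)
    (hs : ∀ s, s ≠ x → (G.map PowerSeries.constantCoeff).eval s = 0 → (derivative (G.map PowerSeries.constantCoeff)).eval s ≠ 0)
    (hno : ∀ ω, G.eval ω = 0 → PowerSeries.constantCoeff ω ≠ x)
    (hsep : ∀ z : Lam Ω, (G.map (jj Ω)).eval z = 0 → (derivative (G.map (jj Ω))).eval z ≠ 0) :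
    ∃ δ : Lam Ω →+* Lam Ω, (∀ o, δ (jj Ω o) = jj Ω o) ∧ ∃ ρ₁ ρ₂ : Lam Ω, ρ₁ ≠ ρ₂ ∧
      (G.map (jj Ω)).eval ρ₁ = 0 ∧ (G.map (jj Ω)).eval ρ₂ = 0 ∧ δ ρ₁ = ρ₂ ∧ δ ρ₂ = ρ₁ ∧
      ∀ z, (G.map (jj Ω)).eval z = 0 → z ≠ ρ₁ → z ≠ ρ₂ → ∃ o, jj Ω o = z := by
  classical
  set G0 := G.map PowerSeries.constantCoeff with hG0
  have hG0m : G0.Monic := hG.map _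
  have hd0 : G0.natDegree = G.natDegree := hG.natDegree_map _
  have hxr : G0.eval x = 0 := (rootMultiplicity_pos hG0m.ne_zero).mp (by rw [hx]; norm_num)
  obtain ⟨ω, hω, T, hT, hT1, hT2⟩ := lifts G hG (G0.roots.toFinset.erase x) (by
    intro s hs'
    rw [Finset.mem_erase] at hs'
    have : G0.eval s = 0 := (mem_roots hG0m.ne_zero).mp (Multiset.mem_toFinset.mp hs'.2)
    exact ⟨this, hs s hs'.1 this⟩)
  have hxm : x ∈ G0.roots.toFinset := by
    rw [Multiset.mem_toFinset, mem_roots hG0m.ne_zero]; exact hxr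
  have hcard : T.card + 2 = G.natDegree := by
    rw [hT, ← hd0, (IsAlgClosed.splits G0).natDegree_eq_card_roots, ← Multiset.toFinset_sum_count_eq,
      ← Finset.sum_erase_add _ _ hxm, count_roots, hx, Finset.sum_congr rfl (g := fun _ => 1), Finset.sum_const, smul_eq_mul, mul_one]
    intro s hs'
    rw [Finset.mem_erase] at hs'
    have : G0.eval s = 0 := (mem_roots hG0m.ne_zero).mp (Multiset.mem_toFinset.mp hs'.2)
    rw [count_roots, simple_mult hG0m.ne_zero this (hs s hs'.1 this)]
  have hGL : (G.map (jj Ω)).Monic := hG.map _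
  set Z := (G.map (jj Ω)).roots.toFinset with hZ
  have hZm : ∀ z, z ∈ Z ↔ (G.map (jj Ω)).eval z = 0 := by
    intro z; rw [hZ, Multiset.mem_toFinset, mem_roots hGL.ne_zero]; rfl
  have hZc : Z.card = G.natDegree := by
    rw [← hG.natDegree_map (jj Ω), (IsAlgClosed.splits (G.map (jj Ω))).natDegree_eq_card_roots, hZ, Multiset.toFinset_card_of_nodup]
    rw [Multiset.nodup_iff_count_le_one]
    intro s
    rw [count_roots]
    by_cases h : (G.map (jj Ω)).eval s = 0
    · exact (simple_mult hGL.ne_zero h (hsep s h)).le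
    · rw [rootMultiplicity_eq_zero h]; exact Nat.zero_le _
  have hTZ : T ⊆ Z := fun z hz => (hZm z).mpr (hT1 z hz)
  have hdiff : (Z \ T).card = 2 := by rw [Finset.card_sdiff_of_subset hTZ]; omega
  obtain ⟨ρ₁, ρ₂, hρ, hpair⟩ := Finset.card_eq_two.mp hdiff
  have hmem : ∀ z, z ∈ Z ∧ z ∉ T ↔ z = ρ₁ ∨ z = ρ₂ := by
    intro z; rw [← Finset.mem_sdiff, hpair]; simp
  have hρ₁ := (hmem ρ₁).mpr (Or.inl rfl)
  have hρ₂ := (hmem ρ₂).mpr (Or.inr rfl)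
  let G1 := G.map (algebraMap (PowerSeries Ω) (FractionRing (PowerSeries Ω)))
  have hG1 : G1.map (algebraMap (FractionRing (PowerSeries Ω)) (Lam Ω)) = G.map (jj Ω) := Polynomial.map_map _ _ _
  have hG1m : G1.Monic := hG.map _
  have hnot : ρ₁ ∉ (algebraMap (FractionRing (PowerSeries Ω)) (Lam Ω)).range := by
    rintro ⟨κ, hκ⟩
    have h1 : G1.eval κ = 0 := by
      apply (algebraMap (FractionRing (PowerSeries Ω)) (Lam Ω)).injective
      rw [← evm, hG1, hκ, map_zero]
      exact (hZm _).mp hρ₁.1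
    have h2 : IsIntegral (PowerSeries Ω) κ := ⟨G, hG, by rw [← eval_map]; exact h1⟩
    obtain ⟨o, ho⟩ := IsIntegrallyClosed.algebraMap_eq_of_integral h2
    have h3 : G.eval o = 0 := by
      apply IsFractionRing.injective (PowerSeries Ω) (FractionRing (PowerSeries Ω))
      rw [← evm, ho, map_zero]; exact h1
    have h4 : G0.eval (PowerSeries.constantCoeff o) = 0 := by rw [hG0, cc_eval, h3, map_zero]
    have h5 := hno o h3
    have h6 : PowerSeries.constantCoeff o ∈ G0.roots.toFinset.erase x := by
      rw [Finset.mem_erase, Multiset.mem_toFinset, mem_roots hG0m.ne_zero]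
      exact ⟨h5, h4⟩
    have h7 := hω _ h6
    have h8 := lift_unique h3 h7.1 h7.2.symm (hs _ h5 h4)
    apply hρ₁.2
    rw [hT2]
    refine ⟨_, h6, ?_⟩
    rw [h8, ← hκ, ← ho]; rfl
  have hint : IsIntegral (FractionRing (PowerSeries Ω)) ρ₁ := Algebra.IsIntegral.isIntegral ρ₁
  set μ := minpoly (FractionRing (PowerSeries Ω)) ρ₁ with hμ
  have hdeg : 2 ≤ μ.natDegree := (minpoly.two_le_natDegree_iff hint).mpr hnot
  have hdvd : μ ∣ G1 := minpoly.dvd _ _ (by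
    rw [aeval_def, ← eval_map, hG1]; exact (hZm _).mp hρ₁.1)
  have hdvd' : μ.map (algebraMap _ (Lam Ω)) ∣ G.map (jj Ω) := by
    rw [← hG1]; exact Polynomial.map_dvd _ hdvd
  have hμm : (μ.map (algebraMap _ (Lam Ω))).Monic := (minpoly.monic hint).map _
  have hnd : (μ.map (algebraMap _ (Lam Ω))).roots.Nodup := by
    rw [Multiset.nodup_iff_count_le_one]
    intro s
    refine (Multiset.count_le_of_le s (roots.le_of_dvd hGL.ne_zero hdvd')).trans ?_
    rw [count_roots]
    by_cases h : (G.map (jj Ω)).eval s = 0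
    · exact (simple_mult hGL.ne_zero h (hsep s h)).le
    · rw [rootMultiplicity_eq_zero h]; exact Nat.zero_le _
  have hmuc : 2 ≤ (μ.map (algebraMap _ (Lam Ω))).roots.toFinset.card := by
    rw [Multiset.toFinset_card_of_nodup hnd, ← (IsAlgClosed.splits _).natDegree_eq_card_roots, (minpoly.monic hint).natDegree_map]
    exact hdeg
  obtain ⟨ρ, hρm, hρne⟩ := Finset.exists_mem_ne (by omega : 1 < (μ.map (algebraMap _ (Lam Ω))).roots.toFinset.card) ρ₁
  have hρr : (μ.map (algebraMap _ (Lam Ω))).eval ρ = 0 := (mem_roots hμm.ne_zero).mp (Multiset.mem_toFinset.mp hρm)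
  obtain ⟨σ, hσ⟩ := minpoly.exists_algEquiv_of_root' (K := FractionRing (PowerSeries Ω)) (y := ρ₁) (x := ρ) hint.isAlgebraic (by
    rw [aeval_def, ← eval_map]; exact hρr)
  have hfix : ∀ o, σ (jj Ω o) = jj Ω o := fun o => σ.commutes _
  have hZσ : ∀ z ∈ Z, σ z ∈ Z := by
    intro z hz
    rw [hZm] at hz ⊢
    have h1 := evm (σ : Lam Ω →+* Lam Ω) (G.map (jj Ω)) z
    rw [hz, map_zero, Polynomial.map_map] at h1
    have h2 : (σ : Lam Ω →+* Lam Ω).comp (jj Ω) = jj Ω := RingHom.ext hfix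
    rw [h2] at h1
    exact h1
  have hTσ : ∀ z ∈ T, σ z = z := by
    intro z hz
    obtain ⟨s, _, rfl⟩ := (hT2 z).mp hz
    exact hfix _
  have hTσ' : ∀ z, z ∉ T → σ z ∉ T := by
    intro z hz h
    have := hTσ _ h
    rw [σ.injective.eq_iff] at this
    rw [this] at h
    exact hz h
  have e1 : σ ρ₁ = ρ₂ := by
    have := (hmem (σ ρ₁)).mp ⟨hZσ _ hρ₁.1, hTσ' _ hρ₁.2⟩
    refine this.resolve_left ?_
    rw [hσ]; exact hρne
  have e2 : σ ρ₂ = ρ₁ := by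
    have := (hmem (σ ρ₂)).mp ⟨hZσ _ hρ₂.1, hTσ' _ hρ₂.2⟩
    refine this.resolve_right ?_
    intro h
    exact hρ (σ.injective (e1.trans h.symm))
  refine ⟨(σ : Lam Ω →+* Lam Ω), hfix, ρ₁, ρ₂, hρ, (hZm _).mp hρ₁.1, (hZm _).mp hρ₂.1, e1, e2, ?_⟩
  intro z hz h1 h2
  by_cases hzT : z ∈ T
  · obtain ⟨s, _, h⟩ := (hT2 z).mp hzT
    exact ⟨_, h⟩
  · rcases (hmem z).mp ⟨(hZm z).mpr hz, hzT⟩ with h | h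
    · exact absurd h h1
    · exact absurd h h2
end
end BW

namespace BW
section
variable {K : Type*} [Field K] {Ω : Type*} [Field Ω] [Algebra K Ω]

noncomputable def jjA (K : Type*) [Field K] (Ω : Type*) [Field Ω] [Algebra K Ω] : PowerSeries Ω →ₐ[K] Lam Ω :=
  { jj Ω with commutes' := fun _ => rfl }

noncomputable def ccA (K : Type*) [Field K] (Ω : Type*) [Field Ω] [Algebra K Ω] : PowerSeries Ω →ₐ[K] Ω :=
  { (PowerSeries.constantCoeff : PowerSeries Ω →+* Ω) with
    commutes' := fun k => by
      change PowerSeries.constantCoeff (algebraMap K (PowerSeries Ω) k) = _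
      rw [PowerSeries.algebraMap_apply, PowerSeries.constantCoeff_C] }

noncomputable def CA (K : Type*) [Field K] (Ω : Type*) [Field Ω] [Algebra K Ω] : Ω →ₐ[K] PowerSeries Ω :=
  { (PowerSeries.C : Ω →+* PowerSeries Ω) with
    commutes' := fun k => by
      change PowerSeries.C (algebraMap K Ω k) = _
      rw [PowerSeries.algebraMap_apply] }

noncomputable def pA (K : Type*) [Field K] (Ω : Type*) [Field Ω] [Algebra K Ω] : Polynomial Ω →ₐ[K] PowerSeries Ω :=
  { (Polynomial.coeToPowerSeries.ringHom : Polynomial Ω →+* PowerSeries Ω) with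
    commutes' := fun k => by
      change ((Polynomial.C (algebraMap K Ω k) : Polynomial Ω) : PowerSeries Ω) = _
      rw [Polynomial.coe_C, PowerSeries.algebraMap_apply] }

lemma mult2 {S : Type*} [Field S] {P : S[X]} (hP : P ≠ 0) {x : S} (h0 : P.eval x = 0) (h1 : (derivative P).eval x = 0)
    (h2 : (derivative (derivative P)).eval x ≠ 0) : P.rootMultiplicity x = 2 := by
  have h3 : 1 < P.rootMultiplicity x := (one_lt_rootMultiplicity_iff_isRoot hP).mpr ⟨h0, h1⟩
  by_contra h4
  have h5 : 3 ≤ P.rootMultiplicity x := by omega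
  obtain ⟨q, hq⟩ := (le_rootMultiplicity_iff hP).mp h5
  apply h2
  rw [hq]
  simp only [derivative_mul, derivative_pow, derivative_sub, derivative_X, derivative_C, derivative_add]
  simp

lemma psi_inj {a b m β : Ω} (h : AlgebraicIndependent K ![a, b]) (hm : Transcendental K m) :
    Function.Injective (MvPolynomial.aeval (R := K) ![(PowerSeries.C m : PowerSeries Ω), PowerSeries.C β + PowerSeries.X]) := by
  rw [injective_iff_map_eq_zero]
  intro p hp
  have e1 := av2 (pA K Ω) (C m) (C β + X) p
  have e2 : pA K Ω (C m) = PowerSeries.C m := Polynomial.coe_C m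
  have e3 : pA K Ω (C β + X) = PowerSeries.C β + PowerSeries.X := by
    rw [map_add]
    exact congrArg₂ _ (Polynomial.coe_C β) Polynomial.coe_X
  rw [e2, e3, hp] at e1
  have e4 : (MvPolynomial.aeval ![C m, C β + X] p : Polynomial Ω) = 0 := Polynomial.coe_injective Ω (by
    rw [Polynomial.coe_zero]; exact e1)
  have e5 : ∀ u : Ω, MvPolynomial.aeval ![m, u] p = 0 := by
    intro u
    have := av2 ((Polynomial.aeval (R := Ω) (u - β)).restrictScalars K) (C m) (C β + X) p
    rw [e4, map_zero] at this
    simp only [AlgHom.restrictScalars_apply, aeval_C, map_add, aeval_X, Algebra.algebraMap_self, RingHom.id_apply, add_sub_cancel] at this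
    exact this.symm
  have : ∃ u, u ∉ NN K m := by
    by_contra! hall
    exact NN_not h (hall a) (hall b)
  obtain ⟨u, hu⟩ := this
  have hi : AlgebraicIndependent K ![m, u] := ind2.mpr ⟨hm, fun h' => hu (mem_NN.mpr h')⟩
  exact hi (by rw [e5, map_zero])

/-- every element of `Ω` is algebraic over `K[a, b]` -/
lemma GenL.poly {a b : Ω} (h : GenL K a b) (z : Ω) :
    ∃ p : (Algebra.adjoin K (Set.range ![a, b]))[X], p ≠ 0 ∧ p.eval₂ (algebraMap _ Ω) z = 0 := by
  have := h.alg z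
  have e : ({a, b} : Set Ω) = Set.range ![a, b] := by simp [Set.pair_comm]
  rw [e, IntermediateField.isAlgebraic_adjoin_iff] at this
  exact this

/-- Degeneration: the generic line specialises to the pencil `y = m T + β + ε`. -/
lemma eta_exists {a b m β : Ω} (h : GenL K a b) (hm : Transcendental K m) :
    ∃ η : Ω →ₐ[K] Lam Ω, η a = jj Ω (PowerSeries.C m) ∧ η b = jj Ω (PowerSeries.C β + PowerSeries.X) := by
  let ψ : MvPolynomial (Fin 2) K →ₐ[K] Lam Ω :=
    (jjA K Ω).comp (MvPolynomial.aeval (R := K) ![(PowerSeries.C m : PowerSeries Ω), PowerSeries.C β + PowerSeries.X])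
  have hψ : Function.Injective ψ := jj_inj.comp (psi_inj h.ind hm)
  let e := h.ind.aevalEquiv
  obtain ⟨η, hη⟩ := ext_alg (algebraMap (Algebra.adjoin K (Set.range ![a, b])) Ω) ((ψ.comp e.symm.toAlgHom : _ →ₐ[K] Lam Ω) : _ →+* Lam Ω)
    Subtype.val_injective (hψ.comp e.symm.injective) h.poly
  have h1 : ∀ p : MvPolynomial (Fin 2) K, η (MvPolynomial.aeval ![a, b] p) = ψ p := by
    intro p
    have h2 := hη (e p)
    have h3 : algebraMap (Algebra.adjoin K (Set.range ![a, b])) Ω (e p) = MvPolynomial.aeval ![a, b] p :=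
      h.ind.algebraMap_aevalEquiv p
    rw [h3] at h2
    rw [h2]
    change ψ (e.symm (e p)) = ψ p
    rw [AlgEquiv.symm_apply_apply]
  refine ⟨{ η with commutes' := fun k => ?_ }, ?_, ?_⟩
  · have := h1 (MvPolynomial.C k)
    rw [MvPolynomial.aeval_C] at this
    refine this.trans ?_
    exact ψ.commutes k
  · have := h1 (MvPolynomial.X 0)
    rw [MvPolynomial.aeval_X] at this
    refine this.trans ?_
    exact congrArg (jj Ω) (MvPolynomial.aeval_X _ _)
  · have := h1 (MvPolynomial.X 1)
    rw [MvPolynomial.aeval_X] at this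
    refine this.trans ?_
    exact congrArg (jj Ω) (MvPolynomial.aeval_X _ _)

variable [IsAlgClosed Ω]

/-- pulling back an automorphism -/
lemma pull_back {a b : Ω} (h : GenL K a b) (η : Ω →ₐ[K] Lam Ω) (δ : Lam Ω →+* Lam Ω)
    (hK : ∀ k : K, δ (algebraMap K _ k) = algebraMap K _ k) (ha : δ (η a) = η a) (hb : δ (η b) = η b) :
    ∃ γ : Ω →+* Ω, Fix K a b γ ∧ ∀ z, η (γ z) = δ (η z) := by
  have hfix : ∀ w : Algebra.adjoin K (Set.range ![a, b]), δ (η (algebraMap _ Ω w)) = η (algebraMap _ Ω w) := by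
    intro w
    obtain ⟨p, rfl⟩ := h.ind.aevalEquiv.surjective w
    rw [h.ind.algebraMap_aevalEquiv p]
    let δA : Lam Ω →ₐ[K] Lam Ω := { δ with commutes' := hK }
    change δA (η _) = _
    rw [av2, av2]
    change MvPolynomial.aeval ![δ (η a), δ (η b)] p = _
    rw [ha, hb]
  have hr : ∀ z, ∃ z', η z' = δ (η z) := by
    intro z
    obtain ⟨p, hp, hp0⟩ := h.poly z
    set P := p.map (algebraMap (Algebra.adjoin K (Set.range ![a, b])) Ω) with hP
    have hP0 : P ≠ 0 := (Polynomial.map_ne_zero_iff Subtype.val_injective).mpr hp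
    obtain ⟨y, hy⟩ := roots_ex P _ rfl
    have hz : P.eval z = 0 := by rw [hP, eval_map]; exact hp0
    have h1 : (P.map (η : Ω →+* Lam Ω)).map δ = P.map (η : Ω →+* Lam Ω) := by
      rw [hP, Polynomial.map_map, Polynomial.map_map]
      have h3 : (δ.comp (η : Ω →+* Lam Ω)).comp (algebraMap (Algebra.adjoin K (Set.range ![a, b])) Ω) =
          (η : Ω →+* Lam Ω).comp (algebraMap (Algebra.adjoin K (Set.range ![a, b])) Ω) := RingHom.ext hfix
      rw [h3, Polynomial.map_map]
    have h2 : (P.map (η : Ω →+* Lam Ω)).eval (δ (η z)) = 0 := by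
      rw [← h1, evm]
      have : (P.map (η : Ω →+* Lam Ω)).eval (η z) = 0 := by
        have := evm (η : Ω →+* Lam Ω) P z
        rw [hz, map_zero] at this
        exact this
      rw [this, map_zero]
    rw [hy, Polynomial.map_mul, map_C, Polynomial.map_prod, eval_mul, eval_C, eval_prod, mul_eq_zero] at h2
    rcases h2 with h2 | h2
    · exfalso
      have : P.leadingCoeff = 0 := η.toRingHom.injective (by rw [map_zero]; exact h2)
      exact hP0 (leadingCoeff_eq_zero.mp this)
    · obtain ⟨j, _, hj⟩ := Finset.prod_eq_zero_iff.mp h2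
      refine ⟨y j, ?_⟩
      rw [Polynomial.map_sub, map_X, map_C, eval_sub, eval_X, eval_C, sub_eq_zero] at hj
      exact hj.symm
  choose g hg using hr
  have inj : Function.Injective η := η.toRingHom.injective
  let γ : Ω →+* Ω :=
    { toFun := g
      map_one' := inj (by rw [hg, map_one, map_one])
      map_zero' := inj (by rw [hg, map_zero, map_zero])
      map_add' := fun u v => inj (by rw [hg, map_add, map_add, map_add, hg, hg])
      map_mul' := fun u v => inj (by rw [hg, map_mul, map_mul, map_mul, hg, hg]) }
  refine ⟨γ, ⟨fun k => inj ?_, inj ?_, inj ?_⟩, hg⟩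
  · refine (hg _).trans ?_
    rw [AlgHom.commutes, hK]
  · exact (hg _).trans ha
  · exact (hg _).trans hb
end
end BW

namespace BW
section
variable {K : Type*} [Field K] [IsAlgClosed K] {Ω : Type*} [Field Ω] [IsAlgClosed Ω] [Algebra K Ω]

/-- no power series root reduces to the point of tangency -/
lemma no_root {f : MvPolynomial (Fin 2) K} {x m β : Ω}
    (hm : MvPolynomial.aeval ![x, m * x + β] (MvPolynomial.pderiv 0 f) + m * MvPolynomial.aeval ![x, m * x + β] (MvPolynomial.pderiv 1 f) = 0)
    (hB : MvPolynomial.aeval ![x, m * x + β] (MvPolynomial.pderiv 1 f) ≠ 0)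
    (ω : PowerSeries Ω) (h0 : (gp f (PowerSeries.C m) (PowerSeries.C β + PowerSeries.X)).eval ω = 0) :
    PowerSeries.constantCoeff ω ≠ x := by
  intro hx
  rw [gp_eval] at h0
  let D := (PowerSeries.derivative Ω).restrictScalars K
  have h1 := chain_rule D ![ω, PowerSeries.C m * ω + (PowerSeries.C β + PowerSeries.X)] f
  rw [h0, map_zero, Fin.sum_univ_two] at h1
  simp only [Matrix.cons_val_zero, Matrix.cons_val_one] at h1
  have e1 : D (PowerSeries.C m * ω + (PowerSeries.C β + PowerSeries.X)) = PowerSeries.C m * D ω + 1 := by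
    have d1 : D (PowerSeries.C m) = 0 := PowerSeries.derivative_C
    have d2 : D (PowerSeries.C β) = 0 := PowerSeries.derivative_C
    have d3 : D (PowerSeries.X) = 1 := PowerSeries.derivative_X
    rw [map_add, D.leibniz, map_add, d1, d2, d3, smul_zero, add_zero, zero_add, smul_eq_mul]
  rw [e1] at h1
  have h2 := congrArg (ccA K Ω) h1
  have c1 : ccA K Ω ω = x := hx
  have c2 : ccA K Ω (PowerSeries.C m) = m := PowerSeries.constantCoeff_C m
  have c3 : ccA K Ω (PowerSeries.C β) = β := PowerSeries.constantCoeff_C β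
  have c4 : ccA K Ω PowerSeries.X = 0 := PowerSeries.constantCoeff_X
  simp only [map_add, map_mul, map_zero, map_one, av2, c1, c2, c3, c4, add_zero] at h2
  apply hB
  linear_combination -h2 - ccA K Ω (D ω) * hm

set_option maxHeartbeats 1000000 in
theorem TR {a b : Ω} (h : GenL K a b) {ι : Type*} (f : ι → MvPolynomial (Fin 2) K) (d : ι → ℕ)
    (hs : ∀ i, Sm (f i) (d i)) (hd : ∀ i, (d i : K) ≠ 0) (hd1 : ∀ i, ((d i - 1 : ℕ) : K) ≠ 0)
    (hdvd : ∀ i j, i ≠ j → ¬ f i ∣ f j) (i : ι) {r : Ω} (hr : (gp (f i) a b).eval r = 0) :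
    ∃ γ : Ω →+* Ω, Fix K a b γ ∧ ∃ r₁ r₂, r₁ ≠ r₂ ∧ (gp (f i) a b).eval r₁ = 0 ∧ (gp (f i) a b).eval r₂ = 0 ∧
      γ r₁ = r₂ ∧ γ r₂ = r₁ ∧ (∀ z, (gp (f i) a b).eval z = 0 → z ≠ r₁ → z ≠ r₂ → γ z = z) ∧
      ∀ j, j ≠ i → ∀ z, (gp (f j) a b).eval z = 0 → γ z = z := by
  have hd0 : ∀ j, d j ≠ 0 := fun j h0 => hd j (by rw [h0]; simp)
  rw [gp_eval] at hr
  have hP := pt_ne' h r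
  have hB := fy_ne (hs i) (hd i) (hd1 i) hr hP
  have hH := Hess_ne (hs i) (hd i) (hd1 i) hr hP
  obtain ⟨m, hm⟩ : ∃ m, MvPolynomial.aeval ![r, a * r + b] (MvPolynomial.pderiv 0 (f i)) +
      m * MvPolynomial.aeval ![r, a * r + b] (MvPolynomial.pderiv 1 (f i)) = 0 :=
    ⟨- MvPolynomial.aeval ![r, a * r + b] (MvPolynomial.pderiv 0 (f i)) / MvPolynomial.aeval ![r, a * r + b] (MvPolynomial.pderiv 1 (f i)), by
      rw [div_mul_cancel₀ _ hB]; ring⟩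
  have hmt := m_trans (hs i) (hd i) (hd1 i) hr hP hm
  obtain ⟨β, hβ⟩ : ∃ β, a * r + b = m * r + β := ⟨a * r + b - m * r, by ring⟩
  rw [hβ] at hr hP hB hH hm
  -- reductions
  have htan : ∀ j s, (gp (f j) m β).eval s = 0 → (derivative (gp (f j) m β)).eval s = 0 → s = r := by
    intro j s h0 h1
    rw [gp_eval] at h0
    rw [gp_der, eval_add, eval_mul, eval_C, gp_eval, gp_eval] at h1
    exact no_tang (hs i) (hd i) (hd1 i) (hs j) (hd j) (hd1 j) hr hP hm h0 h1 (by ring)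
  have htan' : ∀ j, j ≠ i → ∀ s, (gp (f j) m β).eval s = 0 → (derivative (gp (f j) m β)).eval s ≠ 0 := by
    intro j hj s h0 h1
    obtain rfl := htan j s h0 h1
    rw [gp_eval] at h0
    exact hdvd i j hj.symm (GP ((hs i).irr (hd0 i)) hr hP _ h0)
  have hg0 : (gp (f i) m β).eval r = 0 := by rw [gp_eval]; exact hr
  have hg1 : (derivative (gp (f i) m β)).eval r = 0 := by
    rw [gp_der, eval_add, eval_mul, eval_C, gp_eval, gp_eval]; exact hm
  have hg2 : (derivative (derivative (gp (f i) m β))).eval r ≠ 0 := by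
    rw [gp_der, derivative_add, derivative_C_mul, gp_der, gp_der]
    simp only [eval_add, eval_mul, eval_C, gp_eval]
    intro h0
    apply hH
    rw [pd_comm] at h0
    simp only [Hess, map_add, map_sub, map_mul, map_pow, map_ofNat]
    generalize MvPolynomial.aeval ![r, m * r + β] (MvPolynomial.pderiv 0 (f i)) = A at *
    generalize MvPolynomial.aeval ![r, m * r + β] (MvPolynomial.pderiv 1 (f i)) = B at *
    obtain rfl : A = - (m * B) := by linear_combination hm
    linear_combination B ^ 2 * h0
  -- the leading coefficients
  set c : ι → Ω := fun j => Polynomial.aeval m (lcp (d j) (f j)) with hc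
  have hc0 : ∀ j, c j ≠ 0 := fun j h0 => lcp_ne (hs j).deg (hd0 j) (transcendental_iff.mp hmt _ h0)
  set a' : PowerSeries Ω := PowerSeries.C m with ha'
  set b' : PowerSeries Ω := PowerSeries.C β + PowerSeries.X with hb'
  set G : ι → (PowerSeries Ω)[X] := fun j => C (PowerSeries.C (c j)⁻¹) * gp (f j) a' b' with hG
  have hGm : ∀ j, (G j).Monic := by
    intro j
    refine monic_of_natDegree_le_of_coeff_eq_one (d j) ((natDegree_C_mul_le _ _).trans (gp_deg (hs j).deg.le _ _)) ?_
    rw [hG]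
    simp only [coeff_C_mul]
    rw [gp_coeff (hs j).deg.le]
    have : Polynomial.aeval a' (lcp (d j) (f j)) = PowerSeries.C (c j) := by
      have := Polynomial.aeval_algHom_apply (CA K Ω) m (lcp (d j) (f j))
      exact this
    rw [this, ← map_mul, inv_mul_cancel₀ (hc0 j), map_one]
  have hGc : ∀ j, (G j).map PowerSeries.constantCoeff = C (c j)⁻¹ * gp (f j) m β := by
    intro j
    rw [hG]
    simp only [Polynomial.map_mul, map_C, PowerSeries.constantCoeff_C]
    have h1 := gp_map (ccA K Ω) (f j) a' b'
    have c2 : ccA K Ω a' = m := PowerSeries.constantCoeff_C m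
    have c3 : ccA K Ω b' = β := by
      rw [hb', map_add]
      have c3 : ccA K Ω (PowerSeries.C β) = β := PowerSeries.constantCoeff_C β
      have c4 : ccA K Ω PowerSeries.X = 0 := PowerSeries.constantCoeff_X
      rw [c3, c4, add_zero]
    rw [c2, c3] at h1
    exact congrArg _ h1
  have hci : ∀ j, (c j)⁻¹ ≠ 0 := fun j => inv_ne_zero (hc0 j)
  have hGc0 : ∀ j s, ((G j).map PowerSeries.constantCoeff).eval s = 0 ↔ (gp (f j) m β).eval s = 0 := by
    intro j s
    rw [hGc, eval_mul, eval_C, mul_eq_zero]; simp [hc0 j]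
  have hGc1 : ∀ j s, (derivative ((G j).map PowerSeries.constantCoeff)).eval s = 0 ↔ (derivative (gp (f j) m β)).eval s = 0 := by
    intro j s
    rw [hGc, derivative_C_mul, eval_mul, eval_C, mul_eq_zero]; simp [hc0 j]
  obtain ⟨η, hηa, hηb⟩ := eta_exists (β := β) h hmt
  have hinj : Function.Injective η := η.toRingHom.injective
  have hηg : ∀ j, (gp (f j) a' b').map (jj Ω) = (gp (f j) a b).map (η : Ω →+* Lam Ω) := by
    intro j
    rw [gp_map, hηa, hηb]
    exact gp_map (jjA K Ω) (f j) a' b'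
  have hGj : ∀ j, (G j).map (jj Ω) = C (jj Ω (PowerSeries.C (c j)⁻¹)) * (gp (f j) a b).map (η : Ω →+* Lam Ω) := by
    intro j
    rw [hG]
    simp only [Polynomial.map_mul, map_C]
    rw [hηg]
  have hu : ∀ j, jj Ω (PowerSeries.C (c j)⁻¹) ≠ 0 := by
    intro j h0
    rw [← map_zero (jj Ω)] at h0
    have := jj_inj h0
    rw [← map_zero PowerSeries.C] at this
    exact hci j (PowerSeries.C_injective this)
  have hGr : ∀ j z, ((G j).map (jj Ω)).eval (η z) = 0 ↔ (gp (f j) a b).eval z = 0 := by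
    intro j z
    rw [hGj, eval_mul, eval_C, mul_eq_zero, or_iff_right (hu j)]
    have := evm (η : Ω →+* Lam Ω) (gp (f j) a b) z
    change _ = η _ at this
    constructor
    · intro h0
      apply hinj
      rw [map_zero, ← this]; exact h0
    · intro h0
      rw [h0, map_zero] at this; exact this
  have hGr' : ∀ j z, ((G j).map (jj Ω)).eval z = 0 → ∃ z', η z' = z := by
    intro j z hz
    rw [hGj, eval_mul, eval_C, mul_eq_zero, or_iff_right (hu j)] at hz
    obtain ⟨y, hy⟩ := roots_ex (gp (f j) a b) _ rfl
    rw [hy, Polynomial.map_mul, map_C, Polynomial.map_prod, eval_mul, eval_C, eval_prod, mul_eq_zero] at hz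
    rcases hz with h2 | h2
    · exfalso
      have h3 : (gp (f j) a b).leadingCoeff = 0 := η.toRingHom.injective (by rw [map_zero]; exact h2)
      have h4 := (hGm j).map (jj Ω)
      rw [hGj, leadingCoeff_eq_zero.mp h3, Polynomial.map_zero, mul_zero] at h4
      exact h4.ne_zero rfl
    · obtain ⟨k, _, hk⟩ := Finset.prod_eq_zero_iff.mp h2
      refine ⟨y k, ?_⟩
      rw [Polynomial.map_sub, map_X, map_C, eval_sub, eval_X, eval_C, sub_eq_zero] at hk
      exact hk.symm
  obtain ⟨δ, hδ, ρ₁, ρ₂, hρ, h1, h2, hδ1, hδ2, hδ3⟩ := LD (G i) (hGm i) r (by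
    have e : ((G i).map PowerSeries.constantCoeff).Monic := (hGm i).map _
    refine mult2 e.ne_zero ((hGc0 i r).mpr hg0) ((hGc1 i r).mpr hg1) ?_
    rw [hGc, derivative_C_mul, derivative_C_mul, eval_mul, eval_C]
    exact mul_ne_zero (hci i) hg2) (by
    intro s hsr h0 h1
    rw [hGc0] at h0
    rw [hGc1] at h1
    exact hsr (htan i s h0 h1)) (by
    intro ω hω
    refine no_root hm hB ω ?_
    rw [hG] at hω
    simp only [eval_mul, eval_C, mul_eq_zero] at hω
    refine hω.resolve_left fun h0 => hu i ?_
    rw [h0, map_zero]) (by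
    intro z hz
    obtain ⟨w, rfl⟩ := hGr' i z hz
    rw [hGr] at hz
    rw [hGj, derivative_C_mul, eval_mul, eval_C, derivative_map]
    refine mul_ne_zero (hu i) ?_
    have := evm (η : Ω →+* Lam Ω) (derivative (gp (f i) a b)) w
    intro h0
    have h3 := this.symm.trans h0
    exact gp_sep h (hs i) (hd0 i) hz (hinj (by rw [map_zero]; exact h3)))
  obtain ⟨γ, hγ, hγη⟩ := pull_back h η δ (fun k => hδ (algebraMap K _ k)) (by rw [hηa, hδ]) (by rw [hηb, hδ])
  obtain ⟨r₁, rfl⟩ := hGr' i ρ₁ h1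
  obtain ⟨r₂, rfl⟩ := hGr' i ρ₂ h2
  refine ⟨γ, hγ, r₁, r₂, fun h0 => hρ (by rw [h0]), (hGr _ _).mp h1, (hGr _ _).mp h2, hinj ?_, hinj ?_, ?_, ?_⟩
  · rw [hγη, hδ1]
  · rw [hγη, hδ2]
  · intro z hz hz1 hz2
    obtain ⟨o, ho⟩ := hδ3 (η z) ((hGr i z).mpr hz) (fun h0 => hz1 (hinj h0)) (fun h0 => hz2 (hinj h0))
    apply hinj
    rw [hγη, ← ho, hδ]
  · intro j hj z hz
    obtain ⟨o, ho⟩ := LS (G j) (hGm j) (by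
      intro s h0 h1
      rw [hGc0] at h0
      rw [hGc1] at h1
      exact htan' j hj s h0 h1) (η z) ((hGr j z).mpr hz)
    apply hinj
    rw [hγη, ← ho, hδ]
end
end BW

namespace BW
section
variable {K : Type*} [Field K] [IsAlgClosed K] {Ω : Type*} [Field Ω] [IsAlgClosed Ω] [Algebra K Ω]

lemma full_of_swaps {s : ℕ} {d : Fin s → ℕ} (H : Subgroup (GG d))
    (h : ∀ i (p q : Fin (d i)), p ≠ q → (Pi.mulSingle i (Equiv.swap p q) : GG d) ∈ H) : ∀ τ, τ ∈ H := by
  intro τ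
  refine Subgroup.pi_mem_of_mulSingle_mem _ fun i => ?_
  have h1 : H.comap (MonoidHom.mulSingle (fun i => Equiv.Perm (Fin (d i))) i) = ⊤ := by
    rw [eq_top_iff, ← Equiv.Perm.closure_isSwap, Subgroup.closure_le]
    rintro σ ⟨p, q, hpq, rfl⟩
    exact h i p q hpq
  have h2 : τ i ∈ H.comap (MonoidHom.mulSingle (fun i => Equiv.Perm (Fin (d i))) i) := by rw [h1]; trivial
  exact h2

set_option maxHeartbeats 1000000 in
theorem full_perm {a b : Ω} (h : GenL K a b) {s : ℕ} (f : Fin s → MvPolynomial (Fin 2) K) (d : Fin s → ℕ)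
    (hs : ∀ i, Sm (f i) (d i)) (hd : ∀ i, (d i : K) ≠ 0) (hd1 : ∀ i, ((d i - 1 : ℕ) : K) ≠ 0)
    (hdvd : ∀ i j, i ≠ j → ¬ f i ∣ f j) (c : Fin s → Ω) (hc : ∀ i, c i ≠ 0) (r : ∀ i, Fin (d i) → Ω)
    (hr : ∀ i, gp (f i) a b = C (c i) * ∏ j, (X - C (r i j))) :
    (∀ i, Function.Injective (r i)) ∧ ∀ τ : GG d, ∃ γ : Ω →+* Ω, Fix K a b γ ∧ ∀ i j, γ (r i j) = r i (τ i j) := by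
  classical
  have hd0 : ∀ j, d j ≠ 0 := fun j h0 => hd j (by rw [h0]; simp)
  have hroot : ∀ i z, (gp (f i) a b).eval z = 0 ↔ ∃ j, r i j = z := by
    intro i z
    rw [hr, eval_mul, eval_C, mul_eq_zero, or_iff_right (hc i), eval_prod, Finset.prod_eq_zero_iff]
    simp only [Finset.mem_univ, true_and, eval_sub, eval_X, eval_C, sub_eq_zero]
    exact exists_congr fun j => eq_comm
  have hroot' : ∀ i j, (gp (f i) a b).eval (r i j) = 0 := fun i j => (hroot i _).mpr ⟨j, rfl⟩
  have hinj : ∀ i, Function.Injective (r i) := by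
    intro i j k hjk
    by_contra hne
    apply gp_sep h (hs i) (hd0 i) (hroot' i j)
    rw [hr, derivative_C_mul, eval_mul, eval_C, derivative_prod_finset, eval_finsetSum]
    rw [Finset.sum_eq_zero, mul_zero]
    intro l _
    rw [eval_mul, eval_prod]
    by_cases hl : l = j
    · rw [Finset.prod_eq_zero (i := k), zero_mul]
      · simp [hl, Ne.symm hne]
      · simp [hjk]
    · rw [Finset.prod_eq_zero (i := j), zero_mul]
      · simp [Ne.symm hl]
      · simp
  refine ⟨hinj, ?_⟩
  have hgp : ∀ (γ : Ω →+* Ω), Fix K a b γ → ∀ i, (gp (f i) a b).map γ = gp (f i) a b := by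
    intro γ hγ i
    let γA : Ω →ₐ[K] Ω := { γ with commutes' := hγ.1 }
    have := gp_map γA (f i) a b
    have e1 : γA a = a := hγ.2.1
    have e2 : γA b = b := hγ.2.2
    rw [e1, e2] at this
    exact this
  have hperm : ∀ (γ : Ω →+* Ω), Fix K a b γ → ∃ τ : GG d, ∀ i j, γ (r i j) = r i (τ i j) := by
    intro γ hγ
    have h1 : ∀ i j, ∃ k, r i k = γ (r i j) := by
      intro i j
      rw [← hroot, ← hgp γ hγ i, evm, hroot', map_zero]
    choose g hg using h1
    have hgi : ∀ i, Function.Injective (g i) := by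
      intro i j k hjk
      apply hinj i
      apply γ.injective
      rw [← hg, ← hg, hjk]
    exact ⟨fun i => Equiv.ofBijective (g i) (Finite.injective_iff_bijective.mp (hgi i)), fun i j => (hg i j).symm⟩
  let M : Submonoid (GG d) :=
    { carrier := {τ | ∃ γ : Ω →+* Ω, Fix K a b γ ∧ ∀ i j, γ (r i j) = r i (τ i j)}
      one_mem' := ⟨RingHom.id _, ⟨fun _ => rfl, rfl, rfl⟩, fun _ _ => rfl⟩
      mul_mem' := by
        rintro τ τ' ⟨γ, hγ, h1⟩ ⟨γ', hγ', h1'⟩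
        refine ⟨γ.comp γ', ⟨fun k => ?_, ?_, ?_⟩, fun i j => ?_⟩
        · rw [RingHom.comp_apply, hγ'.1, hγ.1]
        · rw [RingHom.comp_apply, hγ'.2.1, hγ.2.1]
        · rw [RingHom.comp_apply, hγ'.2.2, hγ.2.2]
        · rw [RingHom.comp_apply, h1', h1]; rfl }
  let H : Subgroup (GG d) :=
    { M with
      inv_mem' := by
        intro τ hτ
        have e : τ⁻¹ = τ ^ (orderOf τ - 1) := by
          apply inv_eq_of_mul_eq_one_left
          rw [← pow_succ, Nat.sub_add_cancel (orderOf_pos τ), pow_orderOf_eq_one]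
        rw [e]
        exact M.pow_mem hτ _ }
  have hH : ∀ τ, τ ∈ H ↔ ∃ γ : Ω →+* Ω, Fix K a b γ ∧ ∀ i j, γ (r i j) = r i (τ i j) := fun τ => Iff.rfl
  suffices ∀ τ, τ ∈ H from fun τ => (hH τ).mp (this τ)
  apply full_of_swaps
  intro i p q hpq
  -- a transposition
  obtain ⟨γ, hγ, r₁, r₂, hr12, hr1, hr2, h1, h2, h3, h4⟩ := TR h f d hs hd hd1 hdvd i (hroot' i p)
  obtain ⟨j₁, rfl⟩ := (hroot i r₁).mp hr1
  obtain ⟨j₂, rfl⟩ := (hroot i r₂).mp hr2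
  have hj : j₁ ≠ j₂ := fun h0 => hr12 (by rw [h0])
  have hsw : (Pi.mulSingle i (Equiv.swap j₁ j₂) : GG d) ∈ H := by
    rw [hH]
    refine ⟨γ, hγ, fun l k => ?_⟩
    by_cases hl : l = i
    · subst hl
      rw [Pi.mulSingle_eq_same]
      by_cases hk1 : k = j₁
      · subst hk1; rw [Equiv.swap_apply_left, h1]
      · by_cases hk2 : k = j₂
        · subst hk2; rw [Equiv.swap_apply_right, h2]
        · rw [Equiv.swap_apply_of_ne_of_ne hk1 hk2]
          exact h3 _ (hroot' _ _) (fun h0 => hk1 (hinj _ h0)) (fun h0 => hk2 (hinj _ h0))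
    · rw [Pi.mulSingle_eq_of_ne hl]
      exact h4 l hl _ (hroot' _ _)
  have hmv : ∃ τ ∈ H, τ i j₁ = p ∧ τ i j₂ = q := by
    obtain ⟨γ1, hγ1, e1⟩ := trans1 h (hs i) (hd0 i) (hroot' i j₁) (hroot' i p)
    obtain ⟨τ1, hτ1⟩ := hperm γ1 hγ1
    have e1' : τ1 i j₁ = p := hinj i (by rw [← hτ1, e1])
    have hne : p ≠ τ1 i j₂ := by
      intro h0
      rw [← e1'] at h0
      exact hj ((τ1 i).injective h0)
    obtain ⟨γ2, hγ2, e2, e3⟩ := trans2 h (hs i) (hd0 i) (hroot' i p) (hroot' i (τ1 i j₂)) (hroot' i q)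
      (fun h0 => hne (hinj i h0)) (fun h0 => hpq (hinj i h0))
    obtain ⟨τ2, hτ2⟩ := hperm γ2 hγ2
    have e2' : τ2 i p = p := hinj i (by rw [← hτ2, e2])
    have e3' : τ2 i (τ1 i j₂) = q := hinj i (by rw [← hτ2, e3])
    refine ⟨τ2 * τ1, H.mul_mem ((hH _).mpr ⟨γ2, hγ2, hτ2⟩) ((hH _).mpr ⟨γ1, hγ1, hτ1⟩), ?_, e3'⟩
    change τ2 i (τ1 i j₁) = p
    rw [e1', e2']
  obtain ⟨τ, hτ, hp, hq⟩ := hmv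
  have := H.mul_mem (H.mul_mem hτ hsw) (H.inv_mem hτ)
  convert this using 1
  funext l
  by_cases hl : l = i
  · subst hl
    rw [Pi.mul_apply, Pi.mul_apply, Pi.mulSingle_eq_same, Pi.mulSingle_eq_same, Pi.inv_apply, ← hp, ← hq, Equiv.swap_apply_apply]
  · rw [Pi.mul_apply, Pi.mul_apply, Pi.mulSingle_eq_of_ne hl, Pi.mulSingle_eq_of_ne hl, Pi.inv_apply, mul_one, mul_inv_cancel]
end
end BW

namespace BW

lemma cf_scale {S : Type} [Field S] {n : ℕ} (r : Fin n → S) (c : S) (hc : c ≠ 0) (P : S[X])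
    (hP : P = C c * ∏ j, (X - C (r j))) (j : Fin n) :
    cf (fun l => c * r l) j = c ^ (n - 1 - (j : ℕ)) * P.coeff j := by
  have h1 : (∏ k, (X - C (c * r k))).comp (C c * X) = C (c ^ (n - 1)) * P := by
    have hn : n - 1 + 1 = n := by have := j.2; omega
    rw [Polynomial.prod_comp, hP, ← mul_assoc, ← C_mul, ← pow_succ, hn]
    have : ∀ k, (X - C (c * r k)).comp (C c * X) = C c * (X - C (r k)) := by
      intro k; simp; ring
    simp only [this]
    rw [Finset.prod_mul_distrib]
    simp
  have h2 := congrArg (fun p => p.coeff (j : ℕ)) h1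
  simp only [comp_C_mul_X_coeff, coeff_C_mul] at h2
  unfold cf
  apply mul_right_cancel₀ (pow_ne_zero (j : ℕ) hc)
  rw [h2]
  have : n - 1 = (n - 1 - (j : ℕ)) + j := by have := j.2; omega
  conv_lhs => rw [this, pow_add]
  ring

lemma irr_scale {S : Type} [Field S] {n : ℕ} (hn : 1 ≤ n) (P : S[X]) (hP : P.natDegree ≤ n) (hc : P.coeff n ≠ 0)
    (h : Irreducible (mp (fun j : Fin n => P.coeff n ^ (n - 1 - (j : ℕ)) * P.coeff j))) : Irreducible P := by
  set c := P.coeff n with hcdef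
  set Q := mp (fun j : Fin n => c ^ (n - 1 - (j : ℕ)) * P.coeff j) with hQ
  have h1 : Q.comp (C c * X) = C (c ^ (n - 1)) * P := by
    ext l
    rw [comp_C_mul_X_coeff, coeff_C_mul]
    rcases lt_trichotomy l n with hl | hl | hl
    · have := mp_coeff (fun j : Fin n => c ^ (n - 1 - (j : ℕ)) * P.coeff j) ⟨l, hl⟩
      simp only at this
      rw [hQ, this]
      have e : n - 1 = (n - 1 - l) + l := by omega
      conv_rhs => rw [e, pow_add]
      ring
    · subst hl
      have h2 : Q.coeff l = 1 := by
        have := mp_monic (fun j : Fin l => c ^ (l - 1 - (j : ℕ)) * P.coeff j)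
        rw [Monic, leadingCoeff, mp_natDegree] at this
        exact this
      rw [h2, one_mul, ← hcdef, ← pow_succ]
      congr 1; omega
    · rw [coeff_eq_zero_of_natDegree_lt (by rw [hQ, mp_natDegree]; exact hl),
        coeff_eq_zero_of_natDegree_lt (by omega)]
      simp
  have h3 : Irreducible (Q.comp (C c * X)) := by
    letI := invertibleOfNonzero hc
    have := (MulEquiv.irreducible_iff (algEquivCMulXAddC c 0 (R := S))).mpr h
    simpa [comp_eq_aeval] using this
  rw [h1] at h3
  exact (irreducible_isUnit_mul ((isUnit_iff_ne_zero.mpr (pow_ne_zero _ hc)).map C)).mp h3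

def CD {k : Type} [Field k] (n : ℕ) (P : Polynomial (MvPolynomial (Fin 2) k)) : Prop := ∀ j, (P.coeff j).totalDegree ≤ n

lemma CD.mul {k : Type} [Field k] {n m : ℕ} {P Q : Polynomial (MvPolynomial (Fin 2) k)} (hP : CD n P) (hQ : CD m Q) :
    CD (n + m) (P * Q) := by
  intro j
  rw [coeff_mul]
  refine MvPolynomial.totalDegree_finsetSum_le fun x _ => ?_
  exact (MvPolynomial.totalDegree_mul _ _).trans (add_le_add (hP _) (hQ _))

lemma CD.mono {k : Type} [Field k] {n m : ℕ} {P : Polynomial (MvPolynomial (Fin 2) k)} (hP : CD n P) (h : n ≤ m) :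
    CD m P := fun j => (hP j).trans h

lemma CD.C {k : Type} [Field k] {n : ℕ} {g : MvPolynomial (Fin 2) k} (hP : g.totalDegree ≤ n) : CD n (C g) := by
  intro j
  rw [coeff_C]
  split_ifs
  · exact hP
  · simp

lemma CD.X {k : Type} [Field k] : CD (k := k) 0 X := by
  intro j
  rw [coeff_X]
  split_ifs <;> simp

lemma CD.pow {k : Type} [Field k] {n : ℕ} {P : Polynomial (MvPolynomial (Fin 2) k)} (hP : CD n P) (m : ℕ) :
    CD (m * n) (P ^ m) := by
  induction m with
  | zero => rw [pow_zero, ← C_1]; exact CD.C (by simp)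
  | succ m ih => rw [pow_succ, add_mul, one_mul]; exact ih.mul hP

lemma CD.add {k : Type} [Field k] {n : ℕ} {P Q : Polynomial (MvPolynomial (Fin 2) k)} (hP : CD n P) (hQ : CD n Q) :
    CD n (P + Q) := by
  intro j
  rw [coeff_add]
  exact (MvPolynomial.totalDegree_add _ _).trans (max_le (hP j) (hQ j))

lemma CD.sum {k : Type} [Field k] {n : ℕ} {τ : Type*} {t : Finset τ} {P : τ → Polynomial (MvPolynomial (Fin 2) k)}
    (hP : ∀ i ∈ t, CD n (P i)) : CD n (∑ i ∈ t, P i) := by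
  intro j
  rw [finsetSum_coeff]
  exact MvPolynomial.totalDegree_finsetSum_le fun x hx => hP x hx j

lemma gp_CD {k : Type} [Field k] (f : MvPolynomial (Fin 2) k) {d : ℕ} (h : f.totalDegree ≤ d) :
    CD d (gp f (MvPolynomial.X 0 : MvPolynomial (Fin 2) k) (MvPolynomial.X 1)) := by
  unfold gp
  rw [MvPolynomial.aeval_def, MvPolynomial.eval₂_eq']
  refine CD.sum fun m hm => ?_
  have hmd : m 0 + m 1 ≤ d := by
    have := (MvPolynomial.le_totalDegree hm).trans h
    rw [Finsupp.sum_fintype _ _ (by simp)] at this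
    simpa [Fin.sum_univ_two] using this
  have e : (algebraMap k (Polynomial (MvPolynomial (Fin 2) k))) (MvPolynomial.coeff m f) =
      C (MvPolynomial.C (MvPolynomial.coeff m f)) := rfl
  simp only [Fin.prod_univ_two, Matrix.cons_val_zero, Matrix.cons_val_one]
  rw [e]
  refine CD.mono (CD.mul (n := 0) (CD.C (by simp)) (CD.mul (CD.X.pow (m 0)) (CD.pow (n := 1) ?_ (m 1)))) (by omega)
  refine CD.add ((CD.mul (CD.C (n := 1) (by simp)) CD.X)) (CD.C (by simp))

end BW

namespace BW

lemma genL_ex (K : Type) [Field K] : ∃ (Ω : Type) (_ : Field Ω) (_ : IsAlgClosed Ω) (_ : Algebra K Ω) (a b : Ω), GenL K a b := by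
  let R := MvPolynomial (Fin 2) K
  let Q := FractionRing R
  let Ω := AlgebraicClosure Q
  refine ⟨Ω, inferInstance, inferInstance, inferInstance, algebraMap R Ω (MvPolynomial.X 0), algebraMap R Ω (MvPolynomial.X 1), ?_⟩
  have hinj : Function.Injective (algebraMap R Ω) := by
    rw [IsScalarTower.algebraMap_eq R Q Ω]
    exact (algebraMap Q Ω).injective.comp (IsFractionRing.injective R Q)
  have hae : ∀ g : R, MvPolynomial.aeval ![algebraMap R Ω (MvPolynomial.X 0), algebraMap R Ω (MvPolynomial.X 1)] g = algebraMap R Ω g := by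
    intro g
    have : (MvPolynomial.aeval ![algebraMap R Ω (MvPolynomial.X 0), algebraMap R Ω (MvPolynomial.X 1)] : R →ₐ[K] Ω) = 
      IsScalarTower.toAlgHom K R Ω := by
      apply MvPolynomial.algHom_ext
      intro i
      fin_cases i <;> simp <;> rfl
    rw [this]; rfl
  refine ⟨?_, ?_⟩
  · intro x y hxy
    simp only [hae] at hxy
    exact hinj hxy
  · intro z
    have hz : IsAlgebraic R z := (IsFractionRing.isAlgebraic_iff R Q Ω).mpr (Algebra.IsAlgebraic.isAlgebraic z)
    obtain ⟨p, hp, hpz⟩ := hz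
    let M := IntermediateField.adjoin K {algebraMap R Ω (MvPolynomial.X 0), algebraMap R Ω (MvPolynomial.X 1)}
    have hM : ∀ g : R, algebraMap R Ω g ∈ M := by
      intro g
      rw [← hae]
      refine mem_of_eq ?_ (MvPolynomial.aeval (R := K) ![(⟨algebraMap R Ω (MvPolynomial.X 0), IntermediateField.subset_adjoin _ _ (by simp)⟩ : M), ⟨algebraMap R Ω (MvPolynomial.X 1), IntermediateField.subset_adjoin _ _ (by simp)⟩] g).2
      have := MvPolynomial.comp_aeval_apply (R := K) (f := ![(⟨algebraMap R Ω (MvPolynomial.X 0), IntermediateField.subset_adjoin _ _ (by simp)⟩ : M), ⟨algebraMap R Ω (MvPolynomial.X 1), IntermediateField.subset_adjoin _ _ (by simp)⟩]) M.val g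
      refine Eq.trans ?_ this.symm
      congr 2
      funext i
      fin_cases i <;> rfl
    let φ : R →+* M := (algebraMap R Ω).codRestrict M hM
    refine ⟨p.map φ, ?_, ?_⟩
    · rw [Ne, Polynomial.map_eq_zero_iff]
      · exact hp
      · intro x y hxy
        exact hinj (congrArg Subtype.val hxy)
    · rw [aeval_def, eval₂_map]
      exact hpz

lemma gp_tower {k K S : Type} [Field k] [Field K] [Algebra k K] [CommRing S] [Algebra k S] [Algebra K S] [IsScalarTower k K S]
    (f : MvPolynomial (Fin 2) k) (a b : S) : gp (MvPolynomial.map (algebraMap k K) f) a b = gp f a b := by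
  unfold gp
  rw [MvPolynomial.aeval_map_algebraMap]

/-- the scaled coefficients -/
noncomputable def vv {k : Type} [Field k] {s : ℕ} (f : Fin s → MvPolynomial (Fin 2) k) (d : Fin s → ℕ) :
    Th d → MvPolynomial (Fin 2) k := fun p =>
  (gp (f p.1) (MvPolynomial.X 0 : MvPolynomial (Fin 2) k) (MvPolynomial.X 1)).coeff (d p.1) ^ (d p.1 - 1 - (p.2 : ℕ)) *
    (gp (f p.1) (MvPolynomial.X 0 : MvPolynomial (Fin 2) k) (MvPolynomial.X 1)).coeff p.2

lemma gp_hom {k S : Type} [Field k] [CommRing S] [Algebra k S] (θ : MvPolynomial (Fin 2) k →ₐ[k] S)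
    (f : MvPolynomial (Fin 2) k) (j : ℕ) :
    θ ((gp f (MvPolynomial.X 0 : MvPolynomial (Fin 2) k) (MvPolynomial.X 1)).coeff j) =
      (gp f (θ (MvPolynomial.X 0)) (θ (MvPolynomial.X 1))).coeff j := by
  rw [← gp_map, coeff_map]; rfl

set_option maxHeartbeats 1000000 in
lemma fullMono {k : Type} [Field k] {s : ℕ} (f : Fin s → MvPolynomial (Fin 2) k) (d : Fin s → ℕ)
    (hs : ∀ i, Sm (MvPolynomial.map (algebraMap k (AlgebraicClosure k)) (f i)) (d i))
    (hd : ∀ i, (d i : k) ≠ 0) (hd1 : ∀ i, ((d i - 1 : ℕ) : k) ≠ 0)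
    (hdvd : ∀ i j, i ≠ j → ¬ MvPolynomial.map (algebraMap k (AlgebraicClosure k)) (f i) ∣
      MvPolynomial.map (algebraMap k (AlgebraicClosure k)) (f j)) : FullMono (vv f d) := by
  obtain ⟨Ω, _, _, hA, a, b, hg⟩ := genL_ex (AlgebraicClosure k)
  letI : Algebra k Ω := ((algebraMap (AlgebraicClosure k) Ω).comp (algebraMap k (AlgebraicClosure k))).toAlgebra
  haveI : IsScalarTower k (AlgebraicClosure k) Ω := IsScalarTower.of_algebraMap_eq fun x => rfl
  have hd' : ∀ i, (d i : AlgebraicClosure k) ≠ 0 := by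
    intro i h0
    apply hd i
    apply (algebraMap k (AlgebraicClosure k)).injective
    simpa using h0
  have hd1' : ∀ i, ((d i - 1 : ℕ) : AlgebraicClosure k) ≠ 0 := by
    intro i h0
    apply hd1 i
    apply (algebraMap k (AlgebraicClosure k)).injective
    rw [map_natCast, h0, map_zero]
  have hd0 : ∀ i, d i ≠ 0 := fun i h0 => hd i (by rw [h0]; simp)
  set f' := fun i => MvPolynomial.map (algebraMap k (AlgebraicClosure k)) (f i) with hf'
  let c : Fin s → Ω := fun i => (gp (f' i) a b).coeff (d i)
  have hc : ∀ i, c i ≠ 0 := by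
    intro i h0
    have ha : Transcendental (AlgebraicClosure k) a := by
      have := hg.ind.transcendental 0
      simpa using this
    have h1 : c i = aeval a (lcp (d i) (f' i)) := gp_coeff (hs i).deg.le a b
    rw [h0] at h1
    exact ha ⟨_, lcp_ne (hs i).deg (hd0 i), h1.symm⟩
  have hdeg : ∀ i, (gp (f' i) a b).natDegree = d i := fun i =>
    le_antisymm (gp_deg (hs i).deg.le a b) (le_natDegree_of_ne_zero (hc i))
  choose r hr using fun i => roots_ex (gp (f' i) a b) (d i) (hdeg i)
  have hlc : ∀ i, (gp (f' i) a b).leadingCoeff = c i := by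
    intro i; rw [leadingCoeff, hdeg]
  simp only [hlc] at hr
  obtain ⟨hinj, hfull⟩ := full_perm hg f' d hs hd' hd1' hdvd c hc r hr
  let ι : MvPolynomial (Fin 2) (AlgebraicClosure k) →+* Ω := (MvPolynomial.aeval (R := AlgebraicClosure k) ![a, b]).toRingHom
  have hfix : ∀ γ : Ω →+* Ω, Fix (AlgebraicClosure k) a b γ → γ.comp ι = ι := by
    intro γ hγ
    apply MvPolynomial.ringHom_ext
    · intro x
      simp only [ι, RingHom.comp_apply, AlgHom.toRingHom_eq_coe, RingHom.coe_coe, MvPolynomial.aeval_C]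
      exact hγ.1 x
    · intro i
      fin_cases i
      · simpa [ι] using hγ.2.1
      · simpa [ι] using hγ.2.2
  let θ : MvPolynomial (Fin 2) k →ₐ[k] Ω := MvPolynomial.aeval ![a, b]
  have hθ : ∀ g, ι (MvPolynomial.map (algebraMap k (AlgebraicClosure k)) g) = θ g := fun g =>
    MvPolynomial.aeval_map_algebraMap _ _ _
  have hgpθ : ∀ i j, θ ((gp (f i) (MvPolynomial.X 0 : MvPolynomial (Fin 2) k) (MvPolynomial.X 1)).coeff j) =
      (gp (f' i) a b).coeff j := by
    intro i j
    rw [gp_hom, hf', gp_tower]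
    simp [θ]
  refine ⟨Ω, inferInstance, ι, fun i j => c i * r i j, hg.ind, ?_, ?_, ?_⟩
  · intro i x y hxy
    exact hinj i (mul_left_cancel₀ (hc i) hxy)
  · intro p
    rw [hθ, vv, map_mul, map_pow, hgpθ, hgpθ]
    exact cf_scale (r p.1) (c p.1) (hc p.1) _ (hr p.1) p.2
  · intro τ
    obtain ⟨γ, hγ, hγ'⟩ := hfull τ
    refine ⟨γ, hfix γ hγ, fun i j => ?_⟩
    rw [map_mul, hγ']
    congr 1
    have e : c i = θ ((gp (f i) (MvPolynomial.X 0 : MvPolynomial (Fin 2) k) (MvPolynomial.X 1)).coeff (d i)) :=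
      (hgpθ i _).symm
    rw [e, ← hθ, ← RingHom.comp_apply, hfix γ hγ]

end BW

namespace BW

lemma assoc_descend {k K : Type} [Field k] [Field K] [Algebra k K] (f g : MvPolynomial (Fin 2) k) (hf : f ≠ 0) (hg : g ≠ 0)
    (h : Associated (MvPolynomial.map (algebraMap k K) f) (MvPolynomial.map (algebraMap k K) g)) : Associated f g := by
  obtain ⟨u, hu⟩ := h
  obtain ⟨c, hc, hcu⟩ := MvPolynomial.isUnit_iff_eq_C_of_isReduced.mp u.isUnit
  obtain ⟨m, hm⟩ := MvPolynomial.ne_zero_iff.mp hf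
  rw [hcu] at hu
  have h1 := congrArg (MvPolynomial.coeff m) hu
  rw [mul_comm, MvPolynomial.coeff_C_mul, MvPolynomial.coeff_map, MvPolynomial.coeff_map] at h1
  have hm' : algebraMap k K (MvPolynomial.coeff m f) ≠ 0 := by
    rwa [Ne, map_eq_zero]
  have h2 : c = algebraMap k K (MvPolynomial.coeff m g / MvPolynomial.coeff m f) := by
    rw [map_div₀, eq_div_iff hm', h1]
  set c0 := MvPolynomial.coeff m g / MvPolynomial.coeff m f
  have h3 : f * MvPolynomial.C c0 = g := by
    apply MvPolynomial.map_injective _ (algebraMap k K).injective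
    rw [map_mul, MvPolynomial.map_C, ← h2, hu]
  have hc0 : c0 ≠ 0 := by
    intro h0
    rw [h0, map_zero, mul_zero] at h3
    exact hg h3.symm
  exact ⟨((isUnit_iff_ne_zero.mpr hc0).map MvPolynomial.C).unit, by simpa using h3⟩

/-- the local hypotheses on one polynomial -/
structure Good {k : Type} [Field k] (f : MvPolynomial (Fin 2) k) (d : ℕ) : Prop where
  irr : Irreducible f
  sm : Sm (MvPolynomial.map (algebraMap k (AlgebraicClosure k)) f) d
  deg : f.totalDegree = d
  h0 : (d : k) ≠ 0
  h1 : ((d - 1 : ℕ) : k) ≠ 0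

lemma Good.pos {k : Type} [Field k] {f : MvPolynomial (Fin 2) k} {d : ℕ} (h : Good f d) : 1 ≤ d := by
  rcases Nat.eq_zero_or_pos d with h0 | h0
  · exact absurd (by rw [h0]; simp) h.h0
  · exact h0

set_option maxHeartbeats 1000000 in
lemma core1 (A B s : ℕ) (d : Fin s → ℕ) (hdB : ∑ i, d i ≤ B) : ∃ N : ℕ, ∀ (k : Type) [Field k] [Fintype k],
    N ≤ Fintype.card k → ∀ f : Fin s → MvPolynomial (Fin 2) k, (∀ i, Good (f i) (d i)) →
      (∀ i j, i ≠ j → ¬ Associated (f i) (f j)) → ∃ T : Finset (k × k), A ≤ T.card ∧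
        ∀ z ∈ T, ∀ i, Irreducible (gp (f i) z.1 z.2) := by
  by_cases hd1 : ∀ i, 1 ≤ d i
  swap
  · refine ⟨0, fun k _ _ _ f hf => absurd (fun i => (hf i).pos) hd1⟩
  obtain ⟨N, hN⟩ := cheb s d (B * B + B) A hd1
  refine ⟨N, fun k _ _ hk f hf hna => ?_⟩
  have hdi : ∀ i, d i ≤ B := fun i => (Finset.single_le_sum (f := d) (fun _ _ => Nat.zero_le _) (Finset.mem_univ i)).trans hdB
  let c : Fin s → MvPolynomial (Fin 2) k := fun i =>
    (gp (f i) (MvPolynomial.X 0 : MvPolynomial (Fin 2) k) (MvPolynomial.X 1)).coeff (d i)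
  have hCD : ∀ i, CD (d i) (gp (f i) (MvPolynomial.X 0 : MvPolynomial (Fin 2) k) (MvPolynomial.X 1)) :=
    fun i => gp_CD (f i) (hf i).deg.le
  have hc : ∀ i, c i ≠ 0 := by
    intro i h0
    have h1 : c i = aeval (MvPolynomial.X 0 : MvPolynomial (Fin 2) k) (lcp (d i) (f i)) :=
      gp_coeff (hf i).deg.le _ _
    rw [h0] at h1
    exact MvPolynomial.transcendental_X k 0 ⟨_, lcp_ne (hf i).deg (by have := hd1 i; omega), h1.symm⟩
  have hfm : FullMono (vv f d) := by
    refine fullMono f d (fun i => (hf i).sm) (fun i => (hf i).h0) (fun i => (hf i).h1) ?_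
    intro i j hij hdvd
    have hirr : ∀ i, Irreducible (MvPolynomial.map (algebraMap k (AlgebraicClosure k)) (f i)) := fun i =>
      (hf i).sm.irr (by have := hd1 i; omega)
    exact hna i j hij (assoc_descend _ _ (hf i).irr.ne_zero (hf j).irr.ne_zero ((hirr i).associated_of_dvd (hirr j) hdvd))
  obtain ⟨T, hT, hT'⟩ := hN k hk (fun i => (hf i).h0) (vv f d) (by
    intro p
    unfold vv
    refine (MvPolynomial.totalDegree_mul _ _).trans ?_
    refine (add_le_add ((MvPolynomial.totalDegree_pow _ _).trans (Nat.mul_le_mul_left _ (hCD p.1 _))) (hCD p.1 _)).trans ?_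
    have h1 := hdi p.1
    have h2 : (d p.1 - 1 - (p.2 : ℕ)) * d p.1 ≤ B * B := Nat.mul_le_mul (by omega) h1
    omega) hfm (∏ i, c i) (Finset.prod_ne_zero_iff.mpr fun i _ => hc i) (by
    refine (MvPolynomial.totalDegree_finsetProd _ _).trans ?_
    refine (Finset.sum_le_sum fun i _ => hCD i (d i)).trans ?_
    exact hdB.trans (Nat.le_add_left _ _))
  refine ⟨T, hT, fun z hz i => ?_⟩
  obtain ⟨h1, h2⟩ := hT' z hz
  have h2 := h2 i
  rw [map_prod, Finset.prod_ne_zero_iff] at h1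
  have h1 := h1 i (Finset.mem_univ i)
  have key : ∀ j, MvPolynomial.eval ![z.1, z.2]
      ((gp (f i) (MvPolynomial.X 0 : MvPolynomial (Fin 2) k) (MvPolynomial.X 1)).coeff j) = (gp (f i) z.1 z.2).coeff j := by
    intro j
    have := gp_hom (MvPolynomial.aeval (R := k) ![z.1, z.2]) (f i) j
    refine Eq.trans (by rw [MvPolynomial.aeval_eq_eval]) (this.trans ?_)
    simp
  refine irr_scale (hd1 i) _ (gp_deg (hf i).deg.le _ _) (by rw [← key]; exact h1) ?_
  have e : (fun j : Fin (d i) => (gp (f i) z.1 z.2).coeff (d i) ^ (d i - 1 - (j : ℕ)) * (gp (f i) z.1 z.2).coeff j) =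
      fun j => MvPolynomial.eval ![z.1, z.2] (vv f d ⟨i, j⟩) := by
    funext j
    simp only [vv, map_mul, map_pow, key]
  rw [e]
  exact h2

lemma core2 (A B : ℕ) : ∃ N : ℕ, ∀ (k : Type) [Field k] [Fintype k],
    N ≤ Fintype.card k → ∀ (s : ℕ) (f : Fin s → MvPolynomial (Fin 2) k) (d : Fin s → ℕ), ∑ i, d i ≤ B →
      (∀ i, Good (f i) (d i)) →
      (∀ i j, i ≠ j → ¬ Associated (f i) (f j)) → ∃ T : Finset (k × k), A ≤ T.card ∧
        ∀ z ∈ T, ∀ i, Irreducible (gp (f i) z.1 z.2) := by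
  classical
  choose N hN using core1 A B
  refine ⟨∑ s ∈ Finset.range (B + 1), ∑ d : Fin s → Fin (B + 1),
    if h : ∑ i, (d i : ℕ) ≤ B then N s (fun i => d i) h else 0, ?_⟩
  intro k _ _ hk s f d hdB hf hna
  have hsB : s ≤ B := by
    refine le_trans ?_ hdB
    have : ∑ i : Fin s, 1 ≤ ∑ i, d i := Finset.sum_le_sum fun i _ => (hf i).pos
    simpa using this
  have hdi : ∀ i, d i ≤ B := fun i => (Finset.single_le_sum (f := d) (fun _ _ => Nat.zero_le _) (Finset.mem_univ i)).trans hdB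
  refine hN s d hdB k (le_trans ?_ hk) f hf hna
  refine le_trans ?_ (Finset.single_le_sum (f := fun s => ∑ d : Fin s → Fin (B + 1),
    if h : ∑ i, (d i : ℕ) ≤ B then N s (fun i => d i) h else 0) (fun _ _ => Nat.zero_le _) (Finset.mem_range.mpr (Nat.lt_succ_of_le hsB)))
  refine le_trans ?_ (Finset.single_le_sum (f := fun d : Fin s → Fin (B + 1) =>
    if h : ∑ i, (d i : ℕ) ≤ B then N s (fun i => d i) h else 0) (fun _ _ => Nat.zero_le _)
    (Finset.mem_univ (fun i => (⟨d i, Nat.lt_succ_of_le (hdi i)⟩ : Fin (B + 1)))))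
  simp only [dif_pos hdB]
  exact le_rfl

set_option maxHeartbeats 1000000 in
lemma core3 (A B : ℕ) : ∃ N : ℕ, ∀ (k : Type) [Field k] [Fintype k],
    N ≤ Fintype.card k → ∀ (s : ℕ) (f : Fin s → MvPolynomial (Fin 2) k) (d : Fin s → ℕ), ∑ i, d i ≤ B →
      (∀ i, Good (f i) (d i)) → ∃ T : Finset (k × k), A ≤ T.card ∧
        ∀ z ∈ T, ∀ i, Irreducible (gp (f i) z.1 z.2) := by
  classical
  obtain ⟨N, hN⟩ := core2 A B
  refine ⟨N, fun k _ _ hk s f d hdB hf => ?_⟩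
  let st : Setoid (Fin s) := (Associated.setoid (MvPolynomial (Fin 2) k)).comap f
  let e := Fintype.equivFin (Quotient st)
  let ρ : Fin (Fintype.card (Quotient st)) → Fin s := fun j => (e.symm j).out
  have hρ : Function.Injective ρ := by
    intro x y hxy
    apply e.symm.injective
    have := congrArg (Quotient.mk st) (show (e.symm x).out = (e.symm y).out from hxy)
    simpa using this
  obtain ⟨T, hT, hT'⟩ := hN k hk _ (fun j => f (ρ j)) (fun j => d (ρ j)) (by
    refine le_trans ?_ hdB
    rw [← Finset.sum_image (f := d) (s := Finset.univ) (g := ρ) (fun x _ y _ h => hρ h)]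
    exact Finset.sum_le_sum_of_subset (Finset.subset_univ _)) (fun j => hf _) (by
    intro i j hij hass
    apply hij
    apply e.symm.injective
    have h1 : Quotient.mk st (e.symm i).out = Quotient.mk st (e.symm j).out := Quotient.sound hass
    simpa using h1)
  refine ⟨T, hT, fun z hz i => ?_⟩
  have h1 := hT' z hz (e (Quotient.mk st i))
  have h2 : Associated (f (ρ (e (Quotient.mk st i)))) (f i) := by
    have h3 : Quotient.mk st (ρ (e (Quotient.mk st i))) = Quotient.mk st i := by simp [ρ]
    exact Quotient.exact h3
  refine (Associated.irreducible_iff ?_).mp h1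
  unfold gp
  exact h2.map _

end BW

/-- Bender–Wittenberg: for all positive integers `A` and `B` there exists
`N` such that for every finite field `𝔽_q` of characteristic `p` with `q > N` elements
the following holds. If `f₁(T,X),…,f_s(T,X) ∈ 𝔽_q[T,X]` are irreducible polynomials of
total degrees `d₁,…,d_s` with `d₁ + ⋯ + d_s ≤ B` such that for each `i`:
`p ∤ dᵢ(dᵢ−1)`, and the projective plane curve defined by the degree-`dᵢ` homogenization
`Fᵢ ∈ 𝔽_q[x,y,z]` of `fᵢ` is smooth (no common nontrivial zero of `Fᵢ` and its partial
derivatives over an algebraic closure), then there are at least `A` pairs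
`(a,b) ∈ 𝔽_q²` such that all `fᵢ(T, aT + b)` are irreducible in `𝔽_q[T]`. -/
theorem benderWittenberg (A B : ℕ) (hA : 0 < A) (hB : 0 < B) :
    ∃ N : ℕ, ∀ (F : Type) [Field F] [Fintype F], N < Fintype.card F →
      ∀ (s : ℕ) (f : Fin s → MvPolynomial (Fin 2) F) (d : Fin s → ℕ),
        (∀ i, Irreducible (f i)) →
        (∀ i, (f i).totalDegree = d i) →
        (∑ i, d i) ≤ B →
        (∀ i, ¬ (ringChar F ∣ d i * (d i - 1))) →
        (∀ i, ∀ x : Fin 3 → AlgebraicClosure F,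
          (MvPolynomial.eval x
              (MvPolynomial.map (algebraMap F (AlgebraicClosure F))
                (homogenization (d i) (f i))) = 0 ∧
            ∀ j : Fin 3, MvPolynomial.eval x
              (MvPolynomial.pderiv j
                (MvPolynomial.map (algebraMap F (AlgebraicClosure F))
                  (homogenization (d i) (f i)))) = 0) → x = 0) →
        A ≤ {ab : F × F | ∀ i, Irreducible
          (MvPolynomial.aeval
            ![(Polynomial.X : Polynomial F),
              Polynomial.C ab.1 * Polynomial.X + Polynomial.C ab.2] (f i))}.ncard := by
  obtain ⟨N, hN⟩ := BW.core3 A B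
  refine ⟨N, fun F _ _ hF s f d hirr hdeg hdB hchar hsm => ?_⟩
  obtain ⟨T, hT, hT'⟩ := hN F hF.le s f d hdB (fun i => by
    have h0 : ((d i * (d i - 1) : ℕ) : F) ≠ 0 := fun h => hchar i ((ringChar.spec F _).mp h)
    rw [Nat.cast_mul] at h0
    refine ⟨hirr i, ?_, hdeg i, left_ne_zero_of_mul h0, right_ne_zero_of_mul h0⟩
    refine BW.Sm.of_smooth ?_ ?_
    · rw [BW.totalDegree_map_inj (algebraMap F (AlgebraicClosure F)).injective, hdeg]
    · rw [← BW.hom_map]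
      exact hsm i)
  refine hT.trans ?_
  rw [← Set.ncard_coe_finset]
  exact Set.ncard_le_ncard (fun z hz => hT' z hz) (Set.toFinite _)
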